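/- Let G be a (plane) triangulation with n vertices and let d denote the number of vertices of degree three in G. Then G admits a monotone plane arc diagram with at most n − d − 4 biarcs, where every biarc is down-up. -/

import Mathlib

open Set Bornology

noncomputable section

/-! ### Plane drawings, planarity, and triangulations

A drawing of a simple graph in the plane: vertices are distinct points, edges are
simple continuous curves between their endpoints, interiors of edges avoid vertices,
and distinct edges have disjoint interiors (no two edges cross or touch). -/

structure PlaneDrawing {V : Type} (G : SimpleGraph V) where
  vert : V → ℝ × ℝ
  edge : Sym2 V → ℝ → ℝ × ℝ
  vert_inj : Function.Injective vert
  edge_cont : ∀ e ∈ G.edgeSet, ContinuousOn (edge e) (Set.Icc 0 1)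
  edge_injOn : ∀ e ∈ G.edgeSet, Set.InjOn (edge e) (Set.Icc 0 1)
  edge_ends : ∀ a b : V, G.Adj a b →
    ({edge s(a, b) 0, edge s(a, b) 1} : Set (ℝ × ℝ)) = {vert a, vert b}
  edge_int_vert : ∀ e ∈ G.edgeSet, ∀ x : V, vert x ∉ edge e '' Set.Ioo 0 1
  edge_disjoint : ∀ e ∈ G.edgeSet, ∀ f ∈ G.edgeSet, e ≠ f →
    edge e '' Set.Ioo 0 1 ∩ edge f '' Set.Ioo 0 1 = ∅

/-- A graph is planar if it admits a crossing-free drawing in the plane. -/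
def IsPlanar {V : Type} (G : SimpleGraph V) : Prop := Nonempty (PlaneDrawing G)

/-- A (plane) triangulation: a maximal planar graph on at least three vertices. -/
def IsTriangulation {V : Type} [Fintype V] (G : SimpleGraph V) : Prop :=
  3 ≤ Fintype.card V ∧ IsPlanar G ∧
    ∀ a b : V, a ≠ b → ¬ G.Adj a b →
      ¬ IsPlanar (G ⊔ SimpleGraph.fromEdgeSet {s(a, b)})

/-- The edges of `G` with both endpoints in `W`. -/
def edgesWithin {V : Type} (G : SimpleGraph V) (W : Set V) : Set (Sym2 V) :=
  {e | e ∈ G.edgeSet ∧ ∀ x ∈ e, x ∈ W}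

/-- The neighbours of `x` that lie in `W`. -/
def nbrsIn {V : Type} (G : SimpleGraph V) (W : Set V) (x : V) : Set V :=
  {y | y ∈ W ∧ G.Adj x y}

namespace PlaneDrawing

variable {V : Type} {G : SimpleGraph V}

def edgeImage (D : PlaneDrawing G) (e : Sym2 V) : Set (ℝ × ℝ) :=
  D.edge e '' Set.Icc 0 1

/-- The union of all vertex points and edge curves of the sub-drawing induced by `W`. -/
def imageOn (D : PlaneDrawing G) (W : Set V) : Set (ℝ × ℝ) :=
  D.vert '' W ∪ ⋃ e ∈ edgesWithin G W, D.edgeImage e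

/-- The outer face `F∘` of the sub-drawing induced by `W`: the union of the unbounded
connected components of the complement of the drawing. -/
def outerRegion (D : PlaneDrawing G) (W : Set V) : Set (ℝ × ℝ) :=
  {p | p ∉ D.imageOn W ∧ ¬ IsBounded (connectedComponentIn (D.imageOn W)ᶜ p)}

/-- The vertex `x` lies on the boundary cycle `C∘` of the outer face of `G[W]`. -/
def OnOuterVertex (D : PlaneDrawing G) (W : Set V) (x : V) : Prop :=
  D.vert x ∈ frontier (D.outerRegion W)

/-- The edge `e` lies on the boundary cycle `C∘` of the outer face of `G[W]`. -/
def OnOuterEdge (D : PlaneDrawing G) (W : Set V) (e : Sym2 V) : Prop :=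
  e ∈ edgesWithin G W ∧ D.edgeImage e ⊆ frontier (D.outerRegion W)

/-- The triangle `abc` bounds a face of the full drawing. -/
def IsFacialTriangle (D : PlaneDrawing G) (a b c : V) : Prop :=
  G.Adj a b ∧ G.Adj b c ∧ G.Adj a c ∧
    ∃ p, p ∉ D.imageOn Set.univ ∧
      frontier (connectedComponentIn (D.imageOn Set.univ)ᶜ p) =
        D.edgeImage s(a, b) ∪ D.edgeImage s(b, c) ∪ D.edgeImage s(a, c)

/-- Every inner (bounded) face of the sub-drawing induced by `W` is bounded by a
triangle of `G[W]`. -/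
def InnerFacesTriangulated (D : PlaneDrawing G) (W : Set V) : Prop :=
  ∀ p, p ∉ D.imageOn W → IsBounded (connectedComponentIn (D.imageOn W)ᶜ p) →
    ∃ a ∈ W, ∃ b ∈ W, ∃ c ∈ W, G.Adj a b ∧ G.Adj b c ∧ G.Adj a c ∧
      frontier (connectedComponentIn (D.imageOn W)ᶜ p) =
        D.edgeImage s(a, b) ∪ D.edgeImage s(b, c) ∪ D.edgeImage s(a, c)

end PlaneDrawing

/-- A graph is biconnected if it is connected and has no cut vertex. -/
def Biconnected {α : Type} (H : SimpleGraph α) : Prop :=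
  H.Connected ∧ ∀ x : α, (H.induce {y | y ≠ x}).Connected

/-- The subgraph of `G` induced by `W` (with the drawing `D`) is internally
triangulated: biconnected and every inner face is a triangle. -/
def InternallyTriangulatedOn {V : Type} {G : SimpleGraph V}
    (D : PlaneDrawing G) (W : Set V) : Prop :=
  Biconnected (G.induce W) ∧ D.InnerFacesTriangulated W

/-! ### Canonical orderings -/

/-- The vertex set `V_i = {v 1, …, v i}`. -/
def Vset {V : Type} (v : ℕ → V) (i : ℕ) : Set V := v '' Set.Icc 1 i

/-- `v 1, …, v i` is a canonical ordering for `G_i` (conditions (C1)–(C3)). -/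
def IsCanonicalOrdering {V : Type} {G : SimpleGraph V} (D : PlaneDrawing G)
    (i : ℕ) (v : ℕ → V) : Prop :=
  3 ≤ i ∧ Set.InjOn v (Set.Icc 1 i) ∧ G.Adj (v 1) (v 2) ∧
    ∀ m, 3 ≤ m → m ≤ i →
      InternallyTriangulatedOn D (Vset v m) ∧
      D.OnOuterEdge (Vset v m) s(v 1, v 2) ∧
      ∀ j, m < j → j ≤ i → D.vert (v j) ∈ D.outerRegion (Vset v m)

/-- The canonical ordering `v 1, …, v i` is extensible: it can be completed to a
canonical ordering of the whole graph. -/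
def ExtensibleOrd {V : Type} [Fintype V] {G : SimpleGraph V} (D : PlaneDrawing G)
    (i : ℕ) (v : ℕ → V) : Prop :=
  ∃ w : ℕ → V, (∀ m, 1 ≤ m → m ≤ i → w m = v m) ∧
    Set.BijOn w (Set.Icc 1 (Fintype.card V)) Set.univ ∧
    IsCanonicalOrdering D (Fintype.card V) w

/-- Append `x` to the sequence `v` at position `i + 1`. -/
def extendSeq {V : Type} (v : ℕ → V) (i : ℕ) (x : V) : ℕ → V :=
  fun m => if m = i + 1 then x else v m

/-- A vertex `x ∉ V_i` is eligible for `G_i` if appending it yields an extensible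
canonical ordering for `G_{i+1}`. -/
def Eligible {V : Type} [Fintype V] {G : SimpleGraph V} (D : PlaneDrawing G)
    (i : ℕ) (v : ℕ → V) (x : V) : Prop :=
  x ∉ Vset v i ∧ IsCanonicalOrdering D (i + 1) (extendSeq v i x) ∧
    ExtensibleOrd D (i + 1) (extendSeq v i x)

open Classical in
/-- The region `R_i(x)` associated to a vertex `x ∉ W` (with `W = V_i`): the outer
face of `G[W]` if `x` has at most one neighbour in `W`, and otherwise the part of the
outer face cut off from infinity by the edges from `x` to its neighbours on the
outer path. -/
def Rregion {V : Type} {G : SimpleGraph V} (D : PlaneDrawing G)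
    (W : Set V) (x : V) : Set (ℝ × ℝ) :=
  if (nbrsIn G W x).Subsingleton then D.outerRegion W
  else
    {p | p ∈ D.outerRegion W ∧
      p ∉ (⋃ y ∈ nbrsIn G W x, D.edgeImage s(x, y)) ∧
      IsBounded (connectedComponentIn
        (D.imageOn W ∪ ⋃ y ∈ nbrsIn G W x, D.edgeImage s(x, y))ᶜ p)}

/-- The open region `X_j` spanned by `u` and the part of the outer path between two
consecutive neighbours `a`, `b` of `u`. -/
def Xregion {V : Type} {G : SimpleGraph V} (D : PlaneDrawing G)
    (W : Set V) (u a b : V) : Set (ℝ × ℝ) :=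
  {p | p ∈ D.outerRegion W ∧
    p ∉ D.edgeImage s(u, a) ∪ D.edgeImage s(u, b) ∧
    IsBounded (connectedComponentIn
      (D.imageOn W ∪ D.edgeImage s(u, a) ∪ D.edgeImage s(u, b))ᶜ p)}

/-! ### Arc diagrams

Vertices are placed on a horizontal spine.  Every edge is drawn as a *mountain*
(a proper arc, i.e. halfcircle, above the spine), a *pocket* (a proper arc below the
spine), or a *down-up biarc* (two halfcircles, crossing the spine exactly once, the
left halfcircle below and the right halfcircle above the spine).  In particular all
edges are x-monotone and every biarc is down-up monotone.  Each edge also carries an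
amount of credits (used only for the credit-scheme lemmas). -/

inductive ArcKind : Type
  | mountain
  | pocket
  | biarc
deriving DecidableEq

structure ArcDiagram (V : Type) where
  pos : V → ℝ
  kind : Sym2 V → ArcKind
  crossPt : Sym2 V → ℝ
  credit : Sym2 V → ℝ

/-- Two intervals interleave (so that halfcircles over them on the same side of the
spine cross). -/
def Interleaved (p q : ℝ × ℝ) : Prop := p.1 < q.1 ∧ q.1 < p.2 ∧ p.2 < q.2

/-- The height above (or depth below) the spine, at abscissa `x`, of the halfcircle
with diameter from `l` to `r` centered on the spine. -/
def arcHeight (l r x : ℝ) : ℝ := Real.sqrt (((r - l) / 2) ^ 2 - (x - (l + r) / 2) ^ 2)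

namespace ArcDiagram

variable {V : Type}

def lo (A : ArcDiagram V) (e : Sym2 V) : ℝ :=
  Sym2.lift ⟨fun a b => min (A.pos a) (A.pos b), fun _ _ => min_comm _ _⟩ e

def hi (A : ArcDiagram V) (e : Sym2 V) : ℝ :=
  Sym2.lift ⟨fun a b => max (A.pos a) (A.pos b), fun _ _ => max_comm _ _⟩ e

/-- The halfcircles of the edge `e` above the spine (as intervals on the spine). -/
def upperArcs (A : ArcDiagram V) (e : Sym2 V) : List (ℝ × ℝ) :=
  match A.kind e with
  | ArcKind.mountain => [(A.lo e, A.hi e)]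
  | ArcKind.pocket => []
  | ArcKind.biarc => [(A.crossPt e, A.hi e)]

/-- The halfcircles of the edge `e` below the spine (as intervals on the spine). -/
def lowerArcs (A : ArcDiagram V) (e : Sym2 V) : List (ℝ × ℝ) :=
  match A.kind e with
  | ArcKind.mountain => []
  | ArcKind.pocket => [(A.lo e, A.hi e)]
  | ArcKind.biarc => [(A.lo e, A.crossPt e)]

/-- `A` is a plane arc diagram of the subgraph of `G` induced by `W`: vertex
positions on the spine are distinct, spine crossings of biarcs are in the interior
of the edge's span and distinct from all vertices and from each other, and no two
halfcircles on the same side of the spine cross. -/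
def IsPlaneOn (A : ArcDiagram V) (G : SimpleGraph V) (W : Set V) : Prop :=
  Set.InjOn A.pos W ∧
  (∀ e ∈ edgesWithin G W, A.kind e = ArcKind.biarc →
      A.lo e < A.crossPt e ∧ A.crossPt e < A.hi e ∧ ∀ x ∈ W, A.crossPt e ≠ A.pos x) ∧
  (∀ e ∈ edgesWithin G W, ∀ f ∈ edgesWithin G W, e ≠ f →
      A.kind e = ArcKind.biarc → A.kind f = ArcKind.biarc → A.crossPt e ≠ A.crossPt f) ∧
  (∀ e ∈ edgesWithin G W, ∀ f ∈ edgesWithin G W, e ≠ f →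
      (∀ p ∈ A.upperArcs e, ∀ q ∈ A.upperArcs f, ¬ Interleaved p q) ∧
      (∀ p ∈ A.lowerArcs e, ∀ q ∈ A.lowerArcs f, ¬ Interleaved p q))

/-- The number of biarcs of the diagram (on the subgraph induced by `W`). -/
def biarcCount (A : ArcDiagram V) (G : SimpleGraph V) (W : Set V) : ℕ :=
  {e | e ∈ edgesWithin G W ∧ A.kind e = ArcKind.biarc}.ncard

/-- The cost of the diagram: the total amount of credits on its edges. -/
def cost (A : ArcDiagram V) (G : SimpleGraph V) (W : Set V) : ℝ :=
  ∑ᶠ e ∈ edgesWithin G W, A.credit e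

/-- The edge `e` is (partly) vertically visible from above. -/
def OnUpperEnvelope (A : ArcDiagram V) (G : SimpleGraph V) (W : Set V)
    (e : Sym2 V) : Prop :=
  e ∈ edgesWithin G W ∧ ∃ p ∈ A.upperArcs e, ∃ x : ℝ, p.1 < x ∧ x < p.2 ∧
    ∀ f ∈ edgesWithin G W, f ≠ e → ∀ q ∈ A.upperArcs f, q.1 < x → x < q.2 →
      arcHeight q.1 q.2 x < arcHeight p.1 p.2 x

/-- The edge `e` is (partly) vertically visible from below. -/
def OnLowerEnvelope (A : ArcDiagram V) (G : SimpleGraph V) (W : Set V)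
    (e : Sym2 V) : Prop :=
  e ∈ edgesWithin G W ∧ ∃ p ∈ A.lowerArcs e, ∃ x : ℝ, p.1 < x ∧ x < p.2 ∧
    ∀ f ∈ edgesWithin G W, f ≠ e → ∀ q ∈ A.lowerArcs f, q.1 < x → x < q.2 →
      arcHeight q.1 q.2 x < arcHeight p.1 p.2 x

end ArcDiagram

/-! ### The invariants (I1)–(I5) of valid resp. extensible arc diagrams -/

/-- Invariants (I1)–(I4): `A` is a valid arc diagram for the subgraph of `G` induced
by `W` (relative to the plane embedding `D` of `G`, the starting vertices `v1, v2`,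
and the constant `χ`).  (I1) every edge is a proper arc or a down-up biarc and every
edge on the upper envelope is a proper arc; (I2) every mountain whose left endpoint
lies on `C∘(G[W]) \ {v2}` carries one credit; (I3) every biarc carries one credit;
(I4) every pocket on `P∘(G[W])` carries `χ` credits. -/
def ValidDiagram {V : Type} {G : SimpleGraph V} (D : PlaneDrawing G)
    (W : Set V) (v1 v2 : V) (χ : ℝ) (A : ArcDiagram V) : Prop :=
  A.IsPlaneOn G W ∧
  (∀ e ∈ edgesWithin G W, 0 ≤ A.credit e) ∧
  (∀ e, A.OnUpperEnvelope G W e → A.kind e ≠ ArcKind.biarc) ∧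
  (∀ a b : V, a ∈ W → b ∈ W → G.Adj a b → A.kind s(a, b) = ArcKind.mountain →
      A.pos a < A.pos b → D.OnOuterVertex W a → a ≠ v2 → 1 ≤ A.credit s(a, b)) ∧
  (∀ e ∈ edgesWithin G W, A.kind e = ArcKind.biarc → 1 ≤ A.credit e) ∧
  (∀ e ∈ edgesWithin G W, A.kind e = ArcKind.pocket → D.OnOuterEdge W e →
      e ≠ s(v1, v2) → χ ≤ A.credit e)

/-- Invariants (I1)–(I5): additionally `v1` is leftmost and `v2` rightmost on the
spine, the edge `v1 v2` forms the lower envelope, and the edges of `P∘(G[W])` form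
the upper envelope. -/
def ExtensibleDiagram {V : Type} {G : SimpleGraph V} (D : PlaneDrawing G)
    (W : Set V) (v1 v2 : V) (χ : ℝ) (A : ArcDiagram V) : Prop :=
  ValidDiagram D W v1 v2 χ A ∧ v1 ∈ W ∧ v2 ∈ W ∧
  (∀ w ∈ W, w ≠ v1 → A.pos v1 < A.pos w) ∧
  (∀ w ∈ W, w ≠ v2 → A.pos w < A.pos v2) ∧
  (∀ e ∈ edgesWithin G W, (A.OnLowerEnvelope G W e ↔ e = s(v1, v2))) ∧
  (∀ e ∈ edgesWithin G W, (A.OnUpperEnvelope G W e ↔ D.OnOuterEdge W e ∧ e ≠ s(v1, v2)))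

/-! ### Profiles, problematic vertices, pivots and the covering relation -/

/-- `x` has type `T(2, ⌢)`: degree two in `G_{i+1}` and its profile is a single
mountain. -/
def TypeT2 {V : Type} (A : ArcDiagram V) (G : SimpleGraph V) (W : Set V)
    (x : V) : Prop :=
  ∃ a b : V, nbrsIn G W x = {a, b} ∧ A.pos a < A.pos b ∧ G.Adj a b ∧
    A.kind s(a, b) = ArcKind.mountain

/-- `x` has type `T(3, ⌢⌢)`. -/
def TypeT3mm {V : Type} (A : ArcDiagram V) (G : SimpleGraph V) (W : Set V)
    (x : V) : Prop :=
  ∃ a b c : V, nbrsIn G W x = {a, b, c} ∧ A.pos a < A.pos b ∧ A.pos b < A.pos c ∧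
    G.Adj a b ∧ G.Adj b c ∧
    A.kind s(a, b) = ArcKind.mountain ∧ A.kind s(b, c) = ArcKind.mountain

/-- `x` has type `T(4, ⌢⌢⌢)`. -/
def TypeT4 {V : Type} (A : ArcDiagram V) (G : SimpleGraph V) (W : Set V)
    (x : V) : Prop :=
  ∃ a b c d : V, nbrsIn G W x = {a, b, c, d} ∧
    A.pos a < A.pos b ∧ A.pos b < A.pos c ∧ A.pos c < A.pos d ∧
    G.Adj a b ∧ G.Adj b c ∧ G.Adj c d ∧
    A.kind s(a, b) = ArcKind.mountain ∧ A.kind s(b, c) = ArcKind.mountain ∧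
    A.kind s(c, d) = ArcKind.mountain

/-- `x` has type `T(3, ⌢⌣)`. -/
def TypeT3ms {V : Type} (A : ArcDiagram V) (G : SimpleGraph V) (W : Set V)
    (x : V) : Prop :=
  ∃ a b c : V, nbrsIn G W x = {a, b, c} ∧ A.pos a < A.pos b ∧ A.pos b < A.pos c ∧
    G.Adj a b ∧ G.Adj b c ∧
    A.kind s(a, b) = ArcKind.mountain ∧ A.kind s(b, c) = ArcKind.pocket

/-- An eligible vertex is problematic if it has one of the four types
`T(2,⌢)`, `T(3,⌢⌢)`, `T(4,⌢⌢⌢)`, `T(3,⌢⌣)`. -/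
def Problematic {V : Type} (A : ArcDiagram V) (G : SimpleGraph V) (W : Set V)
    (x : V) : Prop :=
  TypeT2 A G W x ∨ TypeT3mm A G W x ∨ TypeT4 A G W x ∨ TypeT3ms A G W x

def HasLeftPivotType {V : Type} (A : ArcDiagram V) (G : SimpleGraph V) (W : Set V)
    (x : V) : Prop :=
  TypeT2 A G W x ∨ TypeT3mm A G W x ∨ TypeT4 A G W x

def HasRightPivotType {V : Type} (A : ArcDiagram V) (G : SimpleGraph V) (W : Set V)
    (x : V) : Prop :=
  TypeT3ms A G W x

def IsLeftmostNbr {V : Type} (A : ArcDiagram V) (G : SimpleGraph V) (W : Set V)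
    (x l : V) : Prop :=
  l ∈ nbrsIn G W x ∧ ∀ y ∈ nbrsIn G W x, A.pos l ≤ A.pos y

def IsRightmostNbr {V : Type} (A : ArcDiagram V) (G : SimpleGraph V) (W : Set V)
    (x r : V) : Prop :=
  r ∈ nbrsIn G W x ∧ ∀ y ∈ nbrsIn G W x, A.pos y ≤ A.pos r

/-- `q` is the pivot `p(x)` of the problematic vertex `x`: its rightmost neighbour on
the outer path if `x` has right pivot type `T(3,⌢⌣)`, its leftmost neighbour
otherwise. -/
def IsPivot {V : Type} (A : ArcDiagram V) (G : SimpleGraph V) (W : Set V)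
    (x q : V) : Prop :=
  (HasRightPivotType A G W x ∧ IsRightmostNbr A G W x q) ∨
  (HasLeftPivotType A G W x ∧ IsLeftmostNbr A G W x q)

/-- `z = pc(x)`: the vertex covering the pivot edge `x·p(x)`, i.e. the vertex outside
`W ∪ {x}` forming a triangular face of `G` with this edge. -/
def PivotCover {V : Type} {G : SimpleGraph V} (D : PlaneDrawing G) (A : ArcDiagram V)
    (W : Set V) (x z : V) : Prop :=
  z ∉ W ∧ z ≠ x ∧ ∃ q : V, IsPivot A G W x q ∧ D.IsFacialTriangle x q z

/-- `z` covers the edge `e` of the outer path: `z ∉ W` forms a triangular face of `G`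
with the two endpoints of `e`. -/
def CoversEdge {V : Type} {G : SimpleGraph V} (D : PlaneDrawing G)
    (W : Set V) (z : V) (e : Sym2 V) : Prop :=
  z ∉ W ∧ ∃ a b : V, e = s(a, b) ∧ D.IsFacialTriangle a b z

/-- `a` and `b` are consecutive neighbours (from left to right) of `x` in `W`. -/
def ConsecNbrs {V : Type} (A : ArcDiagram V) (G : SimpleGraph V) (W : Set V)
    (x a b : V) : Prop :=
  a ∈ nbrsIn G W x ∧ b ∈ nbrsIn G W x ∧ A.pos a < A.pos b ∧
    ∀ c ∈ nbrsIn G W x, ¬ (A.pos a < A.pos c ∧ A.pos c < A.pos b)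

/-- `e` is an edge of the profile `pr(x)`: an edge of the outer path between two
consecutive neighbours of `x`. -/
def ProfileEdge {V : Type} (A : ArcDiagram V) (G : SimpleGraph V) (W : Set V)
    (x : V) (e : Sym2 V) : Prop :=
  ∃ a b : V, e = s(a, b) ∧ ConsecNbrs A G W x a b ∧ G.Adj a b

/-! ### Construction sequences of planar 3-trees and their dual face trees -/

/-- A construction sequence of a planar 3-tree `G`: starting from the triangle on the
first three vertices, each subsequent vertex `ord j` is inserted into a face `F j`
(a triangle of three earlier vertices that was created earlier and not yet
subdivided) and joined to its three vertices. -/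
structure P3TConstruction (V : Type) [Fintype V] [DecidableEq V]
    (G : SimpleGraph V) where
  n : ℕ
  three_le : 3 ≤ n
  card_eq : Fintype.card V = n
  ord : Fin n ≃ V
  F : Fin n → Finset V
  adj_base : ∀ i j : Fin n, (i : ℕ) < 3 → (j : ℕ) < 3 → (G.Adj (ord i) (ord j) ↔ i ≠ j)
  adj_ins : ∀ j : Fin n, 3 ≤ (j : ℕ) → ∀ i : Fin n, i < j →
    (G.Adj (ord i) (ord j) ↔ ord i ∈ F j)
  F_card : ∀ j : Fin n, 3 ≤ (j : ℕ) → (F j).card = 3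
  F_sub : ∀ j : Fin n, 3 ≤ (j : ℕ) → ∀ u ∈ F j, ∃ i : Fin n, i < j ∧ ord i = u
  F_inj : ∀ j k : Fin n, 3 ≤ (j : ℕ) → 3 ≤ (k : ℕ) → F j = F k → j = k
  F_created : ∀ j : Fin n, 3 ≤ (j : ℕ) →
    F j = {ord ⟨0, Nat.lt_of_lt_of_le (by norm_num) three_le⟩,
           ord ⟨1, Nat.lt_of_lt_of_le (by norm_num) three_le⟩,
           ord ⟨2, Nat.lt_of_lt_of_le (by norm_num) three_le⟩} ∨
      ∃ i : Fin n, i < j ∧ 3 ≤ (i : ℕ) ∧ ∃ x ∈ F i, F j = insert (ord i) ((F i).erase x)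

namespace P3TConstruction

variable {V : Type} [Fintype V] [DecidableEq V] {G : SimpleGraph V}

/-- The root face `v1 v2 v3` of the dual face tree. -/
def rootFace (C : P3TConstruction V G) : Finset V :=
  {C.ord ⟨0, Nat.lt_of_lt_of_le (by norm_num) C.three_le⟩,
   C.ord ⟨1, Nat.lt_of_lt_of_le (by norm_num) C.three_le⟩,
   C.ord ⟨2, Nat.lt_of_lt_of_le (by norm_num) C.three_le⟩}

/-- The child face of `F j` obtained by replacing its vertex `x` with `ord j`. -/
def childFace (C : P3TConstruction V G) (j : Fin C.n) (x : V) : Finset V :=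
  insert (C.ord j) ((C.F j).erase x)

/-- A face is internal (has a face vertex, i.e. is subdivided at some point, i.e. is
active at some point) iff some vertex is inserted into it. -/
def IsInternalFace (C : P3TConstruction V G) (f : Finset V) : Prop :=
  ∃ j : Fin C.n, 3 ≤ (j : ℕ) ∧ C.F j = f

/-- `g` is a child of `f` in the dual face tree. -/
def IsChildOf (C : P3TConstruction V G) (g f : Finset V) : Prop :=
  ∃ j : Fin C.n, 3 ≤ (j : ℕ) ∧ C.F j = f ∧ ∃ x ∈ C.F j, g = C.childFace j x

/-- `f` is a node of the dual face tree `𝒯`. -/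
def IsFace (C : P3TConstruction V G) (f : Finset V) : Prop :=
  f = C.rootFace ∨ ∃ f' : Finset V, C.IsChildOf f f'

/-- The grand-degree of a face: the maximal number of active child faces over the
whole construction, i.e. the number of its internal (non-leaf) children in `𝒯`. -/
def gd (C : P3TConstruction V G) (f : Finset V) : ℕ :=
  {g : Finset V | C.IsChildOf g f ∧ C.IsInternalFace g}.ncard

end P3TConstruction

/-- `G` is a Kleetope over the sub-triangulation on the vertex set `S`: both `G` and
`G[S]` are plane triangulations, every vertex outside `S` has exactly the three
vertices of a triangle of `G[S]` as neighbours (so it is inserted into a face of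
`G[S]`), and the number of inserted vertices equals the number `2|S| - 4` of faces
of `G[S]` (so that exactly one vertex is inserted into each face). -/
def IsKleetopeOf {V : Type} [Fintype V] [DecidableEq V]
    (G : SimpleGraph V) (S : Finset V) : Prop :=
  IsTriangulation G ∧ IsTriangulation (G.induce (S : Set V)) ∧
    (∀ v : V, v ∉ S →
      (G.neighborSet v).ncard = 3 ∧ G.neighborSet v ⊆ (S : Set V) ∧
        ∀ a ∈ G.neighborSet v, ∀ b ∈ G.neighborSet v, a ≠ b → G.Adj a b) ∧
    Fintype.card V + 4 = 3 * S.card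

end

set_option linter.unusedSectionVars false
set_option linter.unusedDecidableInType false
set_option linter.unusedFintypeInType false
set_option linter.unusedSimpArgs false

/-! ### Chains modulo two and combinatorial duals -/

namespace ArcDual

variable {V : Type} [Fintype V] [DecidableEq V] {F : Type}

/-- The chain `x` is supported on the edges of `T`. -/
def SuppOn (T : SimpleGraph V) (x : Sym2 V → ZMod 2) : Prop := ∀ e, e ∉ T.edgeSet → x e = 0

/-- The boundary modulo two of a chain of edges. -/
def bd (x : Sym2 V → ZMod 2) (v : V) : ZMod 2 := ∑ w, x s(v, w)

open Classical in
/-- The edges of `T` separating faces with different values of `S`. -/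
noncomputable def cobd (T : SimpleGraph V) (l r : Sym2 V → F) (S : F → ZMod 2) (e : Sym2 V) :
    ZMod 2 := if e ∈ T.edgeSet then S (l e) + S (r e) else 0

/-- The even chains of `T` are exactly the coboundaries of face functions. -/
def IsDual (T : SimpleGraph V) (l r : Sym2 V → F) : Prop :=
  ∀ x, (SuppOn T x ∧ bd x = 0) ↔ ∃ S : F → ZMod 2, x = cobd T l r S

/-- The graph `T` has a combinatorial dual with `k` faces. -/
def HasDualCard (T : SimpleGraph V) (k : ℕ) : Prop :=
  ∃ l r : Sym2 V → Fin k, IsDual T l r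

/-- The graph `T` has a combinatorial dual. -/
def HasDual (T : SimpleGraph V) : Prop := ∃ k, HasDualCard T k

/-- Extend a graph by one edge. -/
def addEdge (T : SimpleGraph V) (a b : V) : SimpleGraph V :=
  T ⊔ SimpleGraph.fromEdgeSet {s(a, b)}

theorem mem_addEdge {T : SimpleGraph V} {a b : V} (h : a ≠ b) (e : Sym2 V) :
    e ∈ (addEdge T a b).edgeSet ↔ e ∈ T.edgeSet ∨ e = s(a, b) := by
  unfold addEdge
  rw [SimpleGraph.edgeSet_sup, SimpleGraph.edgeSet_fromEdgeSet]
  constructor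
  · rintro (h | h)
    · exact Or.inl h
    · exact Or.inr h.1
  · rintro (h' | rfl)
    · exact Or.inl h'
    · exact Or.inr ⟨rfl, by simpa using h⟩

theorem bd_add (x y : Sym2 V → ZMod 2) : bd (x + y) = bd x + bd y := by
  funext v; simp [bd, Finset.sum_add_distrib]

theorem bd_zero : bd (0 : Sym2 V → ZMod 2) = 0 := by
  funext v; simp [bd]

theorem bd_single {a b : V} (h : a ≠ b) :
    bd (Pi.single s(a, b) 1) = Pi.single a 1 + Pi.single b 1 := by
  funext v
  simp only [bd, Pi.add_apply, Pi.single_apply]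
  by_cases ha : v = a
  · subst ha
    have : ∀ w, (s(v, w) = s(v, b)) ↔ w = b := by
      intro w; simp [h]
    simp [this, h]
  · by_cases hb : v = b
    · subst hb
      have : ∀ w, (s(v, w) = s(a, v)) ↔ w = a := by
        intro w; rw [Sym2.eq_swap (a := a)]; simp [ha]
      simp [this, ha]
    · have : ∀ w, ¬ (s(v, w) = s(a, b)) := by
        intro w; simp [ha, hb]
      simp [this, ha, hb]

theorem zadd_self (x : ZMod 2) : x + x = 0 := CharTwo.add_self_eq_zero x

theorem zadd_self' {α : Type*} (x : α → ZMod 2) : x + x = 0 := by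
  funext a; exact zadd_self _

theorem zne_zero {x : ZMod 2} : x ≠ 0 ↔ x = 1 := by revert x; decide

theorem zadd_eq_zero {x y : ZMod 2} : x + y = 0 ↔ x = y := by revert x y; decide

theorem cobd_of_mem {T : SimpleGraph V} {l r : Sym2 V → F} {S : F → ZMod 2} {e : Sym2 V}
    (h : e ∈ T.edgeSet) : cobd T l r S e = S (l e) + S (r e) := by
  simp [cobd, h]

theorem cobd_of_notMem {T : SimpleGraph V} {l r : Sym2 V → F} {S : F → ZMod 2} {e : Sym2 V}
    (h : e ∉ T.edgeSet) : cobd T l r S e = 0 := by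
  simp [cobd, h]

theorem cobd_add (T : SimpleGraph V) (l r : Sym2 V → F) (S S' : F → ZMod 2) :
    cobd T l r (S + S') = cobd T l r S + cobd T l r S' := by
  funext e; by_cases h : e ∈ T.edgeSet
  · simp [cobd_of_mem h]; ring
  · simp [cobd_of_notMem h]

theorem cobd_const (T : SimpleGraph V) (l r : Sym2 V → F) (c : ZMod 2) :
    cobd T l r (fun _ => c) = 0 := by
  funext e; by_cases h : e ∈ T.edgeSet
  · simp [cobd_of_mem h, zadd_self]
  · simp [cobd_of_notMem h]

theorem suppOn_cobd (T : SimpleGraph V) (l r : Sym2 V → F) (S : F → ZMod 2) :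
    SuppOn T (cobd T l r S) := fun _ h => cobd_of_notMem h

theorem SuppOn.add {T : SimpleGraph V} {x y : Sym2 V → ZMod 2} (hx : SuppOn T x)
    (hy : SuppOn T y) : SuppOn T (x + y) := fun e he => by simp [hx e he, hy e he]

theorem suppOn_single {T : SimpleGraph V} {e : Sym2 V} (h : e ∈ T.edgeSet) :
    SuppOn T (Pi.single e 1) := fun f hf => by
  rw [Pi.single_apply, if_neg]; rintro rfl; exact hf h

theorem SuppOn.mono {T T' : SimpleGraph V} (h : T ≤ T') {x : Sym2 V → ZMod 2}
    (hx : SuppOn T x) : SuppOn T' x :=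
  fun e he => hx e fun h' => he (SimpleGraph.edgeSet_mono h h')

theorem IsDual.bd_cobd {T : SimpleGraph V} {l r : Sym2 V → F} (h : IsDual T l r)
    (S : F → ZMod 2) : bd (cobd T l r S) = 0 := ((h _).2 ⟨S, rfl⟩).2

/-- Parity of the number of edges leaving a set of vertices. -/
theorem sum_bd_eq_zero_of_closed (A : Finset V) (y : Sym2 V → ZMod 2)
    (hd : ∀ v, y s(v, v) = 0) (h : ∀ v ∈ A, ∀ w, w ∉ A → y s(v, w) = 0) :
    ∑ v ∈ A, bd y v = 0 := by
  have h1 : ∑ v ∈ A, bd y v = ∑ v ∈ A, ∑ w ∈ A, y s(v, w) := by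
    refine Finset.sum_congr rfl fun v hv => ?_
    unfold bd
    symm
    apply Finset.sum_subset (Finset.subset_univ _)
    intro w _ hw; exact h v hv w hw
  rw [h1, ← Finset.sum_product']
  refine Finset.sum_involution (fun p _ => (p.2, p.1)) ?_ ?_ ?_ ?_
  · rintro ⟨v, w⟩ _
    simp only
    rw [Sym2.eq_swap]; exact zadd_self _
  · rintro ⟨v, w⟩ _ hne heq
    simp only [Prod.mk.injEq] at heq
    obtain ⟨rfl, _⟩ := heq
    exact hne (hd _)
  · rintro ⟨v, w⟩ hm; simp only [Finset.mem_product] at hm ⊢; exact hm.symm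
  · rintro ⟨v, w⟩ _; rfl

theorem SuppOn.diag {T : SimpleGraph V} {x : Sym2 V → ZMod 2} (hx : SuppOn T x) (v : V) :
    x s(v, v) = 0 := hx _ (by simp)

theorem exists_chain_of_reachable {H : SimpleGraph V} {a b : V} (h : H.Reachable a b) :
    ∃ y, SuppOn H y ∧ bd y = Pi.single a 1 + Pi.single b 1 := by
  obtain ⟨p⟩ := h
  induction p with
  | nil => exact ⟨0, fun _ _ => rfl, by rw [bd_zero, zadd_self']⟩
  | @cons u v w huv p ih =>
    obtain ⟨y, hy, hb⟩ := ih
    refine ⟨Pi.single s(u, v) 1 + y, (suppOn_single (by simpa using huv)).add hy, ?_⟩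
    rw [bd_add, bd_single huv.ne, hb]
    have := zadd_self' (Pi.single v 1 : V → ZMod 2)
    linear_combination (exp := 1) this

theorem reachable_of_chain {H : SimpleGraph V} {a b : V} {y : Sym2 V → ZMod 2}
    (hy : SuppOn H y) (hb : bd y = Pi.single a 1 + Pi.single b 1) : H.Reachable a b := by
  classical
  by_contra hab
  have := sum_bd_eq_zero_of_closed (Finset.univ.filter (H.Reachable a)) y hy.diag (by
    intro v hv w hw
    simp only [Finset.mem_filter, Finset.mem_univ, true_and] at hv hw
    apply hy
    intro hvw
    exact hw (hv.trans (SimpleGraph.Adj.reachable (by simpa using hvw))))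
  rw [hb] at this
  simp [Finset.sum_add_distrib, Pi.single_apply, hab] at this

theorem IsDual.hasDualCard {T : SimpleGraph V} [Fintype F] {l r : Sym2 V → F}
    (h : IsDual T l r) : HasDualCard T (Fintype.card F) := by
  classical
  let φ := Fintype.equivFin F
  refine ⟨fun e => φ (l e), fun e => φ (r e), fun x => (h x).trans ⟨?_, ?_⟩⟩
  · rintro ⟨S, rfl⟩
    refine ⟨fun i => S (φ.symm i), ?_⟩
    funext e; by_cases he : e ∈ T.edgeSet
    · simp [cobd_of_mem he]
    · simp [cobd_of_notMem he]
  · rintro ⟨S, rfl⟩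
    refine ⟨fun i => S (φ i), ?_⟩
    funext e; by_cases he : e ∈ T.edgeSet
    · simp [cobd_of_mem he]
    · simp [cobd_of_notMem he]

/-- Criterion for a dual of a graph extended by one edge. -/
theorem isDual_addEdge {F' : Type} {T : SimpleGraph V} {a b : V} (hab : a ≠ b)
    {l' r' : Sym2 V → F'}
    (heven : ∀ S, bd (cobd (addEdge T a b) l' r' S) = 0)
    (hsurj : ∀ x, SuppOn T x → bd x = 0 → ∃ S, x = cobd (addEdge T a b) l' r' S)
    (hone : ∃ S, cobd (addEdge T a b) l' r' S s(a, b) = 1) :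
    IsDual (addEdge T a b) l' r' := by
  have key : ∀ x, SuppOn (addEdge T a b) x → bd x = 0 → x s(a, b) = 0 →
      ∃ S, x = cobd (addEdge T a b) l' r' S := by
    intro x hx hbx h0
    refine hsurj x (fun e he => ?_) hbx
    by_cases hea : e = s(a, b)
    · rw [hea, h0]
    · exact hx e (by rw [mem_addEdge hab]; tauto)
  intro x
  constructor
  · rintro ⟨hx, hbx⟩
    by_cases h0 : x s(a, b) = 0
    · exact key x hx hbx h0
    · obtain ⟨S, hS⟩ := hone
      obtain ⟨S', hS'⟩ := key (x + cobd (addEdge T a b) l' r' S)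
        (hx.add (suppOn_cobd _ _ _ _)) (by rw [bd_add, hbx, heven]; rfl)
        (by rw [Pi.add_apply, hS, zne_zero.1 h0]; rfl)
      refine ⟨S' + S, ?_⟩
      rw [cobd_add, ← hS', add_assoc, zadd_self', add_zero]
  · rintro ⟨S, rfl⟩
    exact ⟨suppOn_cobd _ _ _ _, heven S⟩

end ArcDual

namespace ArcDual

variable {V : Type} [Fintype V] [DecidableEq V] {F : Type}

/-- The graph `T` is edge-maximal among graphs with a combinatorial dual. -/
def MaxDual (T : SimpleGraph V) : Prop :=
  HasDual T ∧ ∀ a b, a ≠ b → ¬ T.Adj a b → ¬ HasDual (addEdge T a b)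

/-- The graph obtained from `T` by isolating the vertex `v`. -/
def isolate (T : SimpleGraph V) (v : V) : SimpleGraph V where
  Adj a b := T.Adj a b ∧ a ≠ v ∧ b ≠ v
  symm := ⟨fun _ _ h => ⟨h.1.symm, h.2.2, h.2.1⟩⟩
  loopless := ⟨fun _ h => h.1.ne rfl⟩

theorem isolate_le (T : SimpleGraph V) (v : V) : isolate T v ≤ T := fun _ _ h => h.1

theorem MaxDual.reachable {T : SimpleGraph V} (h : MaxDual T) (a b : V) : T.Reachable a b := by
  classical
  by_contra hab
  have hne : a ≠ b := by rintro rfl; exact hab (SimpleGraph.Reachable.refl _)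
  have hadj : ¬ T.Adj a b := fun h => hab h.reachable
  refine h.2 a b hne hadj ?_
  obtain ⟨k, l, r, hd⟩ := h.1
  have hform : ∀ S : Option (Fin k) → ZMod 2,
      cobd (addEdge T a b) (fun e => if e = s(a, b) then none else some (l e))
        (fun e => if e = s(a, b) then none else some (r e)) S
      = cobd T l r (fun f => S (some f)) := by
    intro S; funext e
    by_cases he : e = s(a, b)
    · rw [cobd_of_mem (by rw [mem_addEdge hne]; exact Or.inr he),
        cobd_of_notMem (by rw [he]; simpa using hadj)]
      simp [he, zadd_self]
    · by_cases heT : e ∈ T.edgeSet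
      · rw [cobd_of_mem (by rw [mem_addEdge hne]; exact Or.inl heT), cobd_of_mem heT]
        simp [he]
      · rw [cobd_of_notMem (by rw [mem_addEdge hne]; tauto), cobd_of_notMem heT]
  refine ⟨_, IsDual.hasDualCard (F := Option (Fin k))
    (l := fun e => if e = s(a, b) then none else some (l e))
    (r := fun e => if e = s(a, b) then none else some (r e)) fun x => ⟨?_, ?_⟩⟩
  · rintro ⟨hx, hbx⟩
    have hT : ∀ y, SuppOn (addEdge T a b) y → y s(a, b) = 0 → SuppOn T y := by
      intro y hy h0 e he
      by_cases hea : e = s(a, b)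
      · rw [hea, h0]
      · exact hy e (by rw [mem_addEdge hne]; tauto)
    have h0 : x s(a, b) = 0 := by
      by_contra h0
      refine hab (reachable_of_chain (y := x + Pi.single s(a, b) 1) (hT _ ?_ ?_) ?_)
      · exact hx.add (suppOn_single (by rw [mem_addEdge hne]; exact Or.inr rfl))
      · rw [Pi.add_apply, zne_zero.1 h0]; simp [zadd_self]
      · rw [bd_add, hbx, bd_single hne, zero_add]
    obtain ⟨S, hS⟩ := (hd x).1 ⟨hT x hx h0, hbx⟩
    exact ⟨fun o => o.elim 0 S, by rw [hform]; exact hS⟩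
  · rintro ⟨S, rfl⟩
    exact ⟨suppOn_cobd _ _ _ _, by rw [hform]; exact hd.bd_cobd _⟩

/-- Restriction of a chain to the edges that meet `A`. -/
noncomputable def restr (A : Set V) (x : Sym2 V → ZMod 2) (e : Sym2 V) : ZMod 2 :=
  open Classical in if ∃ w ∈ e, w ∈ A then x e else 0

theorem bd_restr {T : SimpleGraph V} {v : V} {A : Set V}
    (hA : ∀ u w, T.Adj u w → u ∈ A → w ≠ v → w ∈ A) {x : Sym2 V → ZMod 2}
    (hx : SuppOn T x) (hb : bd x = 0) : bd (restr A x) = 0 := by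
  classical
  have hne : ∀ w, w ≠ v → bd (restr A x) w = 0 := by
    intro w hw
    by_cases hwA : w ∈ A
    · have hbw : bd x w = 0 := congrFun hb w
      rw [← hbw]
      refine Finset.sum_congr rfl fun u _ => ?_
      have : ∃ z ∈ s(w, u), z ∈ A := ⟨w, by simp, hwA⟩
      simp only [restr, if_pos this]
    · refine Finset.sum_eq_zero fun u _ => ?_
      by_cases hadj : T.Adj w u
      · have : ¬ ∃ z ∈ s(w, u), z ∈ A := by
          rintro ⟨z, hz, hzA⟩
          rcases Sym2.mem_iff.1 hz with rfl | rfl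
          · exact hwA hzA
          · exact hwA (hA _ _ hadj.symm hzA hw)
        simp only [restr, if_neg this]
      · have : x s(w, u) = 0 := hx _ (by simpa using hadj)
        simp [restr, this]
  have hs := sum_bd_eq_zero_of_closed Finset.univ (restr A x)
    (fun w => by simp [restr, hx.diag w]) (by simp)
  rw [Finset.sum_eq_single v (fun w _ hw => hne w hw) (by simp)] at hs
  funext w
  by_cases hw : w = v
  · rw [hw, hs]; rfl
  · exact hne w hw

theorem hasDual_addEdge_of_cut {T : SimpleGraph V} {v a b : V} {A : Set V} (hT : HasDual T)
    (hv : v ∉ A) (hA : ∀ u w, T.Adj u w → u ∈ A → w ≠ v → w ∈ A)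
    (ha : a ∈ A) (hb : b ∉ A) (hva : T.Adj v a) (hvb : T.Adj v b) :
    HasDual (addEdge T a b) := by
  classical
  obtain ⟨k, l, r, hd⟩ := hT
  have hne : a ≠ b := by rintro rfl; exact hb ha
  have hnadj : s(a, b) ∉ T.edgeSet := fun h => hb (hA a b (by simpa using h) ha hvb.ne')
  set q := r s(v, a) with hq
  set q' := r s(v, b) with hq'
  let inA : Sym2 V → Prop := fun e => ∃ w ∈ e, w ∈ A
  let gA : Fin k → Option (Fin k ⊕ Fin k) := fun f => some (Sum.inl f)
  let gB : Fin k → Option (Fin k ⊕ Fin k) :=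
    fun f => if f = q' then some (Sum.inl q) else some (Sum.inr f)
  let l' : Sym2 V → Option (Fin k ⊕ Fin k) := fun e =>
    if e = s(a, b) then some (Sum.inl q) else if inA e then gA (l e) else gB (l e)
  let r' : Sym2 V → Option (Fin k ⊕ Fin k) := fun e =>
    if e = s(a, b) ∨ e = s(v, a) ∨ e = s(v, b) then none
    else if inA e then gA (r e) else gB (r e)
  have hinA : inA s(v, a) := ⟨a, by simp, ha⟩
  have hinB : ¬ inA s(v, b) := by
    rintro ⟨w, hw, hwA⟩
    rcases Sym2.mem_iff.1 hw with rfl | rfl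
    · exact hv hwA
    · exact hb hwA
  have hab1 : s(v, a) ≠ s(a, b) := by simp [hva.ne, hvb.ne]
  have hab2 : s(v, b) ≠ s(a, b) := by simp [hva.ne, hvb.ne]
  have hab3 : s(v, a) ≠ s(v, b) := by simp [hne, hvb.ne]
  have hform : ∀ S, cobd (addEdge T a b) l' r' S =
      restr A (cobd T l r fun f => S (gA f)) + (cobd T l r (fun f => S (gB f)) +
        restr A (cobd T l r fun f => S (gB f))) + fun e => (S (some (Sum.inl q)) + S none) *
        (Pi.single s(v, a) 1 + Pi.single s(v, b) 1 + Pi.single s(a, b) 1 : Sym2 V → ZMod 2) e := by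
    intro S; funext e
    have hgq : gB q' = some (Sum.inl q) := by simp [gB]
    have hgq2 : gA q = some (Sum.inl q) := rfl
    simp only [Pi.add_apply, Pi.single_apply]
    by_cases h1 : e = s(a, b)
    · rw [cobd_of_mem (by rw [mem_addEdge hne]; exact Or.inr h1)]
      subst h1
      simp [restr, cobd_of_notMem hnadj, l', r', hab1.symm, hab2.symm]
    · by_cases heT : e ∈ T.edgeSet
      · rw [cobd_of_mem (by rw [mem_addEdge hne]; exact Or.inl heT)]
        by_cases h2 : e = s(v, a)
        · subst h2
          have : ∃ w ∈ s(v, a), w ∈ A := hinA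
          simp only [restr, if_pos this, cobd_of_mem heT, l', r', if_neg h1, if_pos hinA,
            if_neg hab3, ← hq, true_or, or_true, if_true, hgq2]
          generalize S (some (Sum.inl q)) = x1
          generalize S none = x2
          generalize S (gA _) = x3
          generalize S (gB _) + S (gB _) = x4
          revert x1 x2 x3 x4; decide
        · by_cases h3 : e = s(v, b)
          · subst h3
            have : ¬ ∃ w ∈ s(v, b), w ∈ A := hinB
            simp only [restr, if_neg this, cobd_of_mem heT, l', r', if_neg h1, if_neg hinB,
              if_neg hab3.symm, ← hq', or_true, if_true, hgq]
            generalize S (some (Sum.inl q)) = x1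
            generalize S none = x2
            generalize S (gB _) = x3
            revert x1 x2 x3; decide
          · by_cases h4 : inA e
            · have : ∃ w ∈ e, w ∈ A := h4
              simp only [restr, if_pos this, cobd_of_mem heT, l', r', if_neg h1, if_pos h4,
                if_neg h2, if_neg h3, or_self, if_false, h1, h2, h3]
              rw [zadd_self]; ring
            · have : ¬ ∃ w ∈ e, w ∈ A := h4
              simp only [restr, if_neg this, cobd_of_mem heT, l', r', if_neg h1, if_neg h4,
                if_neg h2, if_neg h3, or_self, if_false, h1, h2, h3]
              ring
      · rw [cobd_of_notMem (by rw [mem_addEdge hne]; tauto)]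
        have h2 : e ≠ s(v, a) := by rintro rfl; exact heT (by simpa using hva)
        have h3 : e ≠ s(v, b) := by rintro rfl; exact heT (by simpa using hvb)
        simp [restr, cobd_of_notMem heT, h1, h2, h3]
  refine ⟨_, IsDual.hasDualCard (isDual_addEdge hne (l' := l') (r' := r') ?_ ?_ ?_)⟩
  · intro S
    rw [hform, bd_add, bd_add, bd_add, bd_restr hA (suppOn_cobd _ _ _ _) (hd.bd_cobd _),
      bd_restr hA (suppOn_cobd _ _ _ _) (hd.bd_cobd _), hd.bd_cobd]
    rcases (by decide : ∀ z : ZMod 2, z = 0 ∨ z = 1) (S (some (Sum.inl q)) + S none) with h | h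
    · rw [h]
      have : (fun e => (0 : ZMod 2) * (Pi.single s(v, a) 1 + Pi.single s(v, b) 1
        + Pi.single s(a, b) 1 : Sym2 V → ZMod 2) e) = 0 := by funext e; simp
      rw [this, bd_zero]; simp
    · rw [h]
      have : (fun e => (1 : ZMod 2) * (Pi.single s(v, a) 1 + Pi.single s(v, b) 1
        + Pi.single s(a, b) 1 : Sym2 V → ZMod 2) e) = Pi.single s(v, a) 1 + Pi.single s(v, b) 1
        + Pi.single s(a, b) 1 := by funext e; simp
      rw [this, bd_add, bd_add, bd_single hva.ne, bd_single hvb.ne, bd_single hne]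
      have h1 := zadd_self' (Pi.single v 1 : V → ZMod 2)
      have h2 := zadd_self' (Pi.single a 1 : V → ZMod 2)
      have h3 := zadd_self' (Pi.single b 1 : V → ZMod 2)
      linear_combination (exp := 1) h1 + h2 + h3
  · intro x hx hbx
    obtain ⟨S, rfl⟩ := (hd x).1 ⟨hx, hbx⟩
    let S' : Option (Fin k ⊕ Fin k) → ZMod 2 := fun o =>
      o.elim (S q) (fun f => Sum.elim S (fun f => S f + (S q + S q')) f)
    have hB : (fun f => S' (gB f)) = S + fun _ => (S q + S q') := by
      funext f
      by_cases hf : f = q'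
      · have h2 : ∀ x y : ZMod 2, x = y + (x + y) := by decide
        simpa [gB, S', hf] using h2 (S q) (S q')
      · simp [gB, if_neg hf, S']
    have hA' : (fun f => S' (gA f)) = S := by funext f; simp [gA, S']
    refine ⟨S', ?_⟩
    rw [hform, hB, hA', cobd_add, cobd_const]
    funext e
    simp only [add_zero, Pi.add_apply]
    have : S' (some (Sum.inl q)) + S' none = 0 := by simp [S', zadd_self]
    rw [this]
    generalize restr A _ e = x; generalize cobd T l r S e = y
    rw [zero_mul]
    revert x y; decide
  · refine ⟨fun o => o.elim 1 0, ?_⟩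
    rw [cobd_of_mem (by rw [mem_addEdge hne]; exact Or.inr rfl)]
    simp [l', r']

theorem MaxDual.reachable_isolate {T : SimpleGraph V} (h : MaxDual T) {v a b : V}
    (ha : a ≠ v) (hb : b ≠ v) : (isolate T v).Reachable a b := by
  classical
  have hnb : ∀ a, a ≠ v → ∃ a', T.Adj v a' ∧ (isolate T v).Reachable a a' := by
    clear ha hb
    intro a ha
    obtain ⟨p⟩ := h.reachable a v
    induction p with
    | nil => exact absurd rfl ha
    | @cons u w z huw p ih =>
      by_cases hw : w = z
      · subst hw; exact ⟨u, huw.symm, SimpleGraph.Reachable.refl _⟩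
      · obtain ⟨a', h1, h2⟩ := ih hw
        exact ⟨a', h1, SimpleGraph.Reachable.trans
          (SimpleGraph.Adj.reachable (show (isolate T z).Adj u w from ⟨huw, ha, hw⟩)) h2⟩
  obtain ⟨a', ha1, ha2⟩ := hnb a ha
  obtain ⟨b', hb1, hb2⟩ := hnb b hb
  refine ha2.trans (SimpleGraph.Reachable.trans ?_ hb2.symm)
  by_contra hcon
  have hne : a' ≠ b' := by rintro rfl; exact hcon (SimpleGraph.Reachable.refl _)
  have hvA : ¬ (isolate T v).Reachable a' v := by
    rintro ⟨p⟩
    have : ∀ {x y} (_ : (isolate T v).Walk x y), x ≠ v → y ≠ v := by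
      intro x y p
      induction p with
      | nil => exact id
      | cons h _ ih => intro _; exact ih h.2.2
    exact this p ha1.ne' rfl
  refine h.2 a' b' hne ?_ (hasDual_addEdge_of_cut (A := {w | (isolate T v).Reachable a' w}) h.1
    hvA ?_ (SimpleGraph.Reachable.refl _) hcon ha1 hb1)
  · intro hadj
    exact hcon (SimpleGraph.Adj.reachable
      (show (isolate T v).Adj a' b' from ⟨hadj, ha1.ne', hb1.ne'⟩))
  · intro u w huw hu hw
    have hu' : (isolate T v).Reachable a' u := hu
    have huv : u ≠ v := by rintro rfl; exact hvA hu'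
    exact hu'.trans (SimpleGraph.Adj.reachable
      (show (isolate T v).Adj u w from ⟨huw, huv, hw⟩))

theorem MaxDual.chain_avoiding {T : SimpleGraph V} (h : MaxDual T) {v a b : V}
    (ha : a ≠ v) (hb : b ≠ v) : ∃ y, SuppOn T y ∧ (∀ e, v ∈ e → y e = 0) ∧
      bd y = Pi.single a 1 + Pi.single b 1 := by
  obtain ⟨y, hy, hby⟩ := exists_chain_of_reachable (h.reachable_isolate ha hb)
  refine ⟨y, hy.mono (isolate_le _ _), fun e he => hy e fun h' => ?_, hby⟩
  induction e with
  | _ c d =>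
    have h2 : T.Adj c d ∧ c ≠ v ∧ d ≠ v := by simpa [isolate] using h'
    rcases Sym2.mem_iff.1 he with rfl | rfl
    · exact h2.2.1 rfl
    · exact h2.2.2 rfl

/-- Splitting a face by a new edge between the ends of two consecutive boundary edges. -/
theorem IsDual.hasDual_split [Fintype F] {T : SimpleGraph V} {l r : Sym2 V → F}
    (hd : IsDual T l r) (hlr : ∀ e ∈ T.edgeSet, l e ≠ r e) {f : F} {a b c : V}
    (hab : T.Adj a b) (hbc : T.Adj b c) (hac : a ≠ c) (hnac : ¬ T.Adj a c)
    (hf1 : l s(a, b) = f ∨ r s(a, b) = f) (hf2 : l s(b, c) = f ∨ r s(b, c) = f) :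
    HasDual (addEdge T a c) := by
  classical
  have e1 : s(a, b) ≠ s(a, c) := by simp [hbc.ne, hac]
  have e2 : s(b, c) ≠ s(a, c) := by simp [hab.ne', hbc.ne]
  have e3 : s(a, b) ≠ s(b, c) := by simp [hac, hab.ne]
  let l' : Sym2 V → Option F := fun e => if e = s(a, c) then some f else
    if (e = s(a, b) ∨ e = s(b, c)) ∧ l e = f then none else some (l e)
  let r' : Sym2 V → Option F := fun e => if e = s(a, c) then none else
    if (e = s(a, b) ∨ e = s(b, c)) ∧ r e = f then none else some (r e)
  have hnac' : s(a, c) ∉ T.edgeSet := by simpa using hnac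
  have hform : ∀ S, cobd (addEdge T a c) l' r' S =
      cobd T l r (fun f => S (some f)) + fun e => (S (some f) + S none) *
        (Pi.single s(a, b) 1 + Pi.single s(b, c) 1 + Pi.single s(a, c) 1 : Sym2 V → ZMod 2) e := by
    intro S; funext e
    simp only [Pi.add_apply, Pi.single_apply]
    by_cases h1 : e = s(a, c)
    · rw [cobd_of_mem (by rw [mem_addEdge hac]; exact Or.inr h1)]
      subst h1
      simp [cobd_of_notMem hnac', l', r', e1.symm, e2.symm]
    · by_cases heT : e ∈ T.edgeSet
      · rw [cobd_of_mem (by rw [mem_addEdge hac]; exact Or.inl heT), cobd_of_mem heT]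
        have hne := hlr e heT
        have fin : ∀ x y z : ZMod 2, x + z = y + z + (y + x) := by decide
        have fin2 : ∀ x y z : ZMod 2, z + x = z + y + (y + x) := by decide
        by_cases h2 : e = s(a, b)
        · subst h2
          rcases hf1 with h | h
          · have h' : r s(a, b) ≠ f := by rw [← h]; exact hne.symm
            simp [l', r', e1, e3, h, h']
            apply fin
          · have h' : l s(a, b) ≠ f := by rw [← h]; exact hne
            simp [l', r', e1, e3, h, h']
            apply fin2
        · by_cases h3 : e = s(b, c)
          · subst h3
            rcases hf2 with h | h
            · have h' : r s(b, c) ≠ f := by rw [← h]; exact hne.symm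
              simp [l', r', e2, e3.symm, h, h']
              apply fin
            · have h' : l s(b, c) ≠ f := by rw [← h]; exact hne
              simp [l', r', e2, e3.symm, h, h']
              apply fin2
          · simp [l', r', h1, h2, h3]
      · rw [cobd_of_notMem (by rw [mem_addEdge hac]; tauto)]
        have h2 : e ≠ s(a, b) := by rintro rfl; exact heT (by simpa using hab)
        have h3 : e ≠ s(b, c) := by rintro rfl; exact heT (by simpa using hbc)
        simp [cobd_of_notMem heT, h1, h2, h3]
  refine ⟨_, IsDual.hasDualCard (isDual_addEdge hac (l' := l') (r' := r') ?_ ?_ ?_)⟩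
  · intro S
    rw [hform, bd_add, hd.bd_cobd]
    rcases (by decide : ∀ z : ZMod 2, z = 0 ∨ z = 1) (S (some f) + S none) with h | h
    · rw [h]
      have : (fun e => (0 : ZMod 2) * (Pi.single s(a, b) 1 + Pi.single s(b, c) 1
        + Pi.single s(a, c) 1 : Sym2 V → ZMod 2) e) = 0 := by funext e; simp
      rw [this, bd_zero]; simp
    · rw [h]
      have : (fun e => (1 : ZMod 2) * (Pi.single s(a, b) 1 + Pi.single s(b, c) 1
        + Pi.single s(a, c) 1 : Sym2 V → ZMod 2) e) = Pi.single s(a, b) 1 + Pi.single s(b, c) 1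
        + Pi.single s(a, c) 1 := by funext e; simp
      rw [this, bd_add, bd_add, bd_single hab.ne, bd_single hbc.ne, bd_single hac]
      have h1 := zadd_self' (Pi.single a 1 : V → ZMod 2)
      have h2 := zadd_self' (Pi.single b 1 : V → ZMod 2)
      have h3 := zadd_self' (Pi.single c 1 : V → ZMod 2)
      linear_combination (exp := 1) h1 + h2 + h3
  · intro x hx hbx
    obtain ⟨S, rfl⟩ := (hd x).1 ⟨hx, hbx⟩
    refine ⟨fun o => o.elim (S f) S, ?_⟩
    rw [hform]
    funext e
    simp [zadd_self]
  · refine ⟨fun o => o.elim 1 0, ?_⟩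
    rw [cobd_of_mem (by rw [mem_addEdge hac]; exact Or.inr rfl)]
    simp [l', r']

/-- A dual with the minimum number of faces has only constant cocycles. -/
theorem exists_strong_dual {T : SimpleGraph V} (h : HasDual T) :
    ∃ (k : ℕ) (l r : Sym2 V → Fin k), IsDual T l r ∧
      ∀ S : Fin k → ZMod 2, cobd T l r S = 0 → ∀ f g, S f = S g := by
  classical
  have hmin : ∀ {m}, m < Nat.find h → ¬ HasDualCard T m := fun hm => Nat.find_min h hm
  obtain ⟨l, r, hd⟩ := Nat.find_spec h
  refine ⟨Nat.find h, l, r, hd, fun S hS f g => ?_⟩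
  by_contra hfg
  let π : Fin (Nat.find h) → {x : Fin (Nat.find h) // x ≠ g} := fun x =>
    if hx : x = g then ⟨f, fun h => hfg (by rw [h])⟩ else ⟨x, hx⟩
  have hπ : ∀ S' : {x : Fin (Nat.find h) // x ≠ g} → ZMod 2,
      cobd T (fun e => π (l e)) (fun e => π (r e)) S' = cobd T l r (fun x => S' (π x)) := by
    intro S'; funext e
    by_cases he : e ∈ T.edgeSet
    · simp [cobd_of_mem he]
    · simp [cobd_of_notMem he]
  have hd' : IsDual T (fun e => π (l e)) (fun e => π (r e)) := by
    refine fun x => (hd x).trans ⟨?_, ?_⟩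
    · rintro ⟨R, rfl⟩
      have key : ∀ R : Fin (Nat.find h) → ZMod 2, R f = R g →
          ∃ S', cobd T l r R = cobd T (fun e => π (l e)) (fun e => π (r e)) S' := by
        intro R hR
        refine ⟨fun x => R x, ?_⟩
        rw [hπ]; congr 1; funext x
        by_cases hx : x = g
        · simp [π, hx, hR]
        · simp [π, hx]
      by_cases hR : R f = R g
      · exact key R hR
      · obtain ⟨S', hS'⟩ := key (R + S) (by
          have h4 : ∀ x1 x2 x3 x4 : ZMod 2, x1 ≠ x2 → x3 ≠ x4 → x1 + x3 = x2 + x4 := by decide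
          exact h4 _ _ _ _ hR hfg)
        exact ⟨S', by rw [← hS', cobd_add, hS, add_zero]⟩
    · rintro ⟨S', rfl⟩
      exact ⟨_, hπ S'⟩
  refine hmin ?_ (IsDual.hasDualCard hd')
  have := Fintype.card_subtype_lt (p := fun x : Fin (Nat.find h) => x ≠ g) (x := g) (by simp)
  simpa using this

end ArcDual

namespace ArcDual

variable {V : Type} [Fintype V] [DecidableEq V] {F : Type} [DecidableEq F]

/-- The face `f` is incident to the edge `e` of `T`. -/
def Inc (T : SimpleGraph V) (l r : Sym2 V → F) (f : F) (e : Sym2 V) : Prop :=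
  e ∈ T.edgeSet ∧ (l e = f ∨ r e = f)

/-- A graph with a combinatorial dual all of whose faces are triangles. -/
structure TriSphere (T : SimpleGraph V) (l r : Sym2 V → F) : Prop where
  dual : IsDual T l r
  strong : ∀ S : F → ZMod 2, cobd T l r S = 0 → ∀ f g, S f = S g
  avoid : ∀ v a b : V, a ≠ v → b ≠ v → ∃ y, SuppOn T y ∧ (∀ e, v ∈ e → y e = 0) ∧
    bd y = Pi.single a 1 + Pi.single b 1
  ne : ∀ e ∈ T.edgeSet, l e ≠ r e
  tri : ∀ f, ∃ a b c, T.Adj a b ∧ T.Adj b c ∧ T.Adj a c ∧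
    ∀ e, Inc T l r f e ↔ e = s(a, b) ∨ e = s(b, c) ∨ e = s(a, c)

theorem IsDual.exists_normalized {T : SimpleGraph V} {l r : Sym2 V → F} (hd : IsDual T l r)
    {x : Sym2 V → ZMod 2} (hx : SuppOn T x) (hb : bd x = 0) (f : F) :
    ∃ S : F → ZMod 2, S f = 0 ∧ x = cobd T l r S := by
  obtain ⟨S, rfl⟩ := (hd x).1 ⟨hx, hb⟩
  refine ⟨S + fun _ => S f, zadd_self _, ?_⟩
  rw [cobd_add, cobd_const, add_zero]

theorem exists_next {x : Sym2 V → ZMod 2} (hb : bd x = 0) {a b : V} (h : x s(a, b) = 1) :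
    ∃ c, c ≠ a ∧ x s(b, c) = 1 := by
  by_contra hcon
  push Not at hcon
  have h1 : bd x b = x s(b, a) := Finset.sum_eq_single a
    (fun c _ hc => by by_contra h0; exact hcon c hc (zne_zero.1 h0)) (by simp)
  rw [hb, Sym2.eq_swap, h] at h1
  exact absurd h1 (by simp)

theorem even_triangle {T : SimpleGraph V} {a b c : V} (hab : T.Adj a b) (hbc : T.Adj b c)
    (hac : T.Adj a c) :
    SuppOn T (Pi.single s(a, b) 1 + Pi.single s(b, c) 1 + Pi.single s(a, c) 1) ∧
    bd (Pi.single s(a, b) 1 + Pi.single s(b, c) 1 + Pi.single s(a, c) 1 : Sym2 V → ZMod 2)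
      = 0 := by
  refine ⟨((suppOn_single (by simpa using hab)).add (suppOn_single (by simpa using hbc))).add
    (suppOn_single (by simpa using hac)), ?_⟩
  rw [bd_add, bd_add, bd_single hab.ne, bd_single hbc.ne, bd_single hac.ne]
  have h1 := zadd_self' (Pi.single a 1 : V → ZMod 2)
  have h2 := zadd_self' (Pi.single b 1 : V → ZMod 2)
  have h3 := zadd_self' (Pi.single c 1 : V → ZMod 2)
  linear_combination (exp := 1) h1 + h2 + h3

theorem cobd_single_eq_one {T : SimpleGraph V} {l r : Sym2 V → F}
    (hne : ∀ e ∈ T.edgeSet, l e ≠ r e) (f : F) (e : Sym2 V) :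
    cobd T l r (Pi.single f 1) e = 1 ↔ Inc T l r f e := by
  by_cases he : e ∈ T.edgeSet
  · rw [cobd_of_mem he, Pi.single_apply, Pi.single_apply]
    have := hne e he
    by_cases h1 : l e = f
    · have h2 : r e ≠ f := by rw [← h1]; exact this.symm
      simp [h1, h2, Inc, he]
    · by_cases h2 : r e = f
      · simp [h1, h2, Inc, he]
      · simp [h1, h2, Inc, he]
  · simp [cobd_of_notMem he, Inc, he]

/-- Even chain through two edges at a vertex. -/
theorem exists_even_through {T : SimpleGraph V}
    (avoid : ∀ v a b : V, a ≠ v → b ≠ v → ∃ y, SuppOn T y ∧ (∀ e, v ∈ e → y e = 0) ∧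
      bd y = Pi.single a 1 + Pi.single b 1)
    {v a b : V} (hva : T.Adj v a) (hvb : T.Adj v b) (hab : a ≠ b) :
    ∃ z, SuppOn T z ∧ bd z = 0 ∧ ∀ w, z s(v, w) = if w = a ∨ w = b then 1 else 0 := by
  obtain ⟨y, hy, hy0, hby⟩ := avoid v a b hva.ne' hvb.ne'
  refine ⟨Pi.single s(v, a) 1 + Pi.single s(v, b) 1 + y,
    ((suppOn_single (by simpa using hva)).add (suppOn_single (by simpa using hvb))).add hy,
    ?_, ?_⟩
  · rw [bd_add, bd_add, bd_single hva.ne, bd_single hvb.ne, hby]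
    have h1 := zadd_self' (Pi.single a 1 : V → ZMod 2)
    have h2 := zadd_self' (Pi.single b 1 : V → ZMod 2)
    have h3 := zadd_self' (Pi.single v 1 : V → ZMod 2)
    linear_combination (exp := 1) h1 + h2 + h3
  · intro w
    have ha : s(v, w) = s(v, a) ↔ w = a := by simp [hva.ne]
    have hb : s(v, w) = s(v, b) ↔ w = b := by simp [hvb.ne]
    simp only [Pi.add_apply, Pi.single_apply, hy0 s(v, w) (by simp), ha, hb, add_zero]
    by_cases h1 : w = a
    · simp [h1, hab]
    · simp [h1]

/-- If a coboundary is contained in the boundary of a single face, it is that boundary. -/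
theorem sub_boundary_eq {T : SimpleGraph V} {l r : Sym2 V → F} (hd : IsDual T l r)
    (hreach : ∀ a b, T.Reachable a b)
    (avoid : ∀ v a b : V, a ≠ v → b ≠ v → ∃ y, SuppOn T y ∧ (∀ e, v ∈ e → y e = 0) ∧
      bd y = Pi.single a 1 + Pi.single b 1)
    {f : F} {Z : Sym2 V → ZMod 2} (hZ : SuppOn T Z)
    (hbZ : bd Z = 0) (hsub : ∀ e, Z e = 1 → Inc T l r f e) {e1 : Sym2 V} (he1 : Z e1 = 1)
    {e2 : Sym2 V} (he2 : Inc T l r f e2) : Z e2 = 1 := by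
  classical
  by_contra hZ2
  obtain ⟨S, hSf, hZS⟩ := hd.exists_normalized hZ hbZ f
  let E1 : Sym2 V → Prop := fun e => S (l e) = 1 ∨ S (r e) = 1
  have hE1 : ∀ e ∈ T.edgeSet, E1 e → ¬ Inc T l r f e → S (l e) = 1 ∧ S (r e) = 1 := by
    intro e he h hinc
    have : Z e = 0 := by
      by_contra h0; exact hinc (hsub e (zne_zero.1 h0))
    rw [hZS, cobd_of_mem he, zadd_eq_zero] at this
    rcases h with h | h
    · exact ⟨h, this ▸ h⟩
    · exact ⟨this ▸ h, h⟩
  have hE1' : ∀ e, Inc T l r f e → E1 e → (l e = f ∧ S (r e) = 1) ∨ (r e = f ∧ S (l e) = 1) := by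
    rintro e ⟨_, h | h⟩ h'
    · left; refine ⟨h, ?_⟩; rcases h' with h' | h'
      · rw [h, hSf] at h'; exact absurd h' (by decide)
      · exact h'
    · right; refine ⟨h, ?_⟩; rcases h' with h' | h'
      · exact h'
      · rw [h, hSf] at h'; exact absurd h' (by decide)
  have hE1e1 : E1 e1 := by
    by_contra h
    have : Z e1 = 0 := by
      have hl : S (l e1) = 0 := by by_contra h0; exact h (Or.inl (zne_zero.1 h0))
      have hr : S (r e1) = 0 := by by_contra h0; exact h (Or.inr (zne_zero.1 h0))
      rw [hZS, cobd_of_mem (hsub e1 he1).1, hl, hr]; rfl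
    rw [he1] at this; exact absurd this (by decide)
  have hE1e2 : ¬ E1 e2 := by
    intro h
    apply hZ2
    rcases hE1' e2 he2 h with ⟨h1, h2⟩ | ⟨h1, h2⟩
    · rw [hZS, cobd_of_mem he2.1, h1, hSf, h2]; rfl
    · rw [hZS, cobd_of_mem he2.1, h1, hSf, h2]; rfl
  -- the cycle space splits
  have hsplit : ∀ z, SuppOn T z → bd z = 0 → bd (fun e => if E1 e then z e else 0) = 0 := by
    intro z hz hbz
    obtain ⟨R, hRf, rfl⟩ := hd.exists_normalized hz hbz f
    have : (fun e => if E1 e then cobd T l r R e else 0) = cobd T l r (fun g => R g * S g) := by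
      funext e
      by_cases he : e ∈ T.edgeSet
      · rw [cobd_of_mem he, cobd_of_mem he]
        by_cases h1 : E1 e
        · rw [if_pos h1]
          by_cases hinc : Inc T l r f e
          · rcases hE1' e hinc h1 with ⟨h2, h3⟩ | ⟨h2, h3⟩
            · rw [h2, h3, hRf, hSf]; ring
            · rw [h2, h3, hRf, hSf]; ring
          · obtain ⟨h2, h3⟩ := hE1 e he h1 hinc
            rw [h2, h3]; ring
        · rw [if_neg h1]
          have hl : S (l e) = 0 := by by_contra h0; exact h1 (Or.inl (zne_zero.1 h0))
          have hr : S (r e) = 0 := by by_contra h0; exact h1 (Or.inr (zne_zero.1 h0))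
          rw [hl, hr]; ring
      · simp [cobd_of_notMem he]
    rw [this]; exact hd.bd_cobd _
  -- a vertex meeting both parts
  obtain ⟨v, a, b, hva, hvb, ha, hb⟩ : ∃ v a b, T.Adj v a ∧ T.Adj v b ∧ E1 s(v, a) ∧
      ¬ E1 s(v, b) := by
    by_contra hcon
    push Not at hcon
    induction e1 with
    | _ p q =>
    induction e2 with
    | _ p' q' =>
    have hpq : T.Adj p q := by simpa using (hsub _ he1).1
    have hpq' : T.Adj p' q' := by simpa using he2.1
    have hcl : ∀ {x y}, T.Walk x y → (∃ a, T.Adj x a ∧ E1 s(x, a)) →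
        (∃ a, T.Adj y a ∧ E1 s(y, a)) := by
      intro x y w
      induction w with
      | nil => exact id
      | @cons u v _ huv _ ih =>
        rintro ⟨a, h1, h2⟩
        refine ih ⟨u, huv.symm, ?_⟩
        rw [Sym2.eq_swap]
        exact hcon u a v h1 huv h2
    obtain ⟨w⟩ := hreach p p'
    obtain ⟨a, h1, h2⟩ := hcl w ⟨q, hpq, hE1e1⟩
    exact hE1e2 (hcon p' a q' h1 hpq' h2)
  have hab : a ≠ b := by rintro rfl; exact hb ha
  obtain ⟨z, hz, hbz, hzv⟩ := exists_even_through avoid hva hvb hab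
  have h0 := congrFun (hsplit z hz hbz) v
  have h1 : bd (fun e => if E1 e then z e else 0) v = if E1 s(v, a) then z s(v, a) else 0 := by
    refine Finset.sum_eq_single a (fun w _ hw => ?_) (by simp)
    change (if E1 s(v, w) then z s(v, w) else 0) = 0
    by_cases hwb : w = b
    · rw [hwb, if_neg hb]
    · rw [hzv w, if_neg (show ¬ (w = a ∨ w = b) by tauto)]; simp
  rw [h1, if_pos ha, hzv a, if_pos (Or.inl rfl)] at h0
  exact absurd h0 (by simp)

theorem MaxDual.exists_triSphere {T : SimpleGraph V} (hm : MaxDual T)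
    (hn : 3 ≤ Fintype.card V) : ∃ (k : ℕ) (l r : Sym2 V → Fin k), TriSphere T l r := by
  classical
  obtain ⟨k, l, r, hd, hstrong⟩ := exists_strong_dual hm.1
  have havoid : ∀ v a b : V, a ≠ v → b ≠ v → ∃ y, SuppOn T y ∧ (∀ e, v ∈ e → y e = 0) ∧
      bd y = Pi.single a 1 + Pi.single b 1 := fun v a b ha hb => hm.chain_avoiding ha hb
  have hthird : ∀ a b : V, ∃ c, c ≠ a ∧ c ≠ b := by
    intro a b
    have : ({a, b} : Finset V).card < Fintype.card V :=
      lt_of_le_of_lt Finset.card_le_two (by omega)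
    obtain ⟨c, hc⟩ := Finset.exists_mem_notMem_of_card_lt_card
      (this.trans_eq Finset.card_univ.symm)
    simp at hc; exact ⟨c, hc⟩
  have hne : ∀ e ∈ T.edgeSet, l e ≠ r e := by
    intro e he
    induction e with
    | _ a b =>
    have hab : T.Adj a b := by simpa using he
    obtain ⟨c, hca, hcb⟩ := hthird a b
    obtain ⟨y, hy, hy0, hby⟩ := havoid b a c hab.ne hcb
    obtain ⟨y', hy', hy0', hby'⟩ := havoid a c b hca hab.ne'
    obtain ⟨S, hS⟩ := (hd (Pi.single s(a, b) 1 + y + y')).1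
      ⟨((suppOn_single he).add hy).add hy', by
        rw [bd_add, bd_add, bd_single hab.ne, hby, hby']
        have h1 := zadd_self' (Pi.single a 1 : V → ZMod 2)
        have h2 := zadd_self' (Pi.single b 1 : V → ZMod 2)
        have h3 := zadd_self' (Pi.single c 1 : V → ZMod 2)
        linear_combination (exp := 1) h1 + h2 + h3⟩
    have h1 := congrFun hS s(a, b)
    rw [cobd_of_mem he, Pi.add_apply, Pi.add_apply, hy0 _ (by simp), hy0' _ (by simp)] at h1
    intro heq
    rw [heq, zadd_self] at h1
    simp at h1
  have hreach := hm.reachable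
  have hedge : ∃ e, e ∈ T.edgeSet := by
    obtain ⟨a, b, hab⟩ : ∃ a b : V, a ≠ b := by
      have : Nontrivial V := Fintype.one_lt_card_iff_nontrivial.1 (by omega)
      exact exists_pair_ne V
    obtain ⟨w⟩ := hreach a b
    cases w with
    | nil => exact absurd rfl hab
    | @cons _ v _ h _ => exact ⟨s(a, v), by simpa using h⟩
  have hsplit : ∀ f a b c, Inc T l r f s(a, b) → Inc T l r f s(b, c) → a ≠ c → T.Adj a c := by
    intro f a b c h1 h2 hac
    by_contra hn
    exact hm.2 a c hac hn (hd.hasDual_split hne (by simpa using h1.1) (by simpa using h2.1)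
      hac hn h1.2 h2.2)
  refine ⟨k, l, r, hd, hstrong, havoid, hne, fun f => ?_⟩
  set D := cobd T l r (Pi.single f 1) with hD
  have hDinc : ∀ e, D e = 1 ↔ Inc T l r f e := cobd_single_eq_one hne f
  have hDb : bd D = 0 := hd.bd_cobd _
  obtain ⟨e0, he0⟩ : ∃ e, D e = 1 := by
    by_contra hcon
    push Not at hcon
    have hzero : D = 0 := by
      funext e; by_contra h0; exact hcon e (zne_zero.1 h0)
    have hc := hstrong _ hzero
    obtain ⟨e, he⟩ := hedge
    apply hne e he
    have h1 : ∀ g, g = f := by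
      intro g; by_contra hg
      have := hc g f
      simp [Pi.single_apply, hg] at this
    rw [h1 (l e), h1 (r e)]
  induction e0 with
  | _ c1 c2 =>
  obtain ⟨c3, h31, he23⟩ := exists_next hDb he0
  have i12 := (hDinc _).1 he0
  have i23 := (hDinc _).1 he23
  have a12 : T.Adj c1 c2 := by simpa using i12.1
  have a23 : T.Adj c2 c3 := by simpa using i23.1
  have a13 : T.Adj c1 c3 := hsplit f c1 c2 c3 i12 i23 h31.symm
  obtain ⟨hZ, hbZ⟩ := even_triangle a12 a23 a13
  set Z : Sym2 V → ZMod 2 := Pi.single s(c1, c2) 1 + Pi.single s(c2, c3) 1 + Pi.single s(c1, c3) 1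
    with hZdef
  have e1 : s(c1, c2) ≠ s(c2, c3) := by simp [a12.ne, a13.ne]
  have e2 : s(c1, c2) ≠ s(c1, c3) := by simp [a23.ne, a13.ne]
  have e3 : s(c2, c3) ≠ s(c1, c3) := by simp [a12.ne', a23.ne]
  have hZval : ∀ e, Z e = 1 ↔ e = s(c1, c2) ∨ e = s(c2, c3) ∨ e = s(c1, c3) := by
    intro e
    simp only [hZdef, Pi.add_apply, Pi.single_apply]
    by_cases h1 : e = s(c1, c2)
    · subst h1; simp [e1, e2]
    · by_cases h2 : e = s(c2, c3)
      · subst h2; simp [e1.symm, e3]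
      · simp [h1, h2]
  by_cases i13 : Inc T l r f s(c1, c3)
  · refine ⟨c1, c2, c3, a12, a23, a13, fun e => ⟨fun he => ?_, ?_⟩⟩
    · rw [← hZval]
      refine sub_boundary_eq hd hreach havoid hZ hbZ (fun e he => ?_)
        ((hZval s(c1, c2)).2 (Or.inl rfl)) he
      rcases (hZval e).1 he with rfl | rfl | rfl
      exacts [i12, i23, i13]
    · rintro (rfl | rfl | rfl)
      exacts [i12, i23, i13]
  · exfalso
    obtain ⟨c4, h42, he34⟩ := exists_next hDb he23
    have i34 := (hDinc _).1 he34
    have a34 : T.Adj c3 c4 := by simpa using i34.1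
    have h41 : c4 ≠ c1 := by rintro rfl; exact i13 (by rw [Sym2.eq_swap]; exact i34)
    have a24 : T.Adj c2 c4 := hsplit f c2 c3 c4 i23 i34 h42.symm
    obtain ⟨hZ', hbZ'⟩ := even_triangle a23 a34 a24
    set Z' : Sym2 V → ZMod 2 :=
      Pi.single s(c2, c3) 1 + Pi.single s(c3, c4) 1 + Pi.single s(c2, c4) 1 with hZ'def
    obtain ⟨S, hSf, hS⟩ := hd.exists_normalized hZ hbZ f
    obtain ⟨S', hSf', hS'⟩ := hd.exists_normalized hZ' hbZ' f
    set Q := cobd T l r (fun g => S g * S' g) with hQ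
    have hQb : bd Q = 0 := hd.bd_cobd _
    have hQinc : ∀ e, Inc T l r f e → Q e = Z e * Z' e := by
      rintro e ⟨he, h | h⟩
      · rw [hQ, hS, hS', cobd_of_mem he, cobd_of_mem he, cobd_of_mem he, h, hSf, hSf']; ring
      · rw [hQ, hS, hS', cobd_of_mem he, cobd_of_mem he, cobd_of_mem he, h, hSf, hSf']; ring
    have hQ0 : ∀ e, Z e = 0 → Z' e = 0 → Q e = 0 := by
      intro e h1 h2
      by_cases he : e ∈ T.edgeSet
      · rw [hS, cobd_of_mem he, zadd_eq_zero] at h1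
        rw [hS', cobd_of_mem he, zadd_eq_zero] at h2
        rw [hQ, cobd_of_mem he, h1, h2, zadd_self]
      · rw [hQ, cobd_of_notMem he]
    have hZ1 : ∀ e, e ≠ s(c1, c2) → e ≠ s(c2, c3) → e ≠ s(c1, c3) → Z e = 0 := by
      intro e h1 h2 h3; simp [hZdef, Pi.single_apply, h1, h2, h3]
    have hZ2 : ∀ e, e ≠ s(c2, c3) → e ≠ s(c3, c4) → e ≠ s(c2, c4) → Z' e = 0 := by
      intro e h1 h2 h3; simp [hZ'def, Pi.single_apply, h1, h2, h3]
    have e4 : s(c2, c3) ≠ s(c3, c4) := by simp [a23.ne, a24.ne]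
    have e5 : s(c2, c3) ≠ s(c2, c4) := by simp [a34.ne, a24.ne]
    have q23 : Q s(c2, c3) = 1 := by
      rw [hQinc _ i23]; simp [hZdef, hZ'def, Pi.single_apply, e1.symm, e3, e4, e5]
    have hQsupp : ∀ e, e ≠ s(c2, c3) → e ≠ s(c1, c3) → e ≠ s(c2, c4) → Q e = 0 := by
      intro e h1 h2 h3
      by_cases h4 : e = s(c1, c2)
      · rw [h4, hQinc _ i12, hZ2 _ e1 (by simp [a13.ne, h41.symm]) (by simp [a12.ne, h41.symm]),
          mul_zero]
      · by_cases h5 : e = s(c3, c4)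
        · rw [h5, hQinc _ i34, hZ1 _ (by simp [a13.ne', a23.ne']) e4.symm
            (by simp [a13.ne', h41, a34.ne']), zero_mul]
        · exact hQ0 e (hZ1 e h4 h1 h2) (hZ2 e h1 h5 h3)
    have q24 : Q s(c2, c4) = 0 := by
      have h1 : bd Q c4 = Q s(c4, c2) := by
        refine Finset.sum_eq_single c2 (fun w _ hw => hQsupp _ ?_ ?_ ?_) (by simp)
        · simp [h42, a34.ne']
        · simp [h41, a34.ne']
        · simp [h42, hw]
      rw [hQb, Sym2.eq_swap] at h1; exact h1.symm
    have h1 : bd Q c2 = Q s(c2, c3) := by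
      refine Finset.sum_eq_single c3 (fun w _ hw => ?_) (by simp)
      by_cases hw4 : w = c4
      · rw [hw4, q24]
      · refine hQsupp _ ?_ ?_ ?_
        · simp [hw, a23.ne]
        · simp [a12.ne', a23.ne]
        · simp [hw4, a24.ne]
    rw [hQb, q23] at h1
    exact absurd h1 (by simp)

/-- Functions that are locally constant across the edges at `v` are constant around `v`. -/
theorem TriSphere.const_around {T : SimpleGraph V} {l r : Sym2 V → F} (h : TriSphere T l r)
    {v : V} {S : F → ZMod 2} (hS : ∀ w, T.Adj v w → S (l s(v, w)) = S (r s(v, w)))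
    {a b : V} (ha : T.Adj v a) (hb : T.Adj v b) : S (l s(v, a)) = S (l s(v, b)) := by
  by_cases hab : a = b
  · rw [hab]
  obtain ⟨z, hz, hbz, hzv⟩ := exists_even_through h.avoid ha hb hab
  obtain ⟨R, hR⟩ := (h.dual z).1 ⟨hz, hbz⟩
  have hq : ∀ w, cobd T l r (fun g => S g * R g) s(v, w) = S (l s(v, w)) * z s(v, w) := by
    intro w
    by_cases hw : T.Adj v w
    · rw [hR, cobd_of_mem (by simpa using hw), cobd_of_mem (by simpa using hw), ← hS w hw]; ring
    · rw [hR, cobd_of_notMem (by simpa using hw), cobd_of_notMem (by simpa using hw), mul_zero]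
  have h0 := congrFun (h.dual.bd_cobd (fun g => S g * R g)) v
  simp only [bd, hq, hzv, Pi.zero_apply, mul_ite, mul_one, mul_zero] at h0
  rw [← Finset.sum_filter, show Finset.univ.filter (fun w => w = a ∨ w = b) = {a, b} by
    ext; simp, Finset.sum_pair hab, zadd_eq_zero] at h0
  exact h0

end ArcDual

namespace ArcDual

variable {V : Type} [Fintype V] [DecidableEq V] {F : Type}

/-- A dual with infinitely many faces can be cut down to a finite one. -/
theorem IsDual.hasDual {T : SimpleGraph V} {l r : Sym2 V → F} (h : IsDual T l r) :
    HasDual T := by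
  classical
  let F0 : Set F := range l ∪ range r
  have : Finite F0 := ((Set.finite_range l).union (Set.finite_range r)).to_subtype
  have := Fintype.ofFinite F0
  refine ⟨_, IsDual.hasDualCard (F := F0) (l := fun e => ⟨l e, Or.inl ⟨e, rfl⟩⟩)
    (r := fun e => ⟨r e, Or.inr ⟨e, rfl⟩⟩) fun x => (h x).trans ⟨?_, ?_⟩⟩
  · rintro ⟨S, rfl⟩
    exact ⟨fun f => S f, rfl⟩
  · rintro ⟨S, rfl⟩
    refine ⟨fun f => if hf : f ∈ F0 then S ⟨f, hf⟩ else 0, ?_⟩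
    funext e
    have h1 : l e ∈ F0 := Or.inl ⟨e, rfl⟩
    have h2 : r e ∈ F0 := Or.inr ⟨e, rfl⟩
    simp only [cobd, dif_pos h1, dif_pos h2]

/-- Summation over edges against a vertex function. -/
theorem sum_sym2_smul {M : Type*} [AddCommGroup M] [Module (ZMod 2) M] (x : Sym2 V → ZMod 2)
    (hx : ∀ v, x s(v, v) = 0) (y : V → M) (g : Sym2 V → M)
    (hg : ∀ u v, g s(u, v) = y u + y v) : ∑ e, x e • g e = ∑ v, bd x v • y v := by
  have h1 : ∑ v, bd x v • y v = ∑ p : V × V, x s(p.1, p.2) • y p.1 := by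
    rw [Fintype.sum_prod_type]
    refine Finset.sum_congr rfl fun v _ => ?_
    rw [bd, Finset.sum_smul]
  rw [h1, ← Finset.sum_fiberwise (s := Finset.univ) (g := fun p : V × V => s(p.1, p.2))]
  refine Finset.sum_congr rfl fun e _ => ?_
  induction e with
  | _ u v =>
  by_cases huv : u = v
  · subst huv
    rw [hx, zero_smul]
    symm
    apply Finset.sum_eq_zero
    rintro ⟨p, q⟩ hp
    simp only [Finset.mem_filter, Finset.mem_univ, true_and] at hp
    rw [hp, hx, zero_smul]
  · have : Finset.univ.filter (fun p : V × V => s(p.1, p.2) = s(u, v)) = {(u, v), (v, u)} := by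
      ext ⟨p, q⟩
      simp
    rw [this, Finset.sum_pair (by simp [huv]), hg, smul_add, Sym2.eq_swap (a := v)]

/-! ### The integer grid -/

/-- Vertices of the integer grid. -/
abbrev GridPt := ℤ × ℤ

/-- Edges of the integer grid; `(p, false)` points right from `p`, `(p, true)` points up. -/
abbrev GridEdge := GridPt × Bool

/-- The second endpoint of a grid edge. -/
def ghead (d : GridEdge) : GridPt := if d.2 then (d.1.1, d.1.2 + 1) else (d.1.1 + 1, d.1.2)

/-- The second face of a grid edge, the first one being indexed by the first endpoint. -/
def gface (d : GridEdge) : GridPt := if d.2 then (d.1.1 - 1, d.1.2) else (d.1.1, d.1.2 - 1)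

/-- The boundary map of the grid. -/
noncomputable def gbd : (GridEdge →₀ ZMod 2) →ₗ[ZMod 2] (GridPt →₀ ZMod 2) :=
  Finsupp.linearCombination (ZMod 2)
    (fun d => Finsupp.single d.1 1 + Finsupp.single (ghead d) 1)

theorem gbd_single (d : GridEdge) (x : ZMod 2) :
    gbd (Finsupp.single d x) = Finsupp.single d.1 x + Finsupp.single (ghead d) x := by
  simp [gbd, Finsupp.linearCombination_single]

theorem gbd_apply (c : GridEdge →₀ ZMod 2) (i j : ℤ) :
    gbd c (i, j) = c ((i, j), false) + c ((i - 1, j), false) + c ((i, j), true)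
      + c ((i, j - 1), true) := by
  induction c using Finsupp.induction_linear with
  | zero => simp
  | add f g hf hg => simp only [map_add, Finsupp.add_apply, hf, hg]; ring
  | single d x =>
    obtain ⟨⟨a, b⟩, t⟩ := d
    rw [gbd_single]
    cases t
    · simp only [ghead, Finsupp.add_apply, Finsupp.single_apply, Prod.mk.injEq,
        reduceCtorEq, and_false, if_false, and_true, add_zero, Bool.false_eq_true]
      congr 2
      rw [eq_sub_iff_add_eq]
    · simp only [ghead, Finsupp.add_apply, Finsupp.single_apply, Prod.mk.injEq,
        reduceCtorEq, and_false, if_false, and_true, zero_add, if_true]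
      congr 2
      rw [eq_sub_iff_add_eq]

theorem gbd_eq_zero_of_faces {c : GridEdge →₀ ZMod 2} {S : GridPt → ZMod 2}
    (h : ∀ d, c d = S d.1 + S (gface d)) : gbd c = 0 := by
  ext ⟨i, j⟩
  rw [gbd_apply, h, h, h, h]
  simp only [gface, Finsupp.zero_apply, if_true, Bool.false_eq_true, if_false]
  generalize S (i, j) = x1
  generalize S (i, j - 1) = x2
  generalize S (i - 1, j) = x3
  generalize S (i - 1, j - 1) = x4
  revert x1 x2 x3 x4; decide

theorem exists_faces_of_gbd_eq_zero {c : GridEdge →₀ ZMod 2} (h : gbd c = 0) :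
    ∃ S : GridPt → ZMod 2, ∀ d, c d = S d.1 + S (gface d) := by
  classical
  obtain ⟨K, hK⟩ : ∃ K : ℤ, ∀ i j t, j ≤ K → c ((i, j), t) = 0 := by
    obtain ⟨K, hK⟩ := (c.support.image fun d : GridEdge => d.1.2).bddBelow
    refine ⟨K - 1, fun i j t hj => ?_⟩
    by_contra h0
    have : K ≤ j := hK (by
      simp only [Finset.coe_image, Set.mem_image, Finset.mem_coe, Finsupp.mem_support_iff]
      exact ⟨((i, j), t), h0, rfl⟩)
    omega
  let S : GridPt → ZMod 2 := fun p => ∑ t ∈ Finset.range (p.2 - K).toNat,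
    c ((p.1, K + 1 + t), false)
  have hlow : ∀ i j, j ≤ K → S (i, j) = 0 := by
    intro i j hj
    have : (j - K).toNat = 0 := by omega
    simp [S, this]
  have hstep : ∀ i j, c ((i, j), false) = S (i, j) + S (i, j - 1) := by
    intro i j
    by_cases hj : j ≤ K
    · rw [hlow i j hj, hlow i (j - 1) (by omega), hK i j _ hj]; rfl
    · have h1 : (j - K).toNat = (j - 1 - K).toNat + 1 := by omega
      simp only [S, h1, Finset.sum_range_succ]
      have h2 : K + 1 + (((j - 1 - K).toNat : ℕ) : ℤ) = j := by omega
      rw [h2]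
      have h3 : ∀ x y : ZMod 2, x = y + x + y := by decide
      exact h3 _ _
  have hvert : ∀ (n : ℕ) (i : ℤ), c ((i, K + n), true) = S (i, K + n) + S (i - 1, K + n) := by
    intro n i
    induction n with
    | zero => rw [hlow _ _ (by simp), hlow _ _ (by simp), hK _ _ _ (by simp)]; rfl
    | succ n ih =>
      have e1 := DFunLike.congr_fun h (i, K + (n + 1 : ℕ))
      rw [gbd_apply, hstep, hstep] at e1
      have e2 : K + ((n + 1 : ℕ) : ℤ) - 1 = K + n := by push_cast; ring
      rw [e2, ih, Finsupp.zero_apply] at e1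
      generalize c ((i, K + ((n + 1 : ℕ) : ℤ)), true) = x at *
      generalize S (i, K + ((n + 1 : ℕ) : ℤ)) = x1 at *
      generalize S (i - 1, K + ((n + 1 : ℕ) : ℤ)) = x2 at *
      generalize S (i - 1, K + n) = x3 at *
      generalize S (i, K + n) = x4 at *
      clear ih
      revert x x1 x2 x3 x4; decide
  refine ⟨S, ?_⟩
  rintro ⟨⟨i, j⟩, t⟩
  cases t
  · simpa [gface] using hstep i j
  · simp only [gface, if_true]
    by_cases hj : j ≤ K
    · rw [hlow i j hj, hlow (i - 1) j hj, hK i j _ hj]; rfl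
    · have := hvert (j - K).toNat i
      rw [show K + (((j - K).toNat : ℕ) : ℤ) = j by omega] at this
      exact this

/-- A set of grid points is connected inside the grid, expressed by chains. -/
def GridConn (B : Set GridPt) : Prop :=
  ∀ p ∈ B, ∀ q ∈ B, ∃ c : GridEdge →₀ ZMod 2, (∀ d, c d ≠ 0 → d.1 ∈ B ∧ ghead d ∈ B) ∧
    gbd c = Finsupp.single p 1 + Finsupp.single q 1

/-- A minor of the grid has a combinatorial dual. -/
theorem hasDual_of_grid_minor {T : SimpleGraph V} (B : V → Set GridPt)
    (hfin : ∀ v, (B v).Finite) (hne : ∀ v, (B v).Nonempty)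
    (hdisj : ∀ u v, u ≠ v → Disjoint (B u) (B v)) (hconn : ∀ v, GridConn (B v))
    (h : Sym2 V → GridEdge)
    (hh : ∀ u v, T.Adj u v → ((h s(u, v)).1 ∈ B u ∧ ghead (h s(u, v)) ∈ B v) ∨
      ((h s(u, v)).1 ∈ B v ∧ ghead (h s(u, v)) ∈ B u)) : HasDual T := by
  classical
  have huniq : ∀ {u v p}, p ∈ B u → p ∈ B v → u = v := by
    intro u v p hu hv
    by_contra hne
    exact (Set.disjoint_left.1 (hdisj u v hne)) hu hv
  let Internal : GridEdge → Prop := fun d => ∃ v, d.1 ∈ B v ∧ ghead d ∈ B v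
  let Spec : GridEdge → Prop := fun d => ∃ e ∈ T.edgeSet, d = h e
  have hinj : ∀ e ∈ T.edgeSet, ∀ f ∈ T.edgeSet, h e = h f → e = f := by
    intro e he f hf heq
    induction e with
    | _ a b =>
    induction f with
    | _ c d =>
    have h1 := hh a b (by simpa using he)
    have h2 := hh c d (by simpa using hf)
    rw [heq] at h1
    rcases h1 with ⟨h11, h12⟩ | ⟨h11, h12⟩ <;> rcases h2 with ⟨h21, h22⟩ | ⟨h21, h22⟩ <;>
      simp [huniq h11 h21, huniq h12 h22]
  have hspecint : ∀ e ∈ T.edgeSet, ¬ Internal (h e) := by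
    rintro e he ⟨v, h1, h2⟩
    induction e with
    | _ a b =>
    have hab : T.Adj a b := by simpa using he
    rcases hh a b hab with ⟨h3, h4⟩ | ⟨h3, h4⟩
    · exact hab.ne ((huniq h3 h1).trans (huniq h2 h4))
    · exact hab.ne ((huniq h4 h2).trans (huniq h1 h3))
  let rel : GridPt → GridPt → Prop := fun f g =>
    ∃ d : GridEdge, ¬ Internal d ∧ ¬ Spec d ∧ f = d.1 ∧ g = gface d
  refine IsDual.hasDual (F := Quot rel) (l := fun e => Quot.mk rel (h e).1)
    (r := fun e => Quot.mk rel (gface (h e))) fun x => ⟨?_, ?_⟩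
  · rintro ⟨hx, hbx⟩
    choose z hz using hne
    have hce : ∀ e, ∃ c : GridEdge →₀ ZMod 2, e ∈ T.edgeSet →
        (∀ d, c d ≠ 0 → Internal d ∨ d = h e) ∧ c (h e) = 1 ∧
        ∀ u v, e = s(u, v) → gbd c = Finsupp.single (z u) 1 + Finsupp.single (z v) 1 := by
      intro e
      by_cases he : e ∈ T.edgeSet
      · induction e with
        | _ a b =>
        have hab : T.Adj a b := by simpa using he
        have main : ∀ a b, T.Adj a b → (h s(a, b)).1 ∈ B a → ghead (h s(a, b)) ∈ B b →
            ∃ c : GridEdge →₀ ZMod 2,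
            (∀ d, c d ≠ 0 → Internal d ∨ d = h s(a, b)) ∧ c (h s(a, b)) = 1 ∧
            gbd c = Finsupp.single (z a) 1 + Finsupp.single (z b) 1 := by
          intro a b hab h1 h2
          have he : s(a, b) ∈ T.edgeSet := by simpa using hab
          obtain ⟨c1, hc1, hb1⟩ := hconn a _ h1 _ (hz a)
          obtain ⟨c2, hc2, hb2⟩ := hconn b _ h2 _ (hz b)
          have i1 : ∀ d, c1 d ≠ 0 → Internal d := fun d hd => ⟨a, hc1 d hd⟩
          have i2 : ∀ d, c2 d ≠ 0 → Internal d := fun d hd => ⟨b, hc2 d hd⟩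
          refine ⟨Finsupp.single (h s(a, b)) 1 + c1 + c2, fun d hd => ?_, ?_, ?_⟩
          · by_contra hcon
            push Not at hcon
            have n1 : c1 d = 0 := by by_contra h0; exact hcon.1 (i1 d h0)
            have n2 : c2 d = 0 := by by_contra h0; exact hcon.1 (i2 d h0)
            simp [n1, n2, Finsupp.single_apply, hcon.2.symm] at hd
          · have n1 : c1 (h s(a, b)) = 0 := by
              by_contra h0; exact hspecint _ he (i1 _ h0)
            have n2 : c2 (h s(a, b)) = 0 := by
              by_contra h0; exact hspecint _ he (i2 _ h0)
            simp [n1, n2]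
          · rw [map_add, map_add, gbd_single, hb1, hb2]
            have t1 : ∀ p : GridPt, (Finsupp.single p 1 + Finsupp.single p 1 : GridPt →₀ ZMod 2)
              = 0 := fun p => by rw [← Finsupp.single_add, zadd_self, Finsupp.single_zero]
            have e1 := t1 (h s(a, b)).1
            have e2 := t1 (ghead (h s(a, b)))
            calc _ = (Finsupp.single (h s(a, b)).1 1 + Finsupp.single (h s(a, b)).1 1) +
                  (Finsupp.single (ghead (h s(a, b))) 1 + Finsupp.single (ghead (h s(a, b))) 1) +
                  (Finsupp.single (z a) 1 + Finsupp.single (z b) 1 : GridPt →₀ ZMod 2) := by abel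
              _ = _ := by rw [e1, e2, zero_add, zero_add]
        rcases hh a b hab with ⟨h1, h2⟩ | ⟨h1, h2⟩
        · obtain ⟨c, p1, p2, p3⟩ := main a b hab h1 h2
          refine ⟨c, fun _ => ⟨p1, p2, fun u v huv => ?_⟩⟩
          rcases Sym2.eq_iff.1 huv with ⟨rfl, rfl⟩ | ⟨rfl, rfl⟩
          · exact p3
          · rw [p3, add_comm]
        · have hs : s(a, b) = s(b, a) := Sym2.eq_swap
          rw [hs] at h1 h2
          obtain ⟨c, p1, p2, p3⟩ := main b a hab.symm h1 h2
          refine ⟨c, fun _ => ⟨by rw [hs]; exact p1, by rw [hs]; exact p2, fun u v huv => ?_⟩⟩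
          rcases Sym2.eq_iff.1 huv with ⟨rfl, rfl⟩ | ⟨rfl, rfl⟩
          · rw [p3, add_comm]
          · exact p3
      · exact ⟨0, fun h => absurd h he⟩
    choose c hc using hce
    have hX : gbd (∑ e, x e • c e) = 0 := by
      rw [map_sum]
      have h1 : ∀ e, gbd (x e • c e) = x e • Sym2.lift ⟨fun u v =>
          (Finsupp.single (z u) 1 + Finsupp.single (z v) 1 : GridPt →₀ ZMod 2),
          fun _ _ => add_comm _ _⟩ e := by
        intro e
        by_cases he : e ∈ T.edgeSet
        · rw [map_smul]
          congr 1
          induction e with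
          | _ a b => rw [(hc _ he).2.2 a b rfl, Sym2.lift_mk]
        · rw [hx e he, zero_smul, zero_smul, map_zero]
      rw [Finset.sum_congr rfl fun e _ => h1 e, sum_sym2_smul x hx.diag
        (fun v => (Finsupp.single (z v) 1 : GridPt →₀ ZMod 2)) _ (fun u v => Sym2.lift_mk _ _ _)]
      refine Finset.sum_eq_zero fun v _ => ?_
      have : bd x v = 0 := congrFun hbx v
      rw [this, zero_smul]
    obtain ⟨S, hS⟩ := exists_faces_of_gbd_eq_zero hX
    have hval : ∀ d, (∑ e, x e • c e) d = ∑ e, x e * c e d := by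
      intro d; simp [Finsupp.finsetSum_apply]
    have hrel : ∀ f g, rel f g → S f = S g := by
      rintro f g ⟨d, hd1, hd2, rfl, rfl⟩
      have h1 := hS d
      rw [hval] at h1
      rw [← zadd_eq_zero, ← h1]
      refine Finset.sum_eq_zero fun e _ => ?_
      by_cases he : e ∈ T.edgeSet
      · have : c e d = 0 := by
          by_contra h0
          rcases (hc e he).1 d h0 with h3 | h3
          · exact hd1 h3
          · exact hd2 ⟨e, he, h3⟩
        rw [this, mul_zero]
      · rw [hx e he, zero_mul]
    refine ⟨Quot.lift S hrel, ?_⟩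
    funext e
    by_cases he : e ∈ T.edgeSet
    · rw [cobd_of_mem he]
      change x e = S (h e).1 + S (gface (h e))
      rw [← hS, hval, Finset.sum_eq_single e, (hc e he).2.1, mul_one]
      · intro f _ hfe
        by_cases hf : f ∈ T.edgeSet
        · have : c f (h e) = 0 := by
            by_contra h0
            rcases (hc f hf).1 _ h0 with h3 | h3
            · exact hspecint e he h3
            · exact hfe (hinj e he f hf h3).symm
          rw [this, mul_zero]
        · rw [hx f hf, zero_mul]
      · simp
    · rw [cobd_of_notMem he, hx e he]
  · rintro ⟨S, rfl⟩
    refine ⟨suppOn_cobd _ _ _ _, ?_⟩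
    let X : GridEdge → ZMod 2 := fun d => S (Quot.mk rel d.1) + S (Quot.mk rel (gface d))
    have hX0 : ∀ d, ¬ Internal d → ¬ Spec d → X d = 0 := by
      intro d h1 h2
      have : Quot.mk rel d.1 = Quot.mk rel (gface d) := Quot.sound ⟨d, h1, h2, rfl, rfl⟩
      simp only [X, this, zadd_self]
    have hXfin : (Function.support X).Finite := by
      have hsub : Function.support X ⊆ ((⋃ v, B v) ×ˢ Set.univ) ∪ range h := by
        intro d hd
        by_cases h1 : Internal d
        · left
          obtain ⟨v, hv, _⟩ := h1
          exact ⟨Set.mem_iUnion.2 ⟨v, hv⟩, trivial⟩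
        · by_cases h2 : Spec d
          · right; obtain ⟨e, _, rfl⟩ := h2; exact ⟨e, rfl⟩
          · exact absurd (hX0 d h1 h2) hd
      exact (((Set.finite_iUnion hfin).prod Set.finite_univ).union (Set.finite_range h)).subset hsub
    let c : GridEdge →₀ ZMod 2 := Finsupp.ofSupportFinite X hXfin
    have hc : ∀ d, c d = X d := fun d => rfl
    have hbc : gbd c = 0 := gbd_eq_zero_of_faces (S := fun p => S (Quot.mk rel p)) hc
    set x := cobd T (fun e => Quot.mk rel (h e).1) (fun e => Quot.mk rel (gface (h e))) S with hx
    have hxe : ∀ e ∈ T.edgeSet, x e = c (h e) := by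
      intro e he; rw [hx, cobd_of_mem he]; rfl
    have hxs : SuppOn T x := suppOn_cobd _ _ _ _
    funext v
    let aug : (GridPt →₀ ZMod 2) →ₗ[ZMod 2] ZMod 2 :=
      Finsupp.linearCombination (ZMod 2) (fun p => if p ∈ B v then 1 else 0)
    have haugs : ∀ d y, aug (gbd (Finsupp.single d y)) =
        y * ((if d.1 ∈ B v then 1 else 0) + (if ghead d ∈ B v then 1 else 0)) := by
      intro d y
      rw [gbd_single]
      simp only [aug, map_add, Finsupp.linearCombination_single, smul_eq_mul]; ring
    let ci : GridEdge →₀ ZMod 2 := c + ∑ e, x e • Finsupp.single (h e) 1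
    have hci : ∀ d, ci d ≠ 0 → Internal d := by
      intro d hd
      by_contra hnmem
      apply hd
      have hval : ci d = c d + ∑ e, x e * (if h e = d then 1 else 0) := by
        simp [ci, Finsupp.finsetSum_apply, Finsupp.single_apply]
      rw [hval]
      by_cases hsp : Spec d
      · obtain ⟨e, he, rfl⟩ := hsp
        rw [Finset.sum_eq_single e, if_pos rfl, mul_one, hxe e he, zadd_self]
        · intro f _ hfe
          by_cases hf : f ∈ T.edgeSet
          · rw [if_neg (fun heq => hfe (hinj f hf e he heq)), mul_zero]
          · rw [hxs f hf, zero_mul]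
        · simp
      · rw [hc, hX0 d hnmem hsp, zero_add]
        refine Finset.sum_eq_zero fun e _ => ?_
        by_cases he : e ∈ T.edgeSet
        · rw [if_neg (fun heq => hsp ⟨e, he, heq.symm⟩), mul_zero]
        · rw [hxs e he, zero_mul]
    have haugi : aug (gbd ci) = 0 := by
      conv_lhs => rw [← Finsupp.sum_single ci]
      rw [Finsupp.sum, map_sum, map_sum]
      refine Finset.sum_eq_zero fun d hd => ?_
      obtain ⟨w, h1, h2⟩ := hci d (Finsupp.mem_support_iff.1 hd)
      rw [haugs]
      by_cases hwv : w = v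
      · subst hwv; rw [if_pos h1, if_pos h2, zadd_self, mul_zero]
      · rw [if_neg (fun h3 => hwv (huniq h1 h3)), if_neg (fun h3 => hwv (huniq h2 h3))]; simp
    have h1 : aug (gbd ci) = ∑ e, x e • Sym2.lift ⟨fun u w =>
        (Pi.single u 1 + Pi.single w 1 : V → ZMod 2) v, fun _ _ => congrFun (add_comm _ _) v⟩ e := by
      simp only [ci]
      rw [map_add, hbc, zero_add, map_sum, map_sum]
      refine Finset.sum_congr rfl fun e _ => ?_
      by_cases he : e ∈ T.edgeSet
      · rw [map_smul, map_smul, haugs, one_mul]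
        congr 1
        induction e with
        | _ a b =>
        have mem : ∀ {p u}, p ∈ B u → ((if p ∈ B v then (1 : ZMod 2) else 0)
            = (Pi.single u 1 : V → ZMod 2) v) := by
          intro p u hp
          by_cases huv : v = u
          · subst huv; simp [hp]
          · rw [if_neg (fun h3 => huv (huniq h3 hp)), Pi.single_apply, if_neg huv]
        rw [Sym2.lift_mk]
        change _ = (Pi.single a 1 : V → ZMod 2) v + (Pi.single b 1 : V → ZMod 2) v
        rcases hh a b (by simpa using he) with ⟨h3, h4⟩ | ⟨h3, h4⟩
        · rw [mem h3, mem h4]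
        · rw [mem h3, mem h4, add_comm]
      · rw [hxs e he]; simp
    rw [haugi, sum_sym2_smul x hxs.diag (fun u => (Pi.single u 1 : V → ZMod 2) v) _
      (fun u w => by rw [Sym2.lift_mk]; rfl)] at h1
    simp [Pi.single_apply] at h1
    exact h1.symm

end ArcDual

namespace ArcDual

open Filter Topology Relation

/-- Adjacency in the integer grid. -/
def GridAdj (p q : GridPt) : Prop :=
  ∃ d : GridEdge, (d.1 = p ∧ ghead d = q) ∨ (d.1 = q ∧ ghead d = p)

theorem GridAdj.symm {p q : GridPt} (h : GridAdj p q) : GridAdj q p := by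
  obtain ⟨d, hd⟩ := h
  exact ⟨d, hd.symm⟩

theorem gridAdj_of_fst {i i' j : ℤ} (h : i' = i + 1 ∨ i = i' + 1) : GridAdj (i, j) (i', j) := by
  rcases h with rfl | rfl
  · exact ⟨((i, j), false), Or.inl ⟨rfl, rfl⟩⟩
  · exact ⟨((i', j), false), Or.inr ⟨rfl, rfl⟩⟩

theorem gridAdj_of_snd {i j j' : ℤ} (h : j' = j + 1 ∨ j = j' + 1) : GridAdj (i, j) (i, j') := by
  rcases h with rfl | rfl
  · exact ⟨((i, j), true), Or.inl ⟨rfl, rfl⟩⟩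
  · exact ⟨((i, j'), true), Or.inr ⟨rfl, rfl⟩⟩

/-- A grid step inside the set `B`. -/
def GridStep (B : Set GridPt) (p q : GridPt) : Prop := p ∈ B ∧ q ∈ B ∧ GridAdj p q

/-- Two grid points joined by a grid path inside `B`. -/
def GridPath (B : Set GridPt) : GridPt → GridPt → Prop := ReflTransGen (GridStep B)

theorem GridPath.symm {B : Set GridPt} {p q : GridPt} (h : GridPath B p q) : GridPath B q p := by
  induction h with
  | refl => exact ReflTransGen.refl
  | tail _ h2 ih => exact ReflTransGen.head ⟨h2.2.1, h2.1, h2.2.2.symm⟩ ih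

theorem GridPath.mono {B C : Set GridPt} (hBC : B ⊆ C) {p q : GridPt} (h : GridPath B p q) :
    GridPath C p q := by
  induction h with
  | refl => exact ReflTransGen.refl
  | tail _ h2 ih => exact ReflTransGen.tail ih ⟨hBC h2.1, hBC h2.2.1, h2.2.2⟩

theorem gridConn_of_paths {B : Set GridPt} (h : ∀ p ∈ B, ∀ q ∈ B, GridPath B p q) :
    GridConn B := by
  intro p hp q hq
  have h1 := h p hp q hq
  clear hq
  induction h1 with
  | refl =>
    exact ⟨0, by simp, by rw [map_zero, ← Finsupp.single_add, zadd_self, Finsupp.single_zero]⟩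
  | @tail x y _ h2 ih =>
    obtain ⟨c, hc, hb⟩ := ih
    obtain ⟨h3, h4, d, hd⟩ := h2
    have hs := zadd_self (1 : ZMod 2)
    refine ⟨c + Finsupp.single d 1, ?_, ?_⟩
    · intro d' hd'
      by_cases h5 : d' = d
      · subst h5
        rcases hd with ⟨rfl, rfl⟩ | ⟨rfl, rfl⟩
        · exact ⟨h3, h4⟩
        · exact ⟨h4, h3⟩
      · rw [Finsupp.add_apply, Finsupp.single_apply, if_neg (Ne.symm h5), add_zero] at hd'
        exact hc d' hd'
    · have hx : (Finsupp.single x 1 : GridPt →₀ ZMod 2) + Finsupp.single x 1 = 0 := by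
        rw [← Finsupp.single_add, hs, Finsupp.single_zero]
      have hdd : gbd (Finsupp.single d 1) = Finsupp.single x 1 + Finsupp.single y 1 := by
        rw [gbd_single]
        rcases hd with ⟨rfl, rfl⟩ | ⟨rfl, rfl⟩
        · rfl
        · exact add_comm _ _
      rw [map_add, hb, hdd]
      rw [add_assoc, ← add_assoc (Finsupp.single x 1), hx, zero_add]

/-- The grid points whose `ε`-scaled copy is within distance `ε` of `K`. -/
def pix (ε : ℝ) (K : Set (ℝ × ℝ)) : Set GridPt :=
  {z | ∃ p ∈ K, dist ((ε * z.1, ε * z.2) : ℝ × ℝ) p ≤ ε}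

theorem pix_mono (ε : ℝ) {K L : Set (ℝ × ℝ)} (h : K ⊆ L) : pix ε K ⊆ pix ε L :=
  fun _ ⟨p, hp, h2⟩ => ⟨p, h hp, h2⟩

theorem mem_pix_singleton {ε : ℝ} {z : GridPt} {p : ℝ × ℝ} :
    z ∈ pix ε {p} ↔ |ε * z.1 - p.1| ≤ ε ∧ |ε * z.2 - p.2| ≤ ε := by
  simp [pix, Prod.dist_eq, Real.dist_eq]

/-- The grid point nearest to `p`. -/
noncomputable def gridRound (ε : ℝ) (p : ℝ × ℝ) : GridPt := (round (p.1 / ε), round (p.2 / ε))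

theorem abs_mul_round_le {ε : ℝ} (hε : 0 < ε) (x : ℝ) : |ε * (round (x / ε) : ℤ) - x| ≤ ε / 2 := by
  have h1 := abs_sub_round (x / ε)
  have h2 : ε * (round (x / ε) : ℤ) - x = -(ε * (x / ε - (round (x / ε) : ℤ))) := by
    field_simp; ring
  rw [h2, abs_neg, abs_mul, abs_of_pos hε]
  nlinarith

theorem gridRound_mem {ε : ℝ} (hε : 0 < ε) {p q : ℝ × ℝ} (h : dist p q ≤ ε / 2) :
    gridRound ε p ∈ pix ε {q} := by
  rw [mem_pix_singleton]
  rw [Prod.dist_eq, Real.dist_eq, Real.dist_eq, max_le_iff] at h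
  have h1 := abs_mul_round_le hε p.1
  have h2 := abs_mul_round_le hε p.2
  constructor
  · exact (abs_sub_le _ p.1 _).trans (by simp only [gridRound]; linarith)
  · exact (abs_sub_le _ p.2 _).trans (by simp only [gridRound]; linarith)

theorem int_close {ε : ℝ} (hε : 0 < ε) {i j : ℤ} {x : ℝ} (h1 : |ε * i - x| ≤ ε)
    (h2 : |ε * j - x| ≤ ε / 2) : i = j ∨ j = i + 1 ∨ i = j + 1 := by
  rw [abs_le] at h1 h2
  have h3 : ((i : ℝ) - j) < 2 := by nlinarith
  have h4 : ((j : ℝ) - i) < 2 := by nlinarith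
  have h5 : i - j < 2 := by exact_mod_cast h3
  have h6 : j - i < 2 := by exact_mod_cast h4
  omega

theorem path_gridRound {ε : ℝ} (hε : 0 < ε) {p : ℝ × ℝ} {z : GridPt} (hz : z ∈ pix ε {p}) :
    GridPath (pix ε {p}) z (gridRound ε p) := by
  have hz' := mem_pix_singleton.1 hz
  have hc := gridRound_mem hε (p := p) (q := p) (by rw [dist_self]; positivity)
  have hc' := mem_pix_singleton.1 hc
  obtain ⟨i, j⟩ := z
  set c := gridRound ε p with hcd
  have hm : ((c.1, j) : GridPt) ∈ pix ε {p} := mem_pix_singleton.2 ⟨hc'.1, hz'.2⟩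
  have s1 : GridPath (pix ε {p}) (i, j) (c.1, j) := by
    rcases int_close hε hz'.1 (abs_mul_round_le hε p.1) with h | h
    · have : i = c.1 := h
      rw [this]; exact ReflTransGen.refl
    · exact ReflTransGen.single ⟨hz, hm, gridAdj_of_fst h⟩
  have s2 : GridPath (pix ε {p}) (c.1, j) (c.1, c.2) := by
    rcases int_close hε hz'.2 (abs_mul_round_le hε p.2) with h | h
    · have : j = c.2 := h
      rw [this]; exact ReflTransGen.refl
    · exact ReflTransGen.single ⟨hm, hc, gridAdj_of_snd h⟩
  exact s1.trans s2

theorem pix_path {ε : ℝ} (hε : 0 < ε) {K : Set (ℝ × ℝ)} (hK : IsPreconnected K) :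
    ∀ z ∈ pix ε K, ∀ w ∈ pix ε K, GridPath (pix ε K) z w := by
  rintro z ⟨p, hp, hz⟩ w ⟨q, hq, hw⟩
  have hsub : ∀ x ∈ K, pix ε {x} ⊆ pix ε K := fun x hx => pix_mono ε (by simpa using hx)
  have key := hK.induction₂' (fun x y => ∀ z ∈ pix ε {x}, ∀ w ∈ pix ε {y},
    GridPath (pix ε K) z w) ?_ ?_ hp hq
  · exact key z ⟨p, rfl, hz⟩ w ⟨q, rfl, hw⟩
  · intro x hx
    have h1 : ∀ᶠ y in 𝓝[K] x, y ∈ K := eventually_mem_nhdsWithin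
    have h2 : ∀ᶠ y in 𝓝[K] x, dist y x ≤ ε / 2 := nhdsWithin_le_nhds
      (Metric.closedBall_mem_nhds x (by positivity))
    filter_upwards [h1, h2] with y hy hxy
    have key2 : ∀ z ∈ pix ε {x}, ∀ w ∈ pix ε {y}, GridPath (pix ε K) z w := by
      intro z hz w hw
      have a1 := (path_gridRound hε hz).mono (hsub x hx)
      have a2 := (path_gridRound hε hw).mono (hsub y hy)
      have a3 := (path_gridRound hε (gridRound_mem hε hxy)).mono (hsub x hx)
      exact (a1.trans a3.symm).trans a2.symm
    exact ⟨key2, fun z hz w hw => (key2 w hw z hz).symm⟩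
  · intro x y u _ _ _ h1 h2 z hz w hw
    have hm := gridRound_mem hε (p := y) (q := y) (by rw [dist_self]; positivity)
    exact (h1 z hz _ hm).trans (h2 _ hm w hw)

theorem pix_nonempty {ε : ℝ} (hε : 0 < ε) {K : Set (ℝ × ℝ)} {p : ℝ × ℝ} (hp : p ∈ K) :
    gridRound ε p ∈ pix ε K :=
  pix_mono ε (Set.singleton_subset_iff.2 hp) (gridRound_mem hε (by rw [dist_self]; positivity))

theorem pix_finite {ε : ℝ} (hε : 0 < ε) {K : Set (ℝ × ℝ)} (hK : IsBounded K) :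
    (pix ε K).Finite := by
  obtain ⟨R, hR⟩ := hK.subset_closedBall (0 : ℝ × ℝ)
  let N : ℤ := ⌈(R + ε) / ε⌉
  refine (((Set.finite_Icc (-N) N).prod (Set.finite_Icc (-N) N))).subset ?_
  rintro z ⟨p, hp, hz⟩
  have h1 := hR hp
  rw [Metric.mem_closedBall] at h1
  have h2 : dist ((ε * z.1, ε * z.2) : ℝ × ℝ) 0 ≤ R + ε := by
    have := dist_triangle ((ε * z.1, ε * z.2) : ℝ × ℝ) p 0
    linarith
  rw [Prod.dist_eq, max_le_iff] at h2
  simp only [Prod.fst_zero, Prod.snd_zero, Real.dist_eq, sub_zero, abs_mul, abs_of_pos hε] at h2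
  have h3 : ∀ i : ℤ, ε * |(i : ℝ)| ≤ R + ε → i ∈ Set.Icc (-N) N := by
    intro i hi
    have h4 : |(i : ℝ)| ≤ (R + ε) / ε := by rw [le_div_iff₀ hε]; linarith
    have h5 : |(i : ℝ)| ≤ (N : ℝ) := h4.trans (Int.le_ceil _)
    have h6 : |i| ≤ N := by exact_mod_cast h5
    exact ⟨(abs_le.1 h6).1, (abs_le.1 h6).2⟩
  exact ⟨h3 _ h2.1, h3 _ h2.2⟩

theorem eventually_pix_disjoint {K L : Set (ℝ × ℝ)} (hK : IsCompact K) (hL : IsCompact L)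
    (h : Disjoint K L) : ∀ᶠ ε in 𝓝[>] (0 : ℝ), Disjoint (pix ε K) (pix ε L) := by
  obtain ⟨δ, hδ, hd⟩ := h.exists_cthickenings hK hL.isClosed
  filter_upwards [Ioo_mem_nhdsGT hδ] with ε hε
  rw [Set.disjoint_left]
  rintro z ⟨p, hp, h1⟩ ⟨q, hq, h2⟩
  exact Set.disjoint_left.1 hd
    (Metric.mem_cthickening_of_dist_le _ _ _ _ hp (h1.trans hε.2.le))
    (Metric.mem_cthickening_of_dist_le _ _ _ _ hq (h2.trans hε.2.le))

/-- A connected grid set from `U` to `W` contributes a tentacle of `U` adjacent to `W`. -/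
theorem exists_tentacle {U W K : Set GridPt} {p q : GridPt} (hp : p ∈ U) (hq : q ∈ W)
    (hUW : Disjoint U W) (h : GridPath K p q) :
    ∃ (M : Set GridPt) (d : GridEdge), M ⊆ K ∧ Disjoint M U ∧ Disjoint M W ∧
      (∀ m ∈ M, ∃ u ∈ U, GridPath (U ∪ M) u m) ∧
      ((d.1 ∈ U ∪ M ∧ ghead d ∈ W) ∨ (d.1 ∈ W ∧ ghead d ∈ U ∪ M)) := by
  let M : Set GridPt := {m | m ∉ U ∧ ∃ u ∈ U,
    ReflTransGen (fun x y => GridAdj x y ∧ y ∈ K ∧ y ∉ U ∧ y ∉ W) u m}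
  have hM : ∀ m ∈ M, m ∈ K ∧ m ∉ U ∧ m ∉ W := by
    rintro m ⟨h1, u, hu, h2⟩
    rcases ReflTransGen.cases_tail h2 with h3 | ⟨x, _, h3⟩
    · exact absurd (h3 ▸ hu) h1
    · exact h3.2
  have key : q ∈ U ∪ M ∨ ∃ d : GridEdge,
      ((d.1 ∈ U ∪ M ∧ ghead d ∈ W) ∨ (d.1 ∈ W ∧ ghead d ∈ U ∪ M)) := by
    clear hq
    induction h with
    | refl => exact Or.inl (Or.inl hp)
    | @tail x y _ h2 ih =>
      rcases ih with ih | ih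
      · by_cases hyU : y ∈ U
        · exact Or.inl (Or.inl hyU)
        by_cases hyW : y ∈ W
        · right
          obtain ⟨d, hd⟩ := h2.2.2
          refine ⟨d, ?_⟩
          rcases hd with ⟨h3, h4⟩ | ⟨h3, h4⟩
          · left; rw [h3, h4]; exact ⟨ih, hyW⟩
          · right; rw [h3, h4]; exact ⟨hyW, ih⟩
        · left; right
          refine ⟨hyU, ?_⟩
          have st : GridAdj x y ∧ y ∈ K ∧ y ∉ U ∧ y ∉ W := ⟨h2.2.2, h2.2.1, hyU, hyW⟩
          rcases ih with ih | ⟨_, u, hu, ih⟩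
          · exact ⟨x, ih, ReflTransGen.single st⟩
          · exact ⟨u, hu, ih.tail st⟩
      · exact Or.inr ih
  have key2 : ∃ d : GridEdge,
      ((d.1 ∈ U ∪ M ∧ ghead d ∈ W) ∨ (d.1 ∈ W ∧ ghead d ∈ U ∪ M)) := by
    rcases key with (h1 | h1) | h1
    · exact absurd hq (Set.disjoint_left.1 hUW h1)
    · exact absurd hq (hM q h1).2.2
    · exact h1
  obtain ⟨d, hd⟩ := key2
  refine ⟨M, d, fun m hm => (hM m hm).1, Set.disjoint_left.2 fun m hm => (hM m hm).2.1,
    Set.disjoint_left.2 fun m hm => (hM m hm).2.2, ?_, hd⟩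
  rintro m ⟨hmU, u, hu, h1⟩
  refine ⟨u, hu, ?_⟩
  clear hmU
  have : GridPath (U ∪ M) u m ∧ m ∈ U ∪ M := by
    induction h1 with
    | refl => exact ⟨ReflTransGen.refl, Or.inl hu⟩
    | @tail x y h3 h2 ih =>
      have hy : y ∈ U ∪ M := Or.inr ⟨h2.2.2.1, u, hu, h3.tail h2⟩
      exact ⟨ih.1.tail ⟨ih.2, hy, h2.1⟩, hy⟩
  exact this.1

variable {V : Type} [Fintype V] [DecidableEq V]

theorem _root_.PlaneDrawing.vert_mem_edgeImage {G : SimpleGraph V} (D : PlaneDrawing G) {a b : V}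
    (h : G.Adj a b) : D.vert a ∈ D.edgeImage s(a, b) := by
  have h1 : D.vert a ∈ ({D.edge s(a, b) 0, D.edge s(a, b) 1} : Set (ℝ × ℝ)) := by
    rw [D.edge_ends a b h]; simp
  rcases h1 with h1 | h1
  · exact ⟨0, by simp, h1.symm⟩
  · exact ⟨1, by simp, h1.symm⟩

theorem _root_.PlaneDrawing.mem_edgeImage_cases {G : SimpleGraph V} (D : PlaneDrawing G) {a b : V}
    (h : G.Adj a b) {p : ℝ × ℝ} (hp : p ∈ D.edgeImage s(a, b)) :
    p ∈ D.edge s(a, b) '' Set.Ioo 0 1 ∨ p = D.vert a ∨ p = D.vert b := by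
  obtain ⟨t, ht, rfl⟩ := hp
  have hmem : t = 0 ∨ t = 1 →
      D.edge s(a, b) t ∈ ({D.edge s(a, b) 0, D.edge s(a, b) 1} : Set (ℝ × ℝ)) := by
    rintro (rfl | rfl) <;> simp
  rw [D.edge_ends a b h] at hmem
  by_cases h0 : t = 0
  · exact Or.inr (hmem (Or.inl h0))
  by_cases h1 : t = 1
  · exact Or.inr (hmem (Or.inr h1))
  · exact Or.inl ⟨t, ⟨lt_of_le_of_ne ht.1 (Ne.symm h0), lt_of_le_of_ne ht.2 h1⟩, rfl⟩

theorem _root_.PlaneDrawing.vert_notMem_edgeImage {G : SimpleGraph V} (D : PlaneDrawing G)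
    {e : Sym2 V} (he : e ∈ G.edgeSet) {v : V} (hv : v ∉ e) : D.vert v ∉ D.edgeImage e := by
  induction e using Sym2.ind with
  | _ a b =>
  intro h
  rw [Sym2.mem_iff] at hv
  rcases D.mem_edgeImage_cases he h with h1 | h1 | h1
  · exact D.edge_int_vert _ he v h1
  · exact hv (Or.inl (D.vert_inj h1))
  · exact hv (Or.inr (D.vert_inj h1))

theorem _root_.PlaneDrawing.mem_two_edgeImages {G : SimpleGraph V} (D : PlaneDrawing G)
    {e f : Sym2 V} (he : e ∈ G.edgeSet) (hf : f ∈ G.edgeSet) (hef : e ≠ f) {p : ℝ × ℝ}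
    (h1 : p ∈ D.edgeImage e) (h2 : p ∈ D.edgeImage f) : ∃ v, p = D.vert v := by
  have aux : ∀ e ∈ G.edgeSet, p ∈ D.edgeImage e →
      p ∈ D.edge e '' Set.Ioo 0 1 ∨ ∃ v, p = D.vert v := by
    intro e he h
    induction e using Sym2.ind with
    | _ a b =>
    rcases D.mem_edgeImage_cases he h with h1 | h1 | h1
    · exact Or.inl h1
    · exact Or.inr ⟨a, h1⟩
    · exact Or.inr ⟨b, h1⟩
  rcases aux e he h1 with h3 | h3
  · rcases aux f hf h2 with h4 | h4
    · have : p ∈ D.edge e '' Set.Ioo 0 1 ∩ D.edge f '' Set.Ioo 0 1 := ⟨h3, h4⟩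
      rw [D.edge_disjoint e he f hf hef] at this
      exact this.elim
    · exact h4
  · exact h3

/-- A graph drawn in the plane has a combinatorial dual. -/
theorem hasDual_of_isPlanar {G : SimpleGraph V} (hG : IsPlanar G) : HasDual G := by
  classical
  obtain ⟨D⟩ := hG
  have hNc : ∀ e ∈ G.edgeSet, IsCompact (D.edgeImage e) := fun e he =>
    isCompact_Icc.image_of_continuousOn (D.edge_cont e he)
  have hNp : ∀ e ∈ G.edgeSet, IsPreconnected (D.edgeImage e) := fun e he =>
    isPreconnected_Icc.image _ (D.edge_cont e he)
  have small : ∀ (p : ℝ × ℝ) (L : Set (ℝ × ℝ)), IsClosed L → p ∉ L →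
      ∀ᶠ ρ in 𝓝[>] (0 : ℝ), Disjoint (Metric.closedBall p ρ) L := by
    intro p L hL hp
    have hnh : Lᶜ ∈ 𝓝 p := hL.isOpen_compl.mem_nhds hp
    obtain ⟨δ, hδ, hb⟩ := Metric.nhds_basis_closedBall.mem_iff.1 hnh
    filter_upwards [Ioo_mem_nhdsGT hδ] with ρ hρ
    exact Set.disjoint_left.2 fun x hx => hb (Metric.closedBall_subset_closedBall hρ.2.le hx)
  have hρ : ∀ᶠ ρ in 𝓝[>] (0 : ℝ), 0 < ρ ∧
      (∀ v w, v ≠ w → Disjoint (Metric.closedBall (D.vert v) ρ) (Metric.closedBall (D.vert w) ρ)) ∧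
      (∀ v, ∀ e, e ∈ G.edgeSet → v ∉ e →
        Disjoint (Metric.closedBall (D.vert v) ρ) (D.edgeImage e)) := by
    refine eventually_mem_nhdsWithin.and (Eventually.and ?_ ?_)
    · refine eventually_all.2 fun v => eventually_all.2 fun w => ?_
      by_cases hvw : v = w
      · exact Eventually.of_forall fun _ h => absurd hvw h
      have hpos : 0 < dist (D.vert v) (D.vert w) / 2 :=
        half_pos (dist_pos.2 fun h => hvw (D.vert_inj h))
      filter_upwards [Ioo_mem_nhdsGT hpos] with ρ hρ _
      exact Metric.closedBall_disjoint_closedBall (by linarith [hρ.2])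
    · refine eventually_all.2 fun v => eventually_all.2 fun e => ?_
      by_cases he : e ∈ G.edgeSet
      · by_cases hv : v ∈ e
        · exact Eventually.of_forall fun _ _ h => absurd hv h
        · filter_upwards [small (D.vert v) _ (hNc e he).isClosed (D.vert_notMem_edgeImage he hv)]
            with ρ hρ _ _ using hρ
      · exact Eventually.of_forall fun _ h => absurd h he
  obtain ⟨ρ, hρ0, hρ1, hρ2⟩ := hρ.exists
  let Ball : V → Set (ℝ × ℝ) := fun v => Metric.closedBall (D.vert v) ρ
  let N' : Sym2 V → Set (ℝ × ℝ) := fun e => D.edgeImage e \ ⋃ v, Metric.ball (D.vert v) ρ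
  have hBc : ∀ v, IsCompact (Ball v) := fun v => isCompact_closedBall _ _
  have hN'c : ∀ e ∈ G.edgeSet, IsCompact (N' e) := fun e he =>
    (hNc e he).diff (isOpen_iUnion fun v => Metric.isOpen_ball)
  have hε : ∀ᶠ ε in 𝓝[>] (0 : ℝ), 0 < ε ∧
      (∀ v w, v ≠ w → Disjoint (pix ε (Ball v)) (pix ε (Ball w))) ∧
      (∀ v, ∀ e, e ∈ G.edgeSet → v ∉ e → Disjoint (pix ε (Ball v)) (pix ε (D.edgeImage e))) ∧
      (∀ e f, e ∈ G.edgeSet → f ∈ G.edgeSet → e ≠ f → Disjoint (pix ε (N' e)) (pix ε (N' f))) := by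
    refine eventually_mem_nhdsWithin.and (Eventually.and ?_ (Eventually.and ?_ ?_))
    · refine eventually_all.2 fun v => eventually_all.2 fun w => ?_
      by_cases hvw : v = w
      · exact Eventually.of_forall fun _ h => absurd hvw h
      filter_upwards [eventually_pix_disjoint (hBc v) (hBc w) (hρ1 v w hvw)] with ε h _ using h
    · refine eventually_all.2 fun v => eventually_all.2 fun e => ?_
      by_cases he : e ∈ G.edgeSet
      · by_cases hv : v ∈ e
        · exact Eventually.of_forall fun _ _ h => absurd hv h
        · filter_upwards [eventually_pix_disjoint (hBc v) (hNc e he) (hρ2 v e he hv)]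
            with ρ hρ _ _ using hρ
      · exact Eventually.of_forall fun _ h => absurd h he
    · refine eventually_all.2 fun e => eventually_all.2 fun f => ?_
      by_cases h : e ∈ G.edgeSet ∧ f ∈ G.edgeSet ∧ e ≠ f
      · obtain ⟨he, hf, hef⟩ := h
        have hd : Disjoint (N' e) (N' f) := by
          rw [Set.disjoint_left]
          rintro p ⟨h1, h2⟩ ⟨h3, _⟩
          obtain ⟨v, rfl⟩ := D.mem_two_edgeImages he hf hef h1 h3
          exact h2 (Set.mem_iUnion.2 ⟨v, Metric.mem_ball_self hρ0⟩)
        filter_upwards [eventually_pix_disjoint (hN'c e he) (hN'c f hf) hd] with ε h _ _ _ using h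
      · exact Eventually.of_forall fun _ h1 h2 h3 => absurd ⟨h1, h2, h3⟩ h
  obtain ⟨ε, hε0, hε1, hε2, hε3⟩ := hε.exists
  have hU : ∀ v, ∀ z ∈ pix ε (Ball v), ∀ w ∈ pix ε (Ball v), GridPath (pix ε (Ball v)) z w :=
    fun v => pix_path hε0 (convex_closedBall _ _).isPreconnected
  have hVB : ∀ v, D.vert v ∈ Ball v := fun v => Metric.mem_closedBall_self (le_of_lt hρ0)
  have hex : ∀ e : Sym2 V, ∃ (own : V) (M : Set GridPt) (d : GridEdge), e ∈ G.edgeSet →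
      ∃ w, e = s(own, w) ∧ M ⊆ pix ε (D.edgeImage e) ∧ Disjoint M (pix ε (Ball own)) ∧
        Disjoint M (pix ε (Ball w)) ∧
        (∀ m ∈ M, ∃ u ∈ pix ε (Ball own), GridPath (pix ε (Ball own) ∪ M) u m) ∧
        ((d.1 ∈ pix ε (Ball own) ∪ M ∧ ghead d ∈ pix ε (Ball w)) ∨
          (d.1 ∈ pix ε (Ball w) ∧ ghead d ∈ pix ε (Ball own) ∪ M)) := by
    intro e
    induction e using Sym2.ind with
    | _ a b =>
    by_cases hab : G.Adj a b
    · obtain ⟨M, d, h1, h2, h3, h4, h5⟩ := exists_tentacle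
        (pix_nonempty hε0 (hVB a)) (pix_nonempty hε0 (hVB b)) (hε1 a b hab.ne)
        (pix_path hε0 (hNp s(a, b) hab) _ (pix_nonempty hε0 (D.vert_mem_edgeImage hab)) _
          (pix_nonempty hε0 (by rw [Sym2.eq_swap]; exact D.vert_mem_edgeImage hab.symm)))
      exact ⟨a, M, d, fun _ => ⟨b, rfl, h1, h2, h3, h4, h5⟩⟩
    · exact ⟨a, ∅, ((0, 0), true), fun h => absurd h hab⟩
  choose own M h hM using hex
  have hMN' : ∀ e ∈ G.edgeSet, M e ⊆ pix ε (N' e) := by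
    intro e he m hm
    obtain ⟨w, hew, h1, h2, h3, -⟩ := hM e he
    obtain ⟨p, hp, hmp⟩ := h1 hm
    refine ⟨p, ⟨hp, ?_⟩, hmp⟩
    intro hp2
    obtain ⟨v, hv⟩ := Set.mem_iUnion.1 hp2
    have hm2 : m ∈ pix ε (Ball v) := ⟨p, Metric.ball_subset_closedBall hv, hmp⟩
    by_cases hve : v ∈ e
    · rw [hew, Sym2.mem_iff] at hve
      rcases hve with rfl | rfl
      · exact Set.disjoint_left.1 h2 hm hm2
      · exact Set.disjoint_left.1 h3 hm hm2
    · exact Set.disjoint_left.1 (hρ2 v e he hve) (Metric.ball_subset_closedBall hv) hp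
  have hMB : ∀ e ∈ G.edgeSet, ∀ v, Disjoint (M e) (pix ε (Ball v)) := by
    intro e he v
    obtain ⟨w, hew, h1, h2, h3, -⟩ := hM e he
    by_cases hve : v ∈ e
    · rw [hew, Sym2.mem_iff] at hve
      rcases hve with rfl | rfl
      · exact h2
      · exact h3
    · exact ((hε2 v e he hve).mono_right h1).symm
  let B : V → Set GridPt := fun v =>
    pix ε (Ball v) ∪ {m | ∃ e, e ∈ G.edgeSet ∧ own e = v ∧ m ∈ M e}
  have hsub : ∀ e ∈ G.edgeSet, pix ε (Ball (own e)) ∪ M e ⊆ B (own e) := by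
    rintro e he m (hm | hm)
    · exact Or.inl hm
    · exact Or.inr ⟨e, he, rfl, hm⟩
  refine hasDual_of_grid_minor B ?_ ?_ ?_ ?_ h ?_
  · intro v
    refine (pix_finite hε0 (hBc v).isBounded).union ?_
    refine (Set.finite_iUnion (fun e : G.edgeSet =>
      pix_finite hε0 (hNc e.1 e.2).isBounded)).subset ?_
    rintro m ⟨e, he, -, hm⟩
    obtain ⟨w, -, h1, -⟩ := hM e he
    exact Set.mem_iUnion.2 ⟨⟨e, he⟩, h1 hm⟩
  · intro v
    exact ⟨_, Or.inl (pix_nonempty hε0 (hVB v))⟩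
  · intro u v huv
    rw [Set.disjoint_left]
    rintro m (hm | ⟨e, he, hu, hm⟩) (hm' | ⟨f, hf, hv, hm'⟩)
    · exact Set.disjoint_left.1 (hε1 u v huv) hm hm'
    · exact Set.disjoint_left.1 (hMB f hf u) hm' hm
    · exact Set.disjoint_left.1 (hMB e he v) hm hm'
    · refine Set.disjoint_left.1 (hε3 e f he hf ?_) (hMN' e he hm) (hMN' f hf hm')
      rintro rfl
      exact huv (hu.symm.trans hv)
  · intro v
    apply gridConn_of_paths
    have key : ∀ m ∈ B v, ∃ u ∈ pix ε (Ball v), GridPath (B v) u m := by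
      rintro m (hm | ⟨e, he, rfl, hm⟩)
      · exact ⟨m, hm, ReflTransGen.refl⟩
      · obtain ⟨w, -, -, -, -, h4, -⟩ := hM e he
        obtain ⟨u, hu, h5⟩ := h4 m hm
        exact ⟨u, hu, h5.mono (hsub e he)⟩
    intro p hp q hq
    obtain ⟨u, hu, h1⟩ := key p hp
    obtain ⟨u', hu', h2⟩ := key q hq
    exact (h1.symm.trans ((hU v u hu u' hu').mono (fun _ => Or.inl))).trans h2
  · intro u v huv
    obtain ⟨w, hew, -, -, -, -, h5⟩ := hM s(u, v) huv
    have h6 : ((h s(u, v)).1 ∈ B (own s(u, v)) ∧ ghead (h s(u, v)) ∈ B w) ∨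
        ((h s(u, v)).1 ∈ B w ∧ ghead (h s(u, v)) ∈ B (own s(u, v))) :=
      h5.imp (fun h7 => ⟨hsub _ huv h7.1, Or.inl h7.2⟩) (fun h7 => ⟨Or.inl h7.1, hsub _ huv h7.2⟩)
    rw [Sym2.eq_iff] at hew
    rcases hew with ⟨h7, h8⟩ | ⟨h7, h8⟩
    · rw [← h7, ← h8] at h6; exact h6
    · rw [← h7, ← h8] at h6; exact h6.symm

/-- Every graph with a combinatorial dual is contained in an edge-maximal one. -/
theorem exists_maxDual {G : SimpleGraph V} (h : HasDual G) : ∃ T, G ≤ T ∧ MaxDual T := by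
  classical
  obtain ⟨T, hGT, hT⟩ := Set.Finite.exists_le_maximal (s := {T : SimpleGraph V | HasDual T})
    (Set.toFinite _) h
  refine ⟨T, hGT, hT.prop, fun a b hab hn hd => hn ?_⟩
  have h1 : addEdge T a b ≤ T := hT.le_of_ge hd le_sup_left
  have h2 : s(a, b) ∈ (addEdge T a b).edgeSet := (mem_addEdge hab _).2 (Or.inr rfl)
  exact SimpleGraph.edgeSet_mono h1 h2

end ArcDual

namespace ArcDual

variable {V : Type} [Fintype V] [DecidableEq V] {F : Type} [DecidableEq F]

section Faces

variable {T : SimpleGraph V} {l r : Sym2 V → F}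

theorem Inc.face_cases {f : F} {e : Sym2 V} (h : Inc T l r f e) : f = l e ∨ f = r e :=
  h.2.imp Eq.symm Eq.symm

theorem Inc.adj {f : F} {a b : V} (h : Inc T l r f s(a, b)) : T.Adj a b := h.1

theorem inc_left {e : Sym2 V} (he : e ∈ T.edgeSet) : Inc T l r (l e) e := ⟨he, Or.inl rfl⟩

theorem inc_right {e : Sym2 V} (he : e ∈ T.edgeSet) : Inc T l r (r e) e := ⟨he, Or.inr rfl⟩

theorem TriSphere.exists_third (h : TriSphere T l r) {f : F} {v y : V}
    (hf : Inc T l r f s(v, y)) : ∃ z, z ≠ y ∧ z ≠ v ∧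
      ∀ e, Inc T l r f e ↔ e = s(v, y) ∨ e = s(v, z) ∨ e = s(y, z) := by
  obtain ⟨a, b, c, hab, hbc, hac, ht⟩ := h.tri f
  have h1 := (ht _).1 hf
  simp only [Sym2.eq_iff] at h1
  rcases h1 with (⟨rfl, rfl⟩ | ⟨rfl, rfl⟩) | (⟨rfl, rfl⟩ | ⟨rfl, rfl⟩) | (⟨rfl, rfl⟩ | ⟨rfl, rfl⟩)
  · exact ⟨c, hbc.ne', hac.ne', fun e => by rw [ht]; tauto⟩
  · exact ⟨c, hac.ne', hbc.ne', fun e => by rw [ht, Sym2.eq_swap (a := v) (b := y)]⟩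
  · refine ⟨a, hac.ne, hab.ne, fun e => ?_⟩
    rw [ht, Sym2.eq_swap (a := v) (b := a), Sym2.eq_swap (a := y) (b := a)]; tauto
  · refine ⟨a, hab.ne, hac.ne, fun e => ?_⟩
    rw [ht, Sym2.eq_swap (a := v) (b := a), Sym2.eq_swap (a := y) (b := a),
      Sym2.eq_swap (a := v) (b := y)]; tauto
  · refine ⟨b, hbc.ne, hab.ne', fun e => ?_⟩
    rw [ht, Sym2.eq_swap (a := y) (b := b)]; tauto
  · refine ⟨b, hab.ne', hbc.ne, fun e => ?_⟩
    rw [ht, Sym2.eq_swap (a := v) (b := b), Sym2.eq_swap (a := v) (b := y)]; tauto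

theorem TriSphere.inc_iff (h : TriSphere T l r) {f : F} {v y z : V} (hy : Inc T l r f s(v, y))
    (hz : Inc T l r f s(v, z)) (hyz : y ≠ z) (e : Sym2 V) :
    Inc T l r f e ↔ e = s(v, y) ∨ e = s(v, z) ∨ e = s(y, z) := by
  obtain ⟨w, hwy, hwv, hw⟩ := h.exists_third hy
  have h1 := (hw _).1 hz
  have hvy : v ≠ y := hy.adj.ne
  have hvz : v ≠ z := hz.adj.ne
  have : z = w := by
    simp only [Sym2.eq_iff] at h1
    rcases h1 with (⟨_, h2⟩ | ⟨h2, h3⟩) | (⟨_, h2⟩ | ⟨h2, h3⟩) | (⟨h2, h3⟩ | ⟨h2, h3⟩)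
    · exact absurd h2.symm hyz
    · exact absurd h2 hvy
    · exact h2
    · exact absurd h2.symm hwv
    · exact absurd h2 hvy
    · exact absurd h3.symm hyz
  subst this
  exact hw e

theorem TriSphere.exists_adj (h : TriSphere T l r) {d : V} (hn : ∃ b, b ≠ d) :
    ∃ w, T.Adj d w := by
  obtain ⟨b, hb⟩ := hn
  by_contra hcon
  push Not at hcon
  by_cases h3 : ∃ c, c ≠ d ∧ c ≠ b
  · obtain ⟨c, hcd, hcb⟩ := h3
    obtain ⟨y, hy, -, hbd⟩ := h.avoid c b d hcb.symm hcd.symm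
    have h1 := congrFun hbd d
    have h2 : bd y d = 0 := Finset.sum_eq_zero fun w _ => hy _ (by simpa using hcon w)
    rw [h2] at h1
    simp [Pi.single_apply, hb.symm] at h1
  · push Not at h3
    obtain ⟨x, y, z, hxy, hyz, hxz, -⟩ := h.tri (l s(d, d))
    by_cases hx : x = d
    · subst hx; exact hcon y hxy
    by_cases hy : y = d
    · subst hy; exact hcon z hyz
    · exact hxy.ne ((h3 x hx).trans (h3 y hy).symm)

/-- Distinct faces have distinct vertex sets once there are four vertices. -/
theorem TriSphere.face_unique (h : TriSphere T l r) (hn : 4 ≤ Fintype.card V) {f g : F}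
    {v y z : V} (hfy : Inc T l r f s(v, y)) (hfz : Inc T l r f s(v, z))
    (hgy : Inc T l r g s(v, y)) (hgz : Inc T l r g s(v, z)) (hyz : y ≠ z) : f = g := by
  by_contra hfg
  have h0 : cobd T l r (Pi.single f 1 + Pi.single g 1) = 0 := by
    rw [cobd_add]
    have : cobd T l r (Pi.single f 1) = cobd T l r (Pi.single g 1) := by
      funext e
      have h1 := cobd_single_eq_one h.ne f e
      have h2 := cobd_single_eq_one h.ne g e
      rw [h.inc_iff hfy hfz hyz] at h1
      rw [h.inc_iff hgy hgz hyz, ← h1] at h2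
      by_cases h3 : cobd T l r (Pi.single f 1) e = 1
      · rw [h3, h2.2 h3]
      · have h4 : ¬ cobd T l r (Pi.single g 1) e = 1 := fun h5 => h3 (h2.1 h5)
        rw [← zne_zero, not_not] at h3 h4
        rw [h3, h4]
    rw [this, zadd_self']
  have hall : ∀ k, k = f ∨ k = g := by
    intro k
    by_contra hk
    push Not at hk
    have h1 := h.strong _ h0 k f
    simp [Pi.single_apply, hk.1, hk.2, hfg] at h1
  obtain ⟨d, hd⟩ : ∃ d, d ∉ ({v, y, z} : Finset V) := by
    by_contra hcon
    push Not at hcon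
    have h1 : Fintype.card V ≤ ({v, y, z} : Finset V).card :=
      Finset.card_le_card (fun x _ => hcon x)
    have := Finset.card_le_three (a := v) (b := y) (c := z)
    omega
  simp only [Finset.mem_insert, Finset.mem_singleton, not_or] at hd
  obtain ⟨w, hw⟩ := h.exists_adj ⟨v, Ne.symm hd.1⟩
  have h1 : Inc T l r (l s(d, w)) s(d, w) := inc_left hw
  have h2 : s(d, w) = s(v, y) ∨ s(d, w) = s(v, z) ∨ s(d, w) = s(y, z) := by
    rcases hall (l s(d, w)) with h3 | h3
    · rw [h3] at h1; exact (h.inc_iff hfy hfz hyz _).1 h1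
    · rw [h3] at h1; exact (h.inc_iff hgy hgz hyz _).1 h1
  simp only [Sym2.eq_iff] at h2
  tauto

theorem TriSphere.cobd_single (h : TriSphere T l r) {f : F} {v y z : V}
    (hf : ∀ e, Inc T l r f e ↔ e = s(v, y) ∨ e = s(v, z) ∨ e = s(y, z))
    (hvy : v ≠ y) (hvz : v ≠ z) (hyz : y ≠ z) : cobd T l r (Pi.single f 1)
      = Pi.single s(v, y) 1 + Pi.single s(v, z) 1 + Pi.single s(y, z) 1 := by
  funext e
  have h1 := cobd_single_eq_one h.ne f e
  rw [hf] at h1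
  have d1 : s(v, y) ≠ s(v, z) := by simp [Sym2.eq_iff]; tauto
  have d2 : s(v, y) ≠ s(y, z) := by simp [Sym2.eq_iff]; tauto
  have d3 : s(v, z) ≠ s(y, z) := by simp [Sym2.eq_iff]; tauto
  simp only [Pi.add_apply, Pi.single_apply]
  by_cases h2 : cobd T l r (Pi.single f 1) e = 1
  · rw [h2]
    rcases h1.1 h2 with rfl | rfl | rfl
    · simp [d1, d2]
    · simp [d1.symm, d3]
    · simp [d2.symm, d3.symm]
  · have h3 : ¬ (e = s(v, y) ∨ e = s(v, z) ∨ e = s(y, z)) := fun h4 => h2 (h1.2 h4)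
    push Not at h3
    rw [← zne_zero, not_not] at h2
    simp [h2, h3.1, h3.2.1, h3.2.2]

/-- Adjacent vertices of degree three occur only in the tetrahedron. -/
theorem TriSphere.not_adj_of_degree_three (h : TriSphere T l r) (hn : 5 ≤ Fintype.card V)
    {x y p q s t : V} (hx : ∀ z, T.Adj x z → z = y ∨ z = p ∨ z = q)
    (hy : ∀ z, T.Adj y z → z = x ∨ z = s ∨ z = t) : ¬ T.Adj x y := by
  intro hxy
  have hn4 : 4 ≤ Fintype.card V := by omega
  have hne := h.ne s(x, y) hxy
  obtain ⟨z, hzy, hzx, hf⟩ := h.exists_third (inc_left (l := l) (r := r) (show s(x, y) ∈ T.edgeSet from hxy))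
  obtain ⟨w, hwy, hwx, hg⟩ := h.exists_third (inc_right (l := l) (r := r) (show s(x, y) ∈ T.edgeSet from hxy))
  set f := l s(x, y)
  set g := r s(x, y)
  have hzw : z ≠ w := by
    rintro rfl
    exact hne (h.face_unique hn4 ((hf _).2 (Or.inl rfl)) ((hf _).2 (Or.inr (Or.inl rfl)))
      ((hg _).2 (Or.inl rfl)) ((hg _).2 (Or.inr (Or.inl rfl))) hzy.symm)
  have axz : T.Adj x z := ((hf s(x, z)).2 (by simp)).adj
  have axw : T.Adj x w := ((hg s(x, w)).2 (by simp)).adj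
  have ayz : T.Adj y z := ((hf s(y, z)).2 (by simp)).adj
  have ayw : T.Adj y w := ((hg s(y, w)).2 (by simp)).adj
  have hxn : ∀ u, T.Adj x u → u = y ∨ u = z ∨ u = w := by
    intro u hu
    rcases hx z axz with h1 | h1 | h1 <;> rcases hx w axw with h2 | h2 | h2 <;>
      rcases hx u hu with h3 | h3 | h3 <;> simp_all
  have hyn : ∀ u, T.Adj y u → u = x ∨ u = z ∨ u = w := by
    intro u hu
    rcases hy z ayz with h1 | h1 | h1 <;> rcases hy w ayw with h2 | h2 | h2 <;>
      rcases hy u hu with h3 | h3 | h3 <;> simp_all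
  have other : ∀ (u u' : V), T.Adj u z → u ≠ u' → u' ≠ z → u ≠ w → u' ≠ w →
      Inc T l r f s(u, z) → Inc T l r f s(u, u') →
      (∀ k, T.Adj u k → k = u' ∨ k = z ∨ k = w) →
      ∃ k, ∀ e, Inc T l r k e ↔ e = s(u, z) ∨ e = s(u, w) ∨ e = s(z, w) := by
    intro u u' huz huu hu'z huw hu'w hfz hfu hk
    obtain ⟨k, hkf, hkz⟩ : ∃ k, k ≠ f ∧ Inc T l r k s(u, z) := by
      have h1 := h.ne s(u, z) huz
      rcases hfz.face_cases with h2 | h2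
      · exact ⟨r s(u, z), by rw [h2]; exact h1.symm, inc_right huz⟩
      · exact ⟨l s(u, z), by rw [h2]; exact h1, inc_left huz⟩
    obtain ⟨c, hcz, hcu, hc⟩ := h.exists_third hkz
    have hku : Inc T l r k s(u, c) := (hc _).2 (by simp)
    rcases hk c hku.adj with h1 | h1 | h1
    · subst h1
      exact absurd (h.face_unique hn4 hkz hku hfz hfu hcz.symm) hkf
    · exact absurd h1 hcz
    · subst h1; exact ⟨k, hc⟩
  obtain ⟨k1, hk1⟩ := other x y axz hxy.ne hzy.symm hwx.symm hwy.symm ((hf _).2 (by simp))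
    ((hf _).2 (by simp)) hxn
  obtain ⟨k2, hk2⟩ := other y x ayz hxy.ne' hzx.symm hwy.symm hwx.symm ((hf _).2 (by simp))
    ((hf _).2 (by simp [Sym2.eq_swap])) hyn
  have h0 : cobd T l r (Pi.single f 1 + Pi.single g 1 + Pi.single k1 1 + Pi.single k2 1) = 0 := by
    rw [cobd_add, cobd_add, cobd_add, h.cobd_single hf hxy.ne hzx.symm hzy.symm,
      h.cobd_single hg hxy.ne hwx.symm hwy.symm, h.cobd_single hk1 hzx.symm hwx.symm hzw,
      h.cobd_single hk2 hzy.symm hwy.symm hzw]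
    have e1 := zadd_self' (Pi.single s(x, y) 1 : Sym2 V → ZMod 2)
    have e2 := zadd_self' (Pi.single s(x, z) 1 : Sym2 V → ZMod 2)
    have e3 := zadd_self' (Pi.single s(x, w) 1 : Sym2 V → ZMod 2)
    have e4 := zadd_self' (Pi.single s(y, z) 1 : Sym2 V → ZMod 2)
    have e5 := zadd_self' (Pi.single s(y, w) 1 : Sym2 V → ZMod 2)
    have e6 := zadd_self' (Pi.single s(z, w) 1 : Sym2 V → ZMod 2)
    linear_combination (exp := 1) e1 + e2 + e3 + e4 + e5 + e6
  obtain ⟨d, hd⟩ : ∃ d, d ∉ ({x, y, z, w} : Finset V) := by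
    by_contra hcon
    push Not at hcon
    have h1 : Fintype.card V ≤ ({x, y, z, w} : Finset V).card :=
      Finset.card_le_card (fun x _ => hcon x)
    have := Finset.card_le_four (a := x) (b := y) (c := z) (d := w)
    omega
  simp only [Finset.mem_insert, Finset.mem_singleton, not_or] at hd
  obtain ⟨u, hu⟩ := h.exists_adj ⟨x, Ne.symm hd.1⟩
  have hi : Inc T l r (l s(d, u)) s(d, u) := inc_left hu
  have n1 : l s(d, u) ≠ f := fun h3 => by
    rw [h3, hf] at hi; simp only [Sym2.eq_iff] at hi; tauto
  have n2 : l s(d, u) ≠ g := fun h3 => by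
    rw [h3, hg] at hi; simp only [Sym2.eq_iff] at hi; tauto
  have n3 : l s(d, u) ≠ k1 := fun h3 => by
    rw [h3, hk1] at hi; simp only [Sym2.eq_iff] at hi; tauto
  have n4 : l s(d, u) ≠ k2 := fun h3 => by
    rw [h3, hk2] at hi; simp only [Sym2.eq_iff] at hi; tauto
  have hfg : f ≠ g := hne
  have m1 : f ≠ k1 := fun h3 => by
    have := (hf s(x, y)).2 (by simp)
    rw [h3, hk1] at this; simp only [Sym2.eq_iff] at this
    have := hxy.ne; tauto
  have m2 : f ≠ k2 := fun h3 => by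
    have := (hf s(x, y)).2 (by simp)
    rw [h3, hk2] at this; simp only [Sym2.eq_iff] at this
    have := hxy.ne; tauto
  have h1 := h.strong _ h0 (l s(d, u)) f
  simp [Pi.single_apply, n1, n2, n3, n4, hfg, m1, m2] at h1

end Faces

section Paths

/-- The edges of a path given by its list of vertices. -/
def pedges : List V → List (Sym2 V)
  | [] => []
  | [_] => []
  | x :: y :: t => s(x, y) :: pedges (y :: t)

theorem pedges_append (A B : List V) (x : V) :
    pedges (A ++ x :: B) = pedges (A ++ [x]) ++ pedges (x :: B) := by
  induction A with
  | nil => simp [pedges]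
  | cons a A ih =>
    cases A with
    | nil => simp [pedges]
    | cons b A => simpa [pedges] using ih

theorem mem_of_mem_pedges {P : List V} {e : Sym2 V} (he : e ∈ pedges P) {x : V} (hx : x ∈ e) :
    x ∈ P := by
  induction P with
  | nil => simp [pedges] at he
  | cons a P ih =>
    cases P with
    | nil => simp [pedges] at he
    | cons b P =>
      simp only [pedges, List.mem_cons] at he
      rcases he with rfl | he
      · rw [Sym2.mem_iff] at hx; rcases hx with rfl | rfl <;> simp
      · exact List.mem_cons_of_mem _ (ih he)

theorem exists_of_mem_pedges {P : List V} {e : Sym2 V} (he : e ∈ pedges P) :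
    ∃ A x y B, P = A ++ x :: y :: B ∧ e = s(x, y) := by
  induction P with
  | nil => simp [pedges] at he
  | cons a P ih =>
    cases P with
    | nil => simp [pedges] at he
    | cons b P =>
      simp only [pedges, List.mem_cons] at he
      rcases he with rfl | he
      · exact ⟨[], a, b, P, rfl, rfl⟩
      · obtain ⟨A, x, y, B, h1, h2⟩ := ih he
        exact ⟨a :: A, x, y, B, by rw [h1]; rfl, h2⟩

theorem mem_pedges_mid (A B : List V) (x y : V) : s(x, y) ∈ pedges (A ++ x :: y :: B) := by
  rw [pedges_append]; simp [pedges]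

/-- The edges of a simple path at an interior vertex. -/
theorem mem_pedges_interior {A C : List V} {a v b : V} (hnd : (A ++ a :: v :: b :: C).Nodup)
    {e : Sym2 V} (hv : v ∈ e) :
    e ∈ pedges (A ++ a :: v :: b :: C) ↔ e = s(a, v) ∨ e = s(v, b) := by
  have h1 : A ++ a :: v :: b :: C = (A ++ [a]) ++ v :: b :: C := by simp
  have hA : v ∉ A ++ [a] := by
    rw [h1, List.nodup_append] at hnd
    intro h; exact hnd.2.2 v h v (by simp) rfl
  have hC : v ∉ b :: C := by
    rw [h1, List.nodup_append] at hnd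
    exact (List.nodup_cons.1 hnd.2.1).1
  rw [pedges_append]
  simp only [List.mem_append, pedges, List.mem_cons]
  constructor
  · rintro (h | h | h | h)
    · exact absurd (mem_of_mem_pedges h hv) hA
    · exact Or.inl h
    · exact Or.inr h
    · exact absurd (mem_of_mem_pedges h hv) hC
  · tauto

/-- The chain of the edges of a path. -/
def lchain : List V → Sym2 V → ZMod 2
  | [] => 0
  | [_] => 0
  | x :: y :: t => Pi.single s(x, y) 1 + lchain (y :: t)

theorem lchain_notMem {P : List V} {e : Sym2 V} (he : e ∉ pedges P) : lchain P e = 0 := by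
  induction P with
  | nil => rfl
  | cons a P ih =>
    cases P with
    | nil => rfl
    | cons b P =>
      simp only [pedges, List.mem_cons, not_or] at he
      rw [lchain, Pi.add_apply, Pi.single_apply, if_neg he.1, ih he.2, add_zero]

theorem lchain_mem {P : List V} (hP : P.Nodup) {e : Sym2 V} (he : e ∈ pedges P) :
    lchain P e = 1 := by
  induction P with
  | nil => simp [pedges] at he
  | cons a P ih =>
    cases P with
    | nil => simp [pedges] at he
    | cons b P =>
      simp only [pedges, List.mem_cons] at he
      have hn : s(a, b) ∉ pedges (b :: P) := fun h =>
        (List.nodup_cons.1 hP).1 (mem_of_mem_pedges h (by simp))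
      rcases he with rfl | he
      · rw [lchain, Pi.add_apply, lchain_notMem hn]; simp
      · rw [lchain, Pi.add_apply, ih (List.nodup_cons.1 hP).2 he, Pi.single_apply, if_neg, zero_add]
        rintro rfl
        exact hn he

theorem bd_lchain (L : List V) (u w : V) (hL : ∀ e ∈ pedges (u :: L ++ [w]), ¬ e.IsDiag) :
    bd (lchain (u :: L ++ [w])) = Pi.single u 1 + Pi.single w 1 := by
  induction L generalizing u with
  | nil =>
    simp only [List.cons_append, List.nil_append, lchain, add_zero]
    have := hL s(u, w) (by simp [pedges])
    rw [bd_single (by simpa using this)]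
  | cons x L ih =>
    have h1 := hL s(u, x) (by simp [pedges])
    have h2 := ih x (fun e he => hL e (by simp only [List.cons_append, pedges, List.mem_cons] at he ⊢; exact Or.inr he))
    simp only [List.cons_append] at h2 ⊢
    rw [lchain, bd_add, h2, bd_single (by simpa using h1)]
    have h3 := zadd_self' (Pi.single x 1 : V → ZMod 2)
    linear_combination (exp := 1) h3

end Paths

end ArcDual

namespace ArcDual

variable {V : Type} [Fintype V] [DecidableEq V] {F : Type} [DecidableEq F]

theorem exists_interior {a b w : V} {B : List V} (hw : w ∈ B) :
    ∃ A y z C, a :: B ++ [b] = A ++ y :: w :: z :: C := by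
  obtain ⟨B1, B2, rfl⟩ := List.append_of_mem hw
  have h1 : ∃ A y, a :: B1 = A ++ [y] := by
    rcases List.eq_nil_or_concat (a :: B1) with h | ⟨L, x, h⟩
    · simp at h
    · exact ⟨L, x, by simpa using h⟩
  obtain ⟨A, y, hA⟩ := h1
  obtain ⟨z, C, hC⟩ : ∃ z C, B2 ++ [b] = z :: C := by
    cases B2 with
    | nil => exact ⟨b, [], rfl⟩
    | cons z t => exact ⟨z, t ++ [b], rfl⟩
  refine ⟨A, y, z, C, ?_⟩
  calc a :: (B1 ++ w :: B2) ++ [b] = (a :: B1) ++ w :: (B2 ++ [b]) := by simp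
    _ = _ := by rw [hA, hC]; simp

theorem zmod_eq_of_iff {x y : ZMod 2} (h : x = 1 ↔ y = 1) : x = y := by
  revert h; revert x y; decide

theorem zmod_ne_one {x : ZMod 2} : x ≠ 1 ↔ x = 0 := by revert x; decide

/-- The faces of `D` around `v` form a fan over a path from `a` to `b`. -/
theorem TriSphere.exists_link {T : SimpleGraph V} {l r : Sym2 V → F} (h : TriSphere T l r)
    {D : F → ZMod 2} {v a b : V} (hab : a ≠ b) (ha : T.Adj v a) (hb : T.Adj v b)
    (hD : ∀ w, cobd T l r D s(v, w) = 1 ↔ w = a ∨ w = b) :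
    ∃ B : List V, (a :: B ++ [b]).Nodup ∧
      (∀ e ∈ pedges (a :: B ++ [b]), ∃ y z f, e = s(y, z) ∧ y ≠ z ∧ D f = 1 ∧
        Inc T l r f s(v, y) ∧ Inc T l r f s(v, z)) ∧
      (∀ f w, Inc T l r f s(v, w) → D f = 1 → ∃ y z, s(y, z) ∈ pedges (a :: B ++ [b]) ∧ y ≠ z ∧
        Inc T l r f s(v, y) ∧ Inc T l r f s(v, z)) := by
  classical
  let H : SimpleGraph V :=
    { Adj := fun y z => y ≠ z ∧ ∃ f, D f = 1 ∧ Inc T l r f s(v, y) ∧ Inc T l r f s(v, z)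
      symm := ⟨fun y z ⟨h1, f, h2, h3, h4⟩ => ⟨h1.symm, f, h2, h4, h3⟩⟩
      loopless := ⟨fun y h1 => h1.1 rfl⟩ }
  have hedge : ∀ {y : V}, T.Adj v y → s(v, y) ∈ T.edgeSet := fun hy => hy
  -- the end of the link path is reachable, by parity
  have hreach : H.Reachable a b := by
    by_contra hnr
    let S : F → ZMod 2 := fun f =>
      if D f = 1 ∧ ∃ y, H.Reachable a y ∧ Inc T l r f s(v, y) then 1 else 0
    have hval : ∀ w, T.Adj v w → ∀ f, Inc T l r f s(v, w) →
        S f = if H.Reachable a w then D f else 0 := by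
      intro w hw f hf
      by_cases hr : H.Reachable a w
      · rw [if_pos hr]
        by_cases hd : D f = 1
        · have : D f = 1 ∧ ∃ y, H.Reachable a y ∧ Inc T l r f s(v, y) := ⟨hd, w, hr, hf⟩
          simp only [S]; rw [if_pos this, hd]
        · have : ¬ (D f = 1 ∧ ∃ y, H.Reachable a y ∧ Inc T l r f s(v, y)) := fun h2 => hd h2.1
          simp only [S]; rw [if_neg this, zmod_ne_one.1 hd]
      · rw [if_neg hr]
        simp only [S]
        rw [if_neg]
        rintro ⟨hd, y, hy, hfy⟩
        by_cases hyw : y = w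
        · exact hr (hyw ▸ hy)
        · exact hr (hy.trans (SimpleGraph.Adj.reachable (G := H) ⟨hyw, f, hd, hfy, hf⟩))
    have hsum : bd (cobd T l r S) v = 1 := by
      unfold bd
      rw [Finset.sum_eq_single a]
      · rw [cobd_of_mem (hedge ha), hval a ha _ (inc_left ha), hval a ha _ (inc_right ha),
          if_pos SimpleGraph.Reachable.rfl, if_pos SimpleGraph.Reachable.rfl,
          ← cobd_of_mem (hedge ha)]
        exact (hD a).2 (Or.inl rfl)
      · intro w _ hwa
        by_cases hw : T.Adj v w
        · rw [cobd_of_mem (hedge hw), hval w hw _ (inc_left hw), hval w hw _ (inc_right hw)]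
          by_cases hr : H.Reachable a w
          · rw [if_pos hr, if_pos hr, ← cobd_of_mem (hedge hw)]
            apply zmod_ne_one.1
            rw [Ne, hD]
            rintro (h1 | h1)
            · exact hwa h1
            · exact hnr (h1 ▸ hr)
          · rw [if_neg hr, if_neg hr, add_zero]
        · exact cobd_of_notMem (by simpa using hw)
      · simp
    rw [h.dual.bd_cobd] at hsum
    exact zero_ne_one hsum
  obtain ⟨p, hp⟩ := hreach.exists_isPath
  obtain ⟨B, hB⟩ : ∃ B, p.support = a :: B ++ [b] := by
    have h1 := SimpleGraph.Walk.cons_tail_support p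
    have h2 := SimpleGraph.Walk.dropLast_support_concat p
    rw [← h1] at h2
    cases h3 : p.support.tail with
    | nil => rw [h3] at h2; simp at h2; exact absurd h2.symm hab
    | cons c t =>
      rw [h3, List.dropLast_cons_of_ne_nil (by simp)] at h2
      exact ⟨_, by rw [← h1, h3, h2]⟩
  have hch : List.IsChain H.Adj (a :: B ++ [b]) := by
    rw [← hB]; exact SimpleGraph.Walk.isChain_adj_support p
  have hnd : (a :: B ++ [b]).Nodup := by rw [← hB]; exact hp.support_nodup
  have hadj : ∀ {A C : List V} {y z : V}, a :: B ++ [b] = A ++ y :: z :: C → H.Adj y z := by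
    intro A C y z h1
    rw [h1] at hch
    have h2 := hch.right_of_append
    simp only [List.isChain_cons_cons] at h2
    exact h2.1
  refine ⟨B, hnd, ?_, ?_⟩
  · intro e he
    obtain ⟨A, y, z, C, h1, h2⟩ := exists_of_mem_pedges he
    obtain ⟨h3, f, h4, h5, h6⟩ := hadj h1
    exact ⟨y, z, f, h2, h3, h4, h5, h6⟩
  -- the remaining faces form a function constant around `v`
  let Pf : F → Prop := fun f => ∃ y z, s(y, z) ∈ pedges (a :: B ++ [b]) ∧ y ≠ z ∧
    Inc T l r f s(v, y) ∧ Inc T l r f s(v, z)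
  let R : F → ZMod 2 := fun f => if D f = 1 ∧ ¬ Pf f then 1 else 0
  have hlr : ∀ {w : V} {f g k : F}, Inc T l r f s(v, w) → Inc T l r g s(v, w) → f ≠ g →
      Inc T l r k s(v, w) → k = f ∨ k = g := by
    intro w f g k hf hg hfg hk
    rcases hf.face_cases with h1 | h1 <;> rcases hg.face_cases with h2 | h2 <;>
      rcases hk.face_cases with h3 | h3 <;> simp_all
  have hend : ∀ w, (w = a ∨ w = b) → (∃ f, D f = 1 ∧ Pf f ∧ Inc T l r f s(v, w)) →
      ∀ k, Inc T l r k s(v, w) → R k = 0 := by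
    rintro w hw ⟨f, hf, hpf, hi⟩ k hk
    simp only [R]
    rw [if_neg]
    rintro ⟨h1, h2⟩
    have h3 : f ≠ k := fun h4 => h2 (h4 ▸ hpf)
    have h4 := (hD w).2 hw
    rw [cobd_of_mem (hedge hi.adj)] at h4
    rcases hi.face_cases with h5 | h5 <;> rcases hk.face_cases with h6 | h6
    · exact h3 (h5.trans h6.symm)
    · rw [← h5, ← h6, hf, h1, zadd_self] at h4; exact zero_ne_one h4
    · rw [← h5, ← h6, hf, h1, zadd_self] at h4; exact zero_ne_one h4
    · exact h3 (h5.trans h6.symm)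
  have hmid : ∀ {A C : List V} {y z : V}, a :: B ++ [b] = A ++ y :: z :: C →
      ∃ f, D f = 1 ∧ Pf f ∧ Inc T l r f s(v, y) ∧ Inc T l r f s(v, z) := by
    intro A C y z h1
    obtain ⟨h3, f, h4, h5, h6⟩ := hadj h1
    exact ⟨f, h4, ⟨y, z, by rw [h1]; exact mem_pedges_mid _ _ _ _, h3, h5, h6⟩, h5, h6⟩
  have hRzero : ∀ w ∈ a :: B ++ [b], ∀ k, Inc T l r k s(v, w) → R k = 0 := by
    intro w hw k hk
    have hcs : w = a ∨ w ∈ B ∨ w = b := by simpa [or_assoc] using hw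
    rcases hcs with rfl | hwB | rfl
    · refine hend w (Or.inl rfl) ?_ k hk
      obtain ⟨z, C, hC⟩ : ∃ z C, B ++ [b] = z :: C := by
        cases B with
        | nil => exact ⟨b, [], rfl⟩
        | cons z t => exact ⟨z, t ++ [b], rfl⟩
      obtain ⟨f, h1, h2, h3, -⟩ := hmid (A := []) (y := w) (z := z) (C := C) (by simp [← hC])
      exact ⟨f, h1, h2, h3⟩
    · obtain ⟨A, y, z, C, hA⟩ := exists_interior (a := a) (b := b) hwB
      obtain ⟨f, h1, h2, h3, h4⟩ := hmid hA
      obtain ⟨g, g1, g2, g3, g4⟩ := hmid (A := A ++ [y]) (y := w) (z := z) (C := C) (by simp [hA])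
      have hnd' := hnd
      rw [hA, List.nodup_append] at hnd'
      have hyz : y ≠ z := by rintro rfl; simp at hnd'
      have hyw : y ≠ w := by rintro rfl; simp at hnd'
      have hwz : w ≠ z := by rintro rfl; simp at hnd'
      have hfg : f ≠ g := by
        rintro rfl
        have h5 := (h.inc_iff h3 h4 hyw _).1 g4
        have := h4.adj.ne
        have := h3.adj.ne
        have := g4.adj.ne
        simp only [Sym2.eq_iff] at h5
        rcases h5 with (⟨_, h6⟩ | ⟨h6, _⟩) | (⟨_, h6⟩ | ⟨h6, _⟩) | (⟨h6, _⟩ | ⟨h6, _⟩)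
        · exact hyz h6.symm
        · contradiction
        · exact hwz h6.symm
        · contradiction
        · contradiction
        · contradiction
      simp only [R]
      rw [if_neg]
      rintro ⟨_, h6⟩
      rcases hlr h4 g3 hfg hk with rfl | rfl
      · exact h6 h2
      · exact h6 g2
    · refine hend w (Or.inr rfl) ?_ k hk
      obtain ⟨A, y, hA⟩ : ∃ A y, a :: B = A ++ [y] := by
        rcases List.eq_nil_or_concat (a :: B) with h | ⟨L, x, h⟩
        · simp at h
        · exact ⟨L, x, by simpa using h⟩
      obtain ⟨f, h1, h2, -, h3⟩ := hmid (A := A) (y := y) (z := w) (C := []) (by rw [hA]; simp)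
      exact ⟨f, h1, h2, h3⟩
  have hconst : ∀ w, T.Adj v w → R (l s(v, w)) = R (r s(v, w)) := by
    intro w hw
    by_cases hwQ : w ∈ a :: B ++ [b]
    · rw [hRzero w hwQ _ (inc_left hw), hRzero w hwQ _ (inc_right hw)]
    · have hnp : ∀ k, Inc T l r k s(v, w) → ¬ Pf k := by
        rintro k hk ⟨y, z, h1, h2, h3, h4⟩
        have hy := mem_of_mem_pedges h1 (x := y) (by simp)
        have hz := mem_of_mem_pedges h1 (x := z) (by simp)
        have h5 := (h.inc_iff h3 h4 h2 _).1 hk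
        have := hw.ne
        have := h3.adj.ne
        have := h4.adj.ne
        simp only [Sym2.eq_iff] at h5
        rcases h5 with (⟨_, rfl⟩ | ⟨h6, _⟩) | (⟨_, rfl⟩ | ⟨h6, _⟩) | (⟨h6, _⟩ | ⟨h6, _⟩) <;>
          contradiction
      have hRD : ∀ k, Inc T l r k s(v, w) → R k = D k := by
        intro k hk
        simp only [R]
        by_cases h1 : D k = 1
        · rw [if_pos ⟨h1, hnp k hk⟩, h1]
        · rw [if_neg (fun h2 => h1 h2.1), zmod_ne_one.1 h1]
      rw [hRD _ (inc_left hw), hRD _ (inc_right hw), ← zadd_eq_zero, ← cobd_of_mem (hedge hw)]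
      apply zmod_ne_one.1
      rw [Ne, hD]
      rintro (rfl | rfl) <;> simp at hwQ
  intro f w hf hDf
  have h1 := h.const_around hconst ha hf.adj
  rw [hRzero a (by simp) _ (inc_left ha)] at h1
  have h2 : R f = 0 := by
    rcases hf.face_cases with h3 | h3
    · rw [h3, ← h1]
    · rw [h3, ← hconst w hf.adj, ← h1]
  by_contra hcon
  have h3 : D f = 1 ∧ ¬ Pf f := ⟨hDf, hcon⟩
  simp only [R] at h2
  rw [if_pos h3] at h2
  exact one_ne_zero h2

end ArcDual

namespace ArcDual

variable {V : Type} [Fintype V] [DecidableEq V] {F : Type} [DecidableEq F]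
variable {T : SimpleGraph V} {l r : Sym2 V → F}

/-- A disc of faces `D` whose boundary cycle is the path `P` closed up by the edge `v1 v2`, and
whose vertex set is `W`. -/
structure Disc (T : SimpleGraph V) (l r : Sym2 V → F) (v1 v2 : V) (D : F → ZMod 2)
    (W : Finset V) (P : List V) : Prop where
  nodup : P.Nodup
  head : P.head? = some v1
  last : P.getLast? = some v2
  len : 3 ≤ P.length
  sub : ∀ u ∈ P, u ∈ W
  bdry : ∀ e, cobd T l r D e = 1 ↔ e ∈ pedges P ∨ e = s(v1, v2)
  inner : ∀ y f w, y ∈ W → y ∉ P → Inc T l r f s(y, w) → D f = 1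
  outer : ∀ y f w, y ∉ W → Inc T l r f s(y, w) → D f = 0
  cover : ∀ y z, y ∈ W → z ∈ W → T.Adj y z → s(y, z) ≠ s(v1, v2) →
    ∃ f, Inc T l r f s(y, z) ∧ D f = 1
  conn : ∀ S : F → ZMod 2, (∀ y, y ∉ W → ∀ w, T.Adj y w → S (l s(y, w)) = S (r s(y, w))) →
    ∀ f g, D f = 0 → D g = 0 → S f = S g

theorem cobd_eq_one_mem {D : F → ZMod 2} {e : Sym2 V} (h : cobd T l r D e = 1) :
    e ∈ T.edgeSet := by
  by_contra hc
  rw [cobd_of_notMem hc] at h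
  exact zero_ne_one h

theorem cobd_inc {D : F → ZMod 2} {f : F} {e : Sym2 V} (h : Inc T l r f e) :
    ∃ g, Inc T l r g e ∧ cobd T l r D e = D f + D g ∧ (l e ≠ r e → f ≠ g) := by
  rcases h.face_cases with rfl | rfl
  · exact ⟨r e, inc_right h.1, cobd_of_mem h.1, id⟩
  · exact ⟨l e, inc_left h.1, (cobd_of_mem h.1).trans (add_comm _ _), Ne.symm⟩

theorem Disc.adj {v1 v2 : V} {D : F → ZMod 2} {W : Finset V} {P : List V}
    (h : Disc T l r v1 v2 D W P) {y z : V} (he : s(y, z) ∈ pedges P) : T.Adj y z :=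
  cobd_eq_one_mem ((h.bdry _).2 (Or.inl he))

theorem Disc.adj_ends {v1 v2 : V} {D : F → ZMod 2} {W : Finset V} {P : List V}
    (h : Disc T l r v1 v2 D W P) : T.Adj v1 v2 :=
  cobd_eq_one_mem ((h.bdry _).2 (Or.inr rfl))

theorem Disc.exists_eq {v1 v2 : V} {D : F → ZMod 2} {W : Finset V} {P : List V}
    (h : Disc T l r v1 v2 D W P) : ∃ M, M ≠ [] ∧ P = v1 :: M ++ [v2] := by
  have h1 := h.head
  have h2 := h.last
  have h3 := h.len
  cases P with
  | nil => simp at h1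
  | cons a P =>
    simp at h1; subst h1
    rcases List.eq_nil_or_concat P with rfl | ⟨M, b, rfl⟩
    · simp at h3
    · rw [List.concat_eq_append] at *
      have : b = v2 := by
        have h4 : a :: (M ++ [b]) = (a :: M) ++ [b] := rfl
        rw [h4, List.getLast?_append] at h2
        simpa using h2
      subst this
      refine ⟨M, ?_, rfl⟩
      rintro rfl; simp at h3

theorem Disc.ne_ends {v1 v2 : V} {D : F → ZMod 2} {W : Finset V} {A C : List V} {a v b : V}
    (h : Disc T l r v1 v2 D W (A ++ a :: v :: b :: C)) : v ≠ v1 ∧ v ≠ v2 := by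
  have hnd := h.nodup
  have h1 := h.head
  have h2 := h.last
  constructor
  · rintro rfl
    cases A with
    | nil => simp at h1 hnd; subst h1; simp at hnd
    | cons c A => simp at h1 hnd; subst h1; simp at hnd
  · rintro rfl
    have h3 : v ∈ b :: C := by
      have : A ++ a :: v :: b :: C = (A ++ [a, v]) ++ b :: C := by simp
      rw [this, List.getLast?_append] at h2
      cases h4 : (b :: C).getLast? with
      | none => simp at h4
      | some z =>
        rw [h4] at h2; simp at h2; subst h2
        exact List.mem_of_getLast? h4
    rw [List.nodup_append] at hnd
    have := hnd.2.1
    simp at this h3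
    grind

theorem mem_pedges_of_mem {L : List V} {y : V} (hy : y ∈ L) (hl : 2 ≤ L.length) :
    ∃ z, s(y, z) ∈ pedges L := by
  induction L with
  | nil => simp at hy
  | cons a L ih =>
    cases L with
    | nil => simp at hl
    | cons b L =>
      rcases List.mem_cons.1 hy with rfl | hy
      · exact ⟨b, by simp [pedges]⟩
      · cases L with
        | nil =>
          have : y = b := by simpa using hy
          subst this
          exact ⟨a, by simp [pedges, Sym2.eq_swap]⟩
        | cons c L =>
          obtain ⟨z, hz⟩ := ih hy (by simp)
          exact ⟨z, by rw [pedges]; exact List.mem_cons_of_mem _ hz⟩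

theorem nodup_replace {A B C : List V} {a v b : V} (h : (A ++ a :: v :: b :: C).Nodup)
    (hB : (a :: B ++ [b]).Nodup) (hd : ∀ y ∈ B, y ∉ A ++ a :: v :: b :: C) :
    (A ++ a :: B ++ b :: C).Nodup := by
  have h1 : List.Sublist (A ++ a :: b :: C) (A ++ a :: v :: b :: C) :=
    (List.Sublist.refl A).append ((List.sublist_cons_self v _).cons_cons a)
  have h2 : (B ++ (A ++ a :: b :: C)).Nodup := by
    rw [List.nodup_append]
    refine ⟨?_, h.sublist h1, ?_⟩
    · exact hB.sublist ((List.sublist_append_left B [b]).trans (List.sublist_cons_self a _))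
    · rintro x hx y hy rfl
      exact hd x hx (h1.subset hy)
  refine (List.Perm.nodup_iff ?_).1 h2
  have e1 : B ++ (A ++ a :: b :: C) = B ++ ((A ++ [a]) ++ b :: C) := by simp
  have e2 : A ++ a :: B ++ b :: C = (A ++ [a]) ++ (B ++ b :: C) := by simp
  rw [e1, e2, ← List.append_assoc, ← List.append_assoc (A ++ [a])]
  exact List.perm_append_comm.append_right _

set_option maxHeartbeats 1000000 in
/-- Removing a chordless boundary vertex of a disc. -/
theorem Disc.peel (hT : TriSphere T l r) (hn : 4 ≤ Fintype.card V) {v1 v2 : V} {D : F → ZMod 2}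
    {W : Finset V} {A C : List V} {a v b : V} (h : Disc T l r v1 v2 D W (A ++ a :: v :: b :: C))
    (hW : 4 ≤ W.card) (hch : ∀ w ∈ A ++ a :: v :: b :: C, T.Adj v w → w = a ∨ w = b) :
    ∃ B D', Disc T l r v1 v2 D' (W.erase v) (A ++ a :: B ++ b :: C) ∧
      ∀ u ∈ W, T.Adj v u ↔ u = a ∨ u ∈ B ∨ u = b := by
  obtain ⟨hv1, hv2⟩ := h.ne_ends
  set P := A ++ a :: v :: b :: C with hP
  have hnd := h.nodup
  have hvP : v ∈ P := by simp [hP]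
  have hnd' := hnd
  rw [hP, List.nodup_append] at hnd'
  simp only [List.nodup_cons, List.mem_cons, not_or] at hnd'
  obtain ⟨hndA, ⟨⟨hav, hab, haC⟩, ⟨hvb, hvC⟩, hbC, hndC⟩, hdis⟩ := hnd'
  have hvA : v ∉ A := fun hx => hdis v hx v (by simp) rfl
  have haA : a ∉ A := fun hx => hdis a hx a (by simp) rfl
  have hbA : b ∉ A := fun hx => hdis b hx b (by simp) rfl
  have hD : ∀ w, cobd T l r D s(v, w) = 1 ↔ w = a ∨ w = b := by
    intro w
    rw [h.bdry, mem_pedges_interior hnd (by simp)]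
    simp only [Sym2.eq_iff]
    grind
  have hva : T.Adj v a := cobd_eq_one_mem ((hD a).2 (Or.inl rfl))
  have hvb' : T.Adj v b := cobd_eq_one_mem ((hD b).2 (Or.inr rfl))
  obtain ⟨B, hBnd, hB1, hB2⟩ := hT.exists_link hab hva hvb' hD
  set Q := a :: B ++ [b] with hQ
  -- faces of the disc at `v`
  have hface : ∀ f w e, Inc T l r f s(v, w) → D f = 1 → Inc T l r f e →
      v ∈ e ∨ e ∈ pedges Q := by
    intro f w e hw hf he
    obtain ⟨y, z, hm, hyz, hy, hz⟩ := hB2 f w hw hf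
    rcases (hT.inc_iff hy hz hyz e).1 he with rfl | rfl | rfl
    · simp
    · simp
    · exact Or.inr hm
  have hvQ : v ∉ Q := by
    intro hv
    obtain ⟨z, hz⟩ := mem_pedges_of_mem hv (by simp [hQ])
    obtain ⟨y', z', f, he, hne, -, h1, h2⟩ := hB1 _ hz
    rcases Sym2.eq_iff.1 he with ⟨rfl, rfl⟩ | ⟨rfl, rfl⟩
    · exact h1.adj.ne rfl
    · exact h2.adj.ne rfl
  have hQf : ∀ y ∈ Q, ∃ f, Inc T l r f s(v, y) ∧ D f = 1 := by
    intro y hy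
    obtain ⟨z, hz⟩ := mem_pedges_of_mem hy (by simp [hQ])
    obtain ⟨y', z', f, he, hne, hf, h1, h2⟩ := hB1 _ hz
    rcases Sym2.eq_iff.1 he with ⟨rfl, rfl⟩ | ⟨rfl, rfl⟩
    · exact ⟨f, h1, hf⟩
    · exact ⟨f, h2, hf⟩
  have hQadj : ∀ y ∈ Q, T.Adj v y := fun y hy => by
    obtain ⟨f, hf, -⟩ := hQf y hy; exact hf.adj
  have hQW : ∀ y ∈ Q, y ∈ W := by
    intro y hy
    obtain ⟨f, hf, h1⟩ := hQf y hy
    by_contra hyW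
    rw [Sym2.eq_swap] at hf
    rw [h.outer y f v hyW hf] at h1
    exact zero_ne_one h1
  have hWQ : ∀ y ∈ W, T.Adj v y → y ∈ Q := by
    intro y hy hvy
    obtain ⟨f, hf, h1⟩ := h.cover v y (h.sub v hvP) hy hvy (by
      simp only [ne_eq, Sym2.eq_iff]; grind)
    obtain ⟨y', z', hm, hyz, hy', hz'⟩ := hB2 f y hf h1
    have h3 := (hT.inc_iff hy' hz' hyz _).1 hf
    have h4 := mem_of_mem_pedges hm (x := y') (by simp)
    have h5 := mem_of_mem_pedges hm (x := z') (by simp)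
    simp only [Sym2.eq_iff] at h3
    grind
  have hQP : ∀ y ∈ Q, y ∈ P → y = a ∨ y = b := fun y hy hp => hch y hp (hQadj y hy)
  have hBP : ∀ y ∈ B, y ∉ P := by
    intro y hy hp
    have h1 := hQP y (by simp [hQ, hy]) hp
    simp [hQ, List.nodup_append] at hBnd
    grind
  have hsplit : pedges P = pedges (A ++ [a]) ++ (s(a, v) :: s(v, b) :: pedges (b :: C)) := by
    rw [hP, pedges_append]; simp [pedges]
  have hsplit' : pedges (A ++ a :: B ++ b :: C)
      = pedges (A ++ [a]) ++ (pedges Q ++ pedges (b :: C)) := by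
    rw [List.append_assoc, List.cons_append, pedges_append, hQ]
    congr 1
    exact pedges_append (a :: B) C b
  have habP : s(a, b) ∉ pedges P := by
    rw [hsplit]
    intro hm
    rcases List.mem_append.1 hm with hm | hm
    · have := mem_of_mem_pedges hm (x := b) (by simp)
      simp at this; grind
    · simp only [List.mem_cons, Sym2.eq_iff] at hm
      rcases hm with hm | hm | hm
      · grind
      · grind
      · have := mem_of_mem_pedges hm (x := a) (by simp)
        simp at this; grind
  -- the link path avoids the base edge
  have hbase : s(v1, v2) ∉ pedges Q := by
    intro hm
    obtain ⟨y, z, f, he, hyz, hf, hfy, hfz⟩ := hB1 _ hm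
    have hv1P : v1 ∈ P := List.mem_of_head? h.head
    have hv2P : v2 ∈ P := List.mem_of_getLast? h.last
    have e1 := hQP v1 (mem_of_mem_pedges hm (by simp)) hv1P
    have e2 := hQP v2 (mem_of_mem_pedges hm (by simp)) hv2P
    have h12 : v1 ≠ v2 := h.adj_ends.ne
    have hAnil : A = [] ∧ v1 = a := by
      have hh := h.head
      cases A with
      | nil => simp [hP] at hh; exact ⟨rfl, hh.symm⟩
      | cons c A =>
        exfalso
        simp [hP] at hh; subst hh
        rcases e1 with rfl | rfl
        · simp at haA
        · simp at hbA
    have hb2 : v2 = b := by grind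
    have hCnil : C = [] := by
      have hh := h.last
      by_contra hC
      have : P = (A ++ [a, v, b]) ++ C := by simp [hP]
      rw [this, List.getLast?_append] at hh
      cases h4 : C.getLast? with
      | none => exact hC (List.getLast?_eq_none_iff.1 h4)
      | some z' =>
        rw [h4] at hh; simp at hh; subst hh
        exact hbC (hb2 ▸ List.mem_of_getLast? h4)
    obtain ⟨rfl, rfl⟩ := hAnil
    subst hb2 hCnil
    have hfi := hT.inc_iff hfy hfz hyz
    have hD1 : D + Pi.single f 1 = 0 := by
      have h0 : cobd T l r (D + Pi.single f 1) = 0 := by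
        rw [cobd_add]
        funext e
        have : cobd T l r D e = cobd T l r (Pi.single f 1) e := by
          apply zmod_eq_of_iff
          rw [h.bdry, cobd_single_eq_one hT.ne, hfi, hsplit]
          have hyz' := Sym2.eq_iff.1 he
          rcases hyz' with ⟨rfl, rfl⟩ | ⟨rfl, rfl⟩
          · simp [pedges, Sym2.eq_swap (a := v)]; tauto
          · simp [pedges, Sym2.eq_swap (a := v)]
            rw [Sym2.eq_swap (a := v2) (b := v1)]; tauto
        simp [this, zadd_self]
      have h1 := hT.strong _ h0
      funext g
      rw [h1 g f]
      simp [hf, zadd_self]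
    obtain ⟨y', hy'W, hy'⟩ : ∃ y' ∈ W, y' ∉ P := by
      by_contra hcon
      push Not at hcon
      have : W ⊆ P.toFinset := fun u hu => List.mem_toFinset.2 (hcon u hu)
      have h1 := Finset.card_le_card this
      have h2 : P.toFinset.card ≤ 3 := (List.toFinset_card_le P).trans (by simp [hP])
      omega
    obtain ⟨w, hw⟩ := hT.exists_adj (d := y') ⟨v, fun hh => hy' (hh ▸ hvP)⟩
    have g1 := h.inner y' _ w hy'W hy' (inc_left (l := l) (r := r) (show s(y', w) ∈ T.edgeSet from hw))
    have g2 := h.inner y' _ w hy'W hy' (inc_right (l := l) (r := r) (show s(y', w) ∈ T.edgeSet from hw))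
    have hg : ∀ g, D g = 1 → g = f := by
      intro g hg
      by_contra hgf
      have := congrFun hD1 g
      simp [hg, hgf] at this
    exact hT.ne _ hw ((hg _ g1).trans (hg _ g2).symm)
  classical
  set D' : F → ZMod 2 := fun f => if ∃ w, Inc T l r f s(v, w) then 0 else D f with hD'
  have hD'v : ∀ f w, Inc T l r f s(v, w) → D' f = 0 := fun f w hw => if_pos ⟨w, hw⟩
  have hD'e : ∀ f, (¬ ∃ w, Inc T l r f s(v, w)) → D' f = D f := fun f hw => if_neg hw
  have hbd : ∀ e, cobd T l r D' e = 1 ↔ e ∈ pedges (A ++ a :: B ++ b :: C) ∨ e = s(v1, v2) := by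
    intro e
    by_cases hve : v ∈ e
    · obtain ⟨w, rfl⟩ := Sym2.mem_iff_exists.1 hve
      constructor
      · intro h1
        have hm := cobd_eq_one_mem h1
        rw [cobd_of_mem hm, hD'v _ w (inc_left hm), hD'v _ w (inc_right hm)] at h1
        simp at h1
      · rintro (h1 | h1)
        · have h2 := mem_of_mem_pedges h1 (x := v) (by simp)
          simp [hQ] at hvQ
          simp at h2
          grind
        · simp only [Sym2.eq_iff] at h1; grind
    · by_cases heQ : e ∈ pedges Q
      · have hR : e ∈ pedges (A ++ a :: B ++ b :: C) := by rw [hsplit']; simp [heQ]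
        simp only [hR, true_or, iff_true]
        obtain ⟨y, z, f, rfl, hyz, hf, hfy, hfz⟩ := hB1 _ heQ
        have hfe : Inc T l r f s(y, z) := (hT.inc_iff hfy hfz hyz _).2 (by simp)
        have hyQ := mem_of_mem_pedges heQ (x := y) (by simp)
        have hzQ := mem_of_mem_pedges heQ (x := z) (by simp)
        obtain ⟨g, hge, hcg, hfg⟩ := cobd_inc (D := D) hfe
        obtain ⟨g', hge', hcg', hfg'⟩ := cobd_inc (D := D') hfe
        have hgg : g' = g := by
          have := hfg (hT.ne _ hfe.1)
          have := hfg' (hT.ne _ hfe.1)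
          have := hge.face_cases
          have := hge'.face_cases
          have := hfe.face_cases
          grind
        subst hgg
        rw [hcg', hD'v f y hfy, zero_add]
        have hgv : ¬ ∃ w, Inc T l r g' s(v, w) := by
          rintro ⟨w, hw⟩
          obtain ⟨w', -, -, hi⟩ := hT.exists_third hw
          have h1 := (hi _).1 hge
          simp only [Sym2.mem_iff, not_or] at hve
          have h2 : s(y, z) = s(w, w') := by
            simp only [Sym2.eq_iff] at h1 ⊢; grind
          have h3 : Inc T l r g' s(v, y) ∧ Inc T l r g' s(v, z) := by
            have i1 := (hi s(v, w)).2 (by simp)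
            have i2 := (hi s(v, w')).2 (by simp)
            rcases Sym2.eq_iff.1 h2 with ⟨rfl, rfl⟩ | ⟨rfl, rfl⟩
            · exact ⟨i1, i2⟩
            · exact ⟨i2, i1⟩
          exact hfg (hT.ne _ hfe.1) (hT.face_unique hn hfy hfz h3.1 h3.2 hyz)
        rw [hD'e g' hgv]
        have h0 : cobd T l r D s(y, z) = 0 := by
          rw [← zmod_ne_one]
          intro h1
          rcases (h.bdry _).1 h1 with h1 | h1
          · have h2 := hQP y hyQ (mem_of_mem_pedges h1 (by simp))
            have h3 := hQP z hzQ (mem_of_mem_pedges h1 (by simp))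
            rcases h2 with rfl | rfl <;> rcases h3 with rfl | rfl
            · exact hyz rfl
            · exact habP h1
            · exact habP (Sym2.eq_swap ▸ h1)
            · exact hyz rfl
          · exact hbase (h1 ▸ heQ)
        rw [h0, hf] at hcg
        exact (zadd_eq_zero.1 hcg.symm).symm
      · have h1 : cobd T l r D' e = cobd T l r D e := by
          by_cases he : e ∈ T.edgeSet
          · have key : ∀ f, Inc T l r f e → D' f = D f := by
              intro f hf
              by_cases hw : ∃ w, Inc T l r f s(v, w)
              · obtain ⟨w, hw⟩ := hw
                rw [hD'v f w hw]
                by_contra hne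
                have := zne_zero.1 (Ne.symm hne)
                rcases hface f w e hw this hf with h2 | h2
                · exact hve h2
                · exact heQ h2
              · exact hD'e f hw
            rw [cobd_of_mem he, cobd_of_mem he, key _ (inc_left he), key _ (inc_right he)]
          · rw [cobd_of_notMem he, cobd_of_notMem he]
        rw [h1, h.bdry, hsplit, hsplit']
        have n1 : e ≠ s(a, v) := by rintro rfl; simp at hve
        have n2 : e ≠ s(v, b) := by rintro rfl; simp at hve
        simp [n1, n2, heQ]
  have hmemP : ∀ y ∈ P, y ≠ v → y ∈ A ++ a :: B ++ b :: C := by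
    intro y hy hyv
    simp [hP] at hy
    simp; tauto
  have hmemQ : ∀ y ∈ Q, y ∈ A ++ a :: B ++ b :: C := by
    intro y hy
    simp [hQ] at hy
    simp; tauto
  refine ⟨B, D', ⟨?_, ?_, ?_, ?_, ?_, hbd, ?_, ?_, ?_, ?_⟩, ?_⟩
  · exact nodup_replace hnd hBnd hBP
  · have := h.head
    cases A <;> simpa [hP] using this
  · have := h.last
    have e1 : P = (A ++ [a, v]) ++ b :: C := by simp [hP]
    have e2 : A ++ a :: B ++ b :: C = (A ++ a :: B) ++ b :: C := by simp
    rw [e1, List.getLast?_append] at this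
    rw [e2, List.getLast?_append]
    cases h4 : (b :: C).getLast? with
    | none => simp at h4
    | some z => rw [h4] at this; simpa using this
  · by_contra hlen
    simp at hlen
    have hAl : A = [] := List.length_eq_zero_iff.1 (by omega)
    have hBl : B = [] := List.length_eq_zero_iff.1 (by omega)
    have hCl : C = [] := List.length_eq_zero_iff.1 (by omega)
    have e1 := h.head
    have e2 := h.last
    subst hAl hCl
    simp [hP] at e1 e2
    subst e1 e2
    exact hbase (by simp [hQ, hBl, pedges])
  · intro u hu
    rw [Finset.mem_erase]
    simp at hu
    have hu' : u ∈ P ∨ u ∈ Q := by simp [hP, hQ]; tauto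
    refine ⟨?_, hu'.elim (h.sub u) (hQW u)⟩
    rintro rfl
    simp [hQ] at hvQ
    grind
  · intro y f w hy hyP hf
    rw [Finset.mem_erase] at hy
    have hyP' : y ∉ P := fun hp => hyP (hmemP y hp hy.1)
    have h1 := h.inner y f w hy.2 hyP' hf
    rw [hD'e, h1]
    rintro ⟨w', hw'⟩
    rcases hface f w' _ hw' h1 hf with h2 | h2
    · have h3 : v = w := by simpa [hy.1.symm] using h2
      subst h3
      exact hyP (hmemQ y (hWQ y hy.2 hf.adj.symm))
    · exact hyP (hmemQ y (mem_of_mem_pedges h2 (by simp)))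
  · intro y f w hy hf
    by_cases hyv : y = v
    · subst hyv; exact hD'v f w hf
    · have h1 := h.outer y f w (fun hw => hy (Finset.mem_erase.2 ⟨hyv, hw⟩)) hf
      simp only [hD', h1, ite_self]
  · intro y z hy hz hyz hne
    rw [Finset.mem_erase] at hy hz
    obtain ⟨f, hf, h1⟩ := h.cover y z hy.2 hz.2 hyz hne
    by_cases hw : ∃ w, Inc T l r f s(v, w)
    · obtain ⟨w, hw⟩ := hw
      have h2 : s(y, z) ∈ pedges Q := by
        rcases hface f w _ hw h1 hf with h2 | h2
        · simp [hy.1.symm, hz.1.symm] at h2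
        · exact h2
      have h3 := (hbd s(y, z)).2 (Or.inl (by rw [hsplit']; simp [h2]))
      rw [cobd_of_mem hf.1] at h3
      by_cases h4 : D' (l s(y, z)) = 1
      · exact ⟨_, inc_left hf.1, h4⟩
      · rw [zmod_ne_one.1 h4, zero_add] at h3
        exact ⟨_, inc_right hf.1, h3⟩
    · exact ⟨f, hf, by rw [hD'e f hw, h1]⟩
  · intro S hS
    have hSv : ∀ w, T.Adj v w → S (l s(v, w)) = S (r s(v, w)) := hS v (by simp)
    have h0 := h.conn S (fun y hy => hS y (fun hh => hy (Finset.mem_erase.1 hh).2))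
    have key : ∀ f, D' f = 0 → ∃ f0, D f0 = 0 ∧ S f = S f0 := by
      intro f hf
      by_cases hw : ∃ w, Inc T l r f s(v, w)
      · obtain ⟨w, hw⟩ := hw
        have h1 : S f = S (l s(v, w)) := by
          rcases hw.face_cases with h1 | h1
          · rw [h1]
          · rw [h1, hSv w hw.adj]
        have h2 := hT.const_around hSv hw.adj hva
        have h3 := (hD a).2 (Or.inl rfl)
        rw [cobd_of_mem hva] at h3
        by_cases h4 : D (l s(v, a)) = 0
        · exact ⟨_, h4, h1.trans h2⟩
        · refine ⟨r s(v, a), ?_, h1.trans (h2.trans (hSv a hva))⟩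
          rw [zne_zero.1 h4] at h3
          simpa using h3
      · exact ⟨f, by rw [← hD'e f hw, hf], rfl⟩
    intro f g hf hg
    obtain ⟨f0, hf0, e1⟩ := key f hf
    obtain ⟨g0, hg0, e2⟩ := key g hg
    rw [e1, e2, h0 f0 g0 hf0 hg0]
  · intro u hu
    constructor
    · intro hvu
      have := hWQ u hu hvu
      simp [hQ] at this; tauto
    · intro hh
      apply hQadj
      simp [hQ]; tauto

end ArcDual

namespace ArcDual

variable {V : Type} [Fintype V] [DecidableEq V] {F : Type} [DecidableEq F]
variable {T : SimpleGraph V} {l r : Sym2 V → F}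

theorem Disc.exists_zero {v1 v2 : V} {D : F → ZMod 2} {W : Finset V} {P : List V}
    (h : Disc T l r v1 v2 D W P) {e : Sym2 V} (he : e ∈ pedges P ∨ e = s(v1, v2)) :
    ∃ f g, Inc T l r f e ∧ D f = 0 ∧ ∀ S : F → ZMod 2, cobd T l r S e = S f + S g := by
  have h1 := (h.bdry e).2 he
  have hm := cobd_eq_one_mem h1
  rw [cobd_of_mem hm] at h1
  by_cases h2 : D (l e) = 0
  · exact ⟨l e, r e, inc_left hm, h2, fun S => cobd_of_mem hm⟩
  · refine ⟨r e, l e, inc_right hm, ?_, fun S => (cobd_of_mem hm).trans (add_comm _ _)⟩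
    rw [zne_zero.1 h2] at h1
    simpa using h1

/-- A chord of the boundary path bounds a set of faces inside the disc. -/
theorem Disc.exists_chord (hT : TriSphere T l r) {v1 v2 : V} {D : F → ZMod 2} {W : Finset V}
    {A L C : List V} {u w : V} (h : Disc T l r v1 v2 D W (A ++ (u :: L ++ [w]) ++ C))
    (huw : T.Adj u w) : ∃ S : F → ZMod 2, (∀ f, D f = 0 → S f = 0) ∧
      cobd T l r S = lchain (u :: L ++ [w]) + Pi.single s(u, w) 1 := by
  set P := A ++ (u :: L ++ [w]) ++ C with hP
  have hsubP : ∀ e ∈ pedges (u :: L ++ [w]), e ∈ pedges P := by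
    intro e he
    obtain ⟨X, x, y, Y, h1, rfl⟩ := exists_of_mem_pedges he
    rw [hP, h1]
    have : A ++ (X ++ x :: y :: Y) ++ C = (A ++ X) ++ x :: y :: (Y ++ C) := by simp
    rw [this]
    exact mem_pedges_mid _ _ _ _
  obtain ⟨f0, -, -, hf0, -⟩ := h.exists_zero (Or.inr rfl)
  have hsupp : SuppOn T (lchain (u :: L ++ [w]) + Pi.single s(u, w) 1) := by
    apply SuppOn.add
    · intro e he
      apply lchain_notMem
      intro hm
      exact he (cobd_eq_one_mem ((h.bdry e).2 (Or.inl (hsubP e hm))))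
    · exact suppOn_single huw
  have hbd : bd (lchain (u :: L ++ [w]) + Pi.single s(u, w) 1) = 0 := by
    rw [bd_add, bd_single huw.ne, bd_lchain, zadd_self']
    intro e he hd
    exact T.not_isDiag_of_mem_edgeSet
      (cobd_eq_one_mem ((h.bdry e).2 (Or.inl (hsubP e he)))) hd
  obtain ⟨S, hS0, hS⟩ := hT.dual.exists_normalized hsupp hbd f0
  refine ⟨S, fun f hf => ?_, hS.symm⟩
  rw [← hS0]
  refine h.conn S ?_ f f0 hf hf0
  intro y hy z hyz
  have h1 := congrFun hS s(y, z)
  rw [cobd_of_mem hyz] at h1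
  rw [← zadd_eq_zero, ← h1]
  have hyP : y ∉ P := fun hh => hy (h.sub y hh)
  have h2 : lchain (u :: L ++ [w]) s(y, z) = 0 := by
    apply lchain_notMem
    intro hm
    exact hyP (mem_of_mem_pedges (hsubP _ hm) (by simp))
  have h3 : s(y, z) ≠ s(u, w) := by
    intro hh
    have : y = u ∨ y = w := by
      rcases Sym2.eq_iff.1 hh with hh | hh
      · exact Or.inl hh.1
      · exact Or.inr hh.1
    apply hyP
    simp [hP]; tauto
  rw [Pi.add_apply, h2, Pi.single_eq_of_ne h3, add_zero]

set_option maxHeartbeats 1000000 in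
/-- Two chords of the boundary path of a disc do not cross. -/
theorem Disc.not_cross (hT : TriSphere T l r) {v1 v2 : V} {D : F → ZMod 2} {W : Finset V}
    {A L1 L2 L3 C : List V} {u x w y : V}
    (h : Disc T l r v1 v2 D W (A ++ u :: L1 ++ x :: L2 ++ w :: L3 ++ y :: C))
    (huw : T.Adj u w) (hxy : T.Adj x y) : False := by
  set P := A ++ u :: L1 ++ x :: L2 ++ w :: L3 ++ y :: C with hP
  have hnd := h.nodup
  have e1 : P = A ++ (u :: (L1 ++ x :: L2) ++ [w]) ++ (L3 ++ y :: C) := by simp [hP]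
  have e2 : P = (A ++ u :: L1) ++ (x :: (L2 ++ w :: L3) ++ [y]) ++ C := by simp [hP]
  obtain ⟨S1, hz1, hS1⟩ := Disc.exists_chord hT (e1 ▸ h) huw
  obtain ⟨S2, hz2, hS2⟩ := Disc.exists_chord hT (e2 ▸ h) hxy
  obtain ⟨t, R, ht⟩ : ∃ t R, L2 ++ [w] = t :: R := by
    cases L2 with
    | nil => exact ⟨w, [], rfl⟩
    | cons t L2 => exact ⟨t, L2 ++ [w], rfl⟩
  have c1 : u :: (L1 ++ x :: L2) ++ [w] = (u :: L1) ++ x :: t :: R := by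
    rw [← ht]; simp
  have c2 : x :: (L2 ++ w :: L3) ++ [y] = x :: t :: (R ++ L3 ++ [y]) := by
    have : L2 ++ w :: L3 ++ [y] = (L2 ++ [w]) ++ L3 ++ [y] := by simp
    rw [List.cons_append, this, ht]; simp
  have eP : P = A ++ u :: L1 ++ x :: t :: (R ++ L3 ++ y :: C) := by
    rw [e2, c2]; simp
  rw [c1] at hS1
  rw [c2] at hS2
  have hnd' := hnd
  rw [eP] at hnd'
  have hnd1 : (u :: L1 ++ x :: t :: R).Nodup := by
    refine hnd'.sublist ?_
    have : A ++ u :: L1 ++ x :: t :: (R ++ L3 ++ y :: C)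
        = A ++ ((u :: L1 ++ x :: t :: R) ++ (L3 ++ y :: C)) := by simp
    rw [this]
    exact (List.sublist_append_left _ _).trans (List.sublist_append_right _ _)
  have hnd2 : (x :: t :: (R ++ L3 ++ [y])).Nodup := by
    refine hnd'.sublist ?_
    have : A ++ u :: L1 ++ x :: t :: (R ++ L3 ++ y :: C)
        = (A ++ u :: L1) ++ ((x :: t :: (R ++ L3 ++ [y])) ++ C) := by simp
    rw [this]
    exact (List.sublist_append_left _ _).trans (List.sublist_append_right _ _)
  have hyn : y ∉ u :: L1 ++ x :: t :: R := by
    intro hy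
    have : A ++ u :: L1 ++ x :: t :: (R ++ L3 ++ y :: C)
        = (A ++ (u :: L1 ++ x :: t :: R)) ++ (L3 ++ y :: C) := by simp
    rw [this, List.nodup_append] at hnd'
    exact hnd'.2.2 y (List.mem_append_right _ hy) y (by simp) rfl
  have hwm : w ∈ t :: R := by rw [← ht]; simp
  have hxu : x ≠ u := by
    rintro rfl; simp at hnd1
  have hxw : x ≠ w := by
    rintro rfl; simp at hnd2 hwm; grind
  have hyu : y ≠ u := by rintro rfl; simp at hyn
  have hyw : y ≠ w := by
    rintro rfl
    exact hyn (by simp at hwm ⊢; tauto)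
  have hty : t ≠ y := by rintro rfl; simp at hyn
  have hxy' : x ≠ y := hxy.ne
  have p1 : ∀ e ∈ pedges (u :: L1 ++ x :: t :: R), e ∈ pedges P := by
    intro e he
    obtain ⟨X, x', y', Y, h1, rfl⟩ := exists_of_mem_pedges he
    have : P = (A ++ X) ++ x' :: y' :: (Y ++ (L3 ++ y :: C)) := by
      rw [e1, c1, h1]; simp
    rw [this]
    exact mem_pedges_mid _ _ _ _
  have p2 : ∀ e ∈ pedges (x :: t :: (R ++ L3 ++ [y])), e ∈ pedges P := by
    intro e he
    obtain ⟨X, x', y', Y, h1, rfl⟩ := exists_of_mem_pedges he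
    have : P = (A ++ u :: L1 ++ X) ++ x' :: y' :: (Y ++ C) := by
      rw [e2, c2, h1]; simp
    rw [this]
    exact mem_pedges_mid _ _ _ _
  have ha : ∀ e, e ∈ pedges P ∨ e = s(v1, v2) →
      cobd T l r (S1 * S2) e = cobd T l r S1 e * cobd T l r S2 e := by
    intro e he
    obtain ⟨f, g, -, hf, hc⟩ := h.exists_zero he
    simp only [hc, Pi.mul_apply, hz1 f hf, hz2 f hf]
    ring
  have hz : ∀ e, cobd T l r S1 e = 0 → cobd T l r S2 e = 0 → cobd T l r (S1 * S2) e = 0 := by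
    intro e h1 h2
    by_cases he : e ∈ T.edgeSet
    · rw [cobd_of_mem he, zadd_eq_zero] at h1 h2
      rw [cobd_of_mem he, zadd_eq_zero, Pi.mul_apply, Pi.mul_apply, h1, h2]
    · rw [cobd_of_notMem he]
  have hy1 : ∀ z, cobd T l r S1 s(y, z) = 0 := by
    intro z
    rw [hS1, Pi.add_apply, lchain_notMem, Pi.single_eq_of_ne, add_zero]
    · intro hh
      rcases Sym2.eq_iff.1 hh with hh | hh
      · exact hyu hh.1
      · exact hyw hh.1
    · intro hm
      exact hyn (mem_of_mem_pedges hm (by simp))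
  have hQy : cobd T l r (S1 * S2) s(x, y) = 0 := by
    have h0 := congrFun (hT.dual.bd_cobd (S1 * S2)) y
    rw [bd, Finset.sum_eq_single x] at h0
    · rw [Sym2.eq_swap]; simpa using h0
    · intro z _ hzx
      by_cases he : s(y, z) ∈ pedges P ∨ s(y, z) = s(v1, v2)
      · rw [ha _ he, hy1, zero_mul]
      · push Not at he
        apply hz _ (hy1 z)
        rw [hS2, Pi.add_apply, lchain_notMem (fun hm => he.1 (p2 _ hm)), Pi.single_eq_of_ne,
          add_zero]
        intro hh
        rcases Sym2.eq_iff.1 hh with hh | hh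
        · exact hxy' hh.1.symm
        · exact hzx hh.2
    · simp
  have h0 := congrFun (hT.dual.bd_cobd (S1 * S2)) x
  rw [bd, Finset.sum_eq_single t] at h0
  · have m1 : s(x, t) ∈ pedges (u :: L1 ++ x :: t :: R) := mem_pedges_mid _ _ _ _
    have m2 : s(x, t) ∈ pedges (x :: t :: (R ++ L3 ++ [y])) := by simp [pedges]
    rw [ha _ (Or.inl (p1 _ m1)), hS1, hS2, Pi.add_apply, Pi.add_apply, lchain_mem hnd1 m1,
      lchain_mem hnd2 m2, Pi.single_eq_of_ne, Pi.single_eq_of_ne] at h0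
    · simp at h0
    · intro hh
      rcases Sym2.eq_iff.1 hh with hh | hh
      · exact hty hh.2
      · exact hxy' hh.1
    · intro hh
      rcases Sym2.eq_iff.1 hh with hh | hh
      · exact hxu hh.1
      · exact hxw hh.1
  · intro z _ hzt
    by_cases hzy : z = y
    · rw [hzy, hQy]
    have h2 : cobd T l r S2 s(x, z) = 0 := by
      rw [hS2, Pi.add_apply, lchain_notMem, Pi.single_eq_of_ne, add_zero]
      · intro hh
        rcases Sym2.eq_iff.1 hh with hh | hh
        · exact hzy hh.2
        · exact hxy' hh.1
      · intro hm
        rw [pedges, List.mem_cons] at hm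
        rcases hm with hm | hm
        · rcases Sym2.eq_iff.1 hm with hh | hh
          · exact hzt hh.2
          · exact (List.nodup_cons.1 hnd2).1 (by rw [hh.1]; simp)
        · exact (List.nodup_cons.1 hnd2).1 (mem_of_mem_pedges hm (by simp))
    by_cases he : s(x, z) ∈ pedges P ∨ s(x, z) = s(v1, v2)
    · rw [ha _ he, h2, mul_zero]
    · push Not at he
      refine hz _ ?_ h2
      rw [hS1, Pi.add_apply, lchain_notMem (fun hm => he.1 (p1 _ hm)), Pi.single_eq_of_ne,
          add_zero]
      intro hh
      rcases Sym2.eq_iff.1 hh with hh | hh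
      · exact hxu hh.1
      · exact hxw hh.1
  · simp

/-- Some interior vertex of the boundary path has no chords. -/
theorem Disc.exists_chordless (hT : TriSphere T l r) {v1 v2 : V} {D : F → ZMod 2} {W : Finset V}
    {P : List V} (h : Disc T l r v1 v2 D W P) :
    ∃ A a v b C, P = A ++ a :: v :: b :: C ∧ ∀ w ∈ P, T.Adj v w → w = a ∨ w = b := by
  have key : ∀ n : ℕ, ∀ A u M w C, M.length = n → M ≠ [] → P = A ++ u :: M ++ w :: C →
      T.Adj u w → ∃ A a v b C, P = A ++ a :: v :: b :: C ∧ ∀ w ∈ P, T.Adj v w → w = a ∨ w = b := by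
    intro n
    induction n using Nat.strong_induction_on with
    | _ n ih =>
      intro A u M w C hlen hM hP huw
      obtain ⟨x, M, rfl⟩ := List.exists_cons_of_ne_nil hM
      obtain ⟨b, R, hb⟩ : ∃ b R, M ++ w :: C = b :: R := by
        cases M with
        | nil => exact ⟨w, C, rfl⟩
        | cons t M => exact ⟨t, M ++ w :: C, rfl⟩
      by_cases hc : ∀ z ∈ P, T.Adj x z → z = u ∨ z = b
      · exact ⟨A, u, x, b, R, by rw [hP, ← hb]; simp, hc⟩
      push Not at hc
      obtain ⟨z, hz, hxz, hzu, hzb⟩ := hc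
      have hz' : z ∈ A ∨ z = u ∨ z = x ∨ z ∈ M ∨ z = w ∨ z ∈ C := by
        rw [hP] at hz; simpa using hz
      rcases hz' with hz' | hz' | hz' | hz' | hz' | hz'
      · obtain ⟨A1, A2, rfl⟩ := List.append_of_mem hz'
        have : P = A1 ++ z :: A2 ++ u :: [] ++ x :: M ++ w :: C := by rw [hP]; simp
        exact (Disc.not_cross hT (this ▸ h) hxz.symm huw).elim
      · exact (hzu hz').elim
      · exact (hxz.ne hz'.symm).elim
      · obtain ⟨N1, N2, rfl⟩ := List.append_of_mem hz'
        refine ih N1.length ?_ (A ++ [u]) x N1 z (N2 ++ w :: C) rfl ?_ ?_ hxz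
        · simp at hlen; omega
        · rintro rfl; simp at hb; exact hzb hb.1
        · rw [hP]; simp
      · subst hz'
        refine ih M.length ?_ (A ++ [u]) x M z C rfl ?_ ?_ hxz
        · simp at hlen; omega
        · rintro rfl; simp at hb; exact hzb hb.1
        · rw [hP]; simp
      · obtain ⟨C1, C2, rfl⟩ := List.append_of_mem hz'
        have : P = A ++ u :: [] ++ x :: M ++ w :: C1 ++ z :: C2 := by rw [hP]; simp
        exact (Disc.not_cross hT (this ▸ h) huw hxz).elim
  obtain ⟨M, hM, hP⟩ := h.exists_eq
  exact key _ [] v1 M v2 [] rfl hM (by rw [hP]; simp) h.adj_ends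

/-- A canonical construction of a plane graph: `P` is the current outer path, without the
base edge `v1 v2`, and `W` the current vertex set. -/
inductive Canon (T : SimpleGraph V) (v1 v2 v3 : V) : Finset V → List V → Prop
  | base (h12 : T.Adj v1 v2) (h13 : T.Adj v1 v3) (h32 : T.Adj v3 v2)
      (hout : ∀ u ∈ [v1, v3, v2], ∃ z, z ∉ ({v1, v3, v2} : Finset V) ∧ T.Adj u z) :
      Canon T v1 v2 v3 {v1, v3, v2} [v1, v3, v2]
  | step {W : Finset V} {A B C : List V} {a b : V} (v : V)
      (h : Canon T v1 v2 v3 W (A ++ a :: B ++ b :: C)) (hv : v ∉ W)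
      (hadj : ∀ u ∈ W, T.Adj v u ↔ u = a ∨ u ∈ B ∨ u = b)
      (hout : ∀ u ∈ A ++ a :: v :: b :: C, ∃ z, z ∉ insert v W ∧ T.Adj u z) :
      Canon T v1 v2 v3 (insert v W) (A ++ a :: v :: b :: C)

theorem Disc.exists_canon (hT : TriSphere T l r) (hn : 4 ≤ Fintype.card V) {v1 v2 : V}
    {D : F → ZMod 2} {W : Finset V} {P : List V} (h : Disc T l r v1 v2 D W P)
    (hout : ∀ u ∈ P, ∃ z, z ∉ W ∧ T.Adj u z) : ∃ v3, Canon T v1 v2 v3 W P := by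
  induction hk : W.card using Nat.strong_induction_on generalizing D W P with
  | _ k ih =>
    have hPW : P.toFinset ⊆ W := fun u hu => h.sub u (List.mem_toFinset.1 hu)
    have hPc : P.toFinset.card = P.length := List.toFinset_card_of_nodup h.nodup
    have hle := Finset.card_le_card hPW
    have hlen := h.len
    by_cases h4 : 4 ≤ W.card
    · obtain ⟨A, a, v, b, C, rfl, hch⟩ := h.exists_chordless hT
      obtain ⟨B, D', hD', hadj⟩ := h.peel hT hn h4 hch
      have hvW : v ∈ W := h.sub v (by simp)
      have hvw : ∀ u ∈ A ++ a :: B ++ b :: C, ∃ z, z ∉ W.erase v ∧ T.Adj u z := by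
        intro u hu
        have huW := (Finset.mem_erase.1 (hD'.sub u hu)).2
        have hu' : u ∈ A ++ a :: v :: b :: C ∨ u ∈ B := by simp at hu ⊢; tauto
        rcases hu' with hu' | hu'
        · obtain ⟨z, hz, huz⟩ := hout u hu'
          exact ⟨z, fun hh => hz (Finset.mem_erase.1 hh).2, huz⟩
        · exact ⟨v, by simp, ((hadj u huW).2 (Or.inr (Or.inl hu'))).symm⟩
      have hlt : (W.erase v).card < k := by
        rw [← hk]; exact Finset.card_erase_lt_of_mem hvW
      obtain ⟨v3, hc⟩ := ih _ hlt hD' hvw rfl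
      have hst := Canon.step v hc (by simp)
        (fun u hu => hadj u (Finset.mem_erase.1 hu).2) (by rwa [Finset.insert_erase hvW])
      rw [Finset.insert_erase hvW] at hst
      exact ⟨v3, hst⟩
    · obtain ⟨M, hM, hP⟩ := h.exists_eq
      obtain ⟨v3, rfl⟩ : ∃ v3, M = [v3] := by
        rw [← List.length_eq_one_iff]
        have := List.length_pos_iff.2 hM
        have hl : P.length = M.length + 2 := by rw [hP]; simp
        omega
      have hW : W = {v1, v3, v2} := by
        have := Finset.eq_of_subset_of_card_le hPW (by omega)
        rw [← this, hP]; simp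
      subst hW
      have hP' : P = [v1, v3, v2] := by simpa using hP
      subst hP'
      exact ⟨v3, Canon.base h.adj_ends (h.adj (by simp [pedges])) (h.adj (by simp [pedges])) hout⟩

/-- Every triangulated sphere has a canonical construction ending with a vertex of a given face. -/
theorem TriSphere.exists_canon (hT : TriSphere T l r) (hn : 4 ≤ Fintype.card V) {f0 : F}
    {v1 v2 vn : V} (h12 : v1 ≠ v2) (h1 : Inc T l r f0 s(vn, v1)) (h2 : Inc T l r f0 s(vn, v2)) :
    ∃ v3 P, Canon T v1 v2 v3 (Finset.univ.erase vn) P ∧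
      ∀ u, T.Adj vn u ↔ u ∈ P := by
  have hi := hT.inc_iff h1 h2 h12
  have hd : Disc T l r v1 v2 ((fun _ => 1) + Pi.single f0 1) Finset.univ
      ([] ++ v1 :: vn :: v2 :: []) := by
    have hD : ∀ f, (((fun _ => 1) + Pi.single f0 1 : F → ZMod 2) f = 1) ↔ f ≠ f0 := by
      intro f
      by_cases hf : f = f0
      · subst hf; simp [zadd_self]
      · simp [hf]
    refine ⟨?_, rfl, rfl, by simp, by simp, ?_, ?_, by simp, ?_, ?_⟩
    · have := h1.adj.ne; have := h2.adj.ne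
      simp; tauto
    · intro e
      rw [cobd_add, cobd_const, zero_add, cobd_single_eq_one hT.ne, hi]
      simp [pedges, Sym2.eq_swap (a := v1) (b := vn)]
      tauto
    · intro y f w _ hy hf
      rw [hD]
      rintro rfl
      have := (hi _).1 hf
      simp only [Sym2.eq_iff] at this
      simp at hy
      tauto
    · intro y z _ _ hyz _
      have hne := hT.ne s(y, z) hyz
      by_cases hl : l s(y, z) = f0
      · exact ⟨_, inc_right hyz, (hD _).2 (fun hh => hne (hl.trans hh.symm))⟩
      · exact ⟨_, inc_left hyz, (hD _).2 hl⟩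
    · intro S _ f g hf hg
      have k : ∀ f, ((fun _ => 1) + Pi.single f0 1 : F → ZMod 2) f = 0 → f = f0 := by
        intro f hf
        by_contra hne
        rw [(hD f).2 hne] at hf
        exact one_ne_zero hf
      rw [k f hf, k g hg]
  obtain ⟨B, D', hD', hadj⟩ := hd.peel hT hn (by simpa using hn) (by
    intro w hw hv
    have := hv.ne
    simp at hw
    tauto)
  have hadj' : ∀ u, T.Adj vn u ↔ u ∈ [] ++ v1 :: B ++ v2 :: [] := by
    intro u
    rw [hadj u (Finset.mem_univ u)]
    simp
  obtain ⟨v3, hc⟩ := hD'.exists_canon hT hn (fun u hu => ⟨vn, by simp, ((hadj' u).2 hu).symm⟩)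
  exact ⟨v3, _, hc, hadj'⟩

end ArcDual

namespace ArcDual

variable {V : Type} [Fintype V] [DecidableEq V]

/-- The left end of an edge on the spine. -/
noncomputable def elo (pos : V → ℝ) (e : Sym2 V) : ℝ :=
  Sym2.lift ⟨fun a b => min (pos a) (pos b), fun _ _ => min_comm _ _⟩ e

/-- The right end of an edge on the spine. -/
noncomputable def ehi (pos : V → ℝ) (e : Sym2 V) : ℝ :=
  Sym2.lift ⟨fun a b => max (pos a) (pos b), fun _ _ => max_comm _ _⟩ e

theorem elo_mk {pos : V → ℝ} {a b : V} (h : pos a < pos b) : elo pos s(a, b) = pos a :=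
  min_eq_left h.le

theorem ehi_mk {pos : V → ℝ} {a b : V} (h : pos a < pos b) : ehi pos s(a, b) = pos b :=
  max_eq_right h.le

/-- A plane picture: every edge `e` of `E` consists of a lower halfcircle from its left end to
`c e` and an upper halfcircle from `c e` to its right end, either of which may be degenerate. -/
structure Pic (pos : V → ℝ) (c : Sym2 V → ℝ) (E : Set (Sym2 V)) (W : Finset V) : Prop where
  inj : ∀ x ∈ W, ∀ y ∈ W, pos x = pos y → x = y
  wf : ∀ e ∈ E, ∃ a b, a ∈ W ∧ b ∈ W ∧ e = s(a, b) ∧ pos a < pos b ∧ pos a ≤ c e ∧ c e ≤ pos b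
  cpos : ∀ e ∈ E, ∀ w ∈ W, c e = pos w → c e = elo pos e ∨ c e = ehi pos e
  cne : ∀ e ∈ E, ∀ f ∈ E, e ≠ f → c e = c f → c e = elo pos e ∨ c e = ehi pos e
  up : ∀ e ∈ E, ∀ f ∈ E, c e < c f → c f < ehi pos e → ehi pos e < ehi pos f → False
  dn : ∀ e ∈ E, ∀ f ∈ E, elo pos e < elo pos f → elo pos f < c e → c e < c f → False

/-- The spine interval from `s` to `t` contains no points of the picture and is not below any
halfcircle. -/
structure Clear (pos : V → ℝ) (c : Sym2 V → ℝ) (E : Set (Sym2 V)) (W : Finset V) (s t : ℝ) :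
    Prop where
  pt : ∀ w ∈ W, pos w ≤ s ∨ t ≤ pos w
  cr : ∀ e ∈ E, c e ≤ s ∨ t ≤ c e
  arc : ∀ e ∈ E, ehi pos e ≤ s ∨ t ≤ c e

/-- A vertex of the outer path with a bound `h` on the number of its mountains to the right,
a flag `k` that is set only if the spine is clear up to the next vertex, and a vertex `o` waiting
to be drawn between this vertex and the next one. -/
structure Ent (V : Type) where
  u : V
  h : ℕ
  k : Bool
  o : Option V

/-- A picture together with its visible outer path and a bound on its number of biarcs. -/
structure St (pos : V → ℝ) (c : Sym2 V → ℝ) (E : Set (Sym2 V)) (W : Finset V) (β : ℕ)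
    (L : List (Ent V)) : Prop where
  pic : Pic pos c E W
  mem : ∀ x ∈ L, x.u ∈ W
  chain : L.IsChain fun x y => pos x.u < pos y.u ∧
    (x.k = true → Clear pos c E W (pos x.u) (pos y.u))
  vis : ∀ x ∈ L, ∀ e ∈ E, c e < pos x.u → pos x.u < ehi pos e → False
  cnt : ∀ x ∈ L, {e ∈ E | c e = pos x.u ∧ elo pos e = pos x.u}.ncard ≤ x.h
  bia : {e ∈ E | elo pos e < c e ∧ c e < ehi pos e}.ncard ≤ β

/-- A configuration is drawable if it is realised by some picture. -/
def Dr (E : Set (Sym2 V)) (W : Finset V) (β : ℕ) (L : List (Ent V)) : Prop :=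
  ∃ pos c, St pos c E W β L

theorem Dr.mono {E E' : Set (Sym2 V)} {W : Finset V} {β : ℕ} {L : List (Ent V)}
    (h : Dr E W β L) (hE : E' ⊆ E) : Dr E' W β L := by
  obtain ⟨pos, c, hp, hm, hc, hv, hcnt, hb⟩ := h
  refine ⟨pos, c, ⟨hp.inj, fun e he => hp.wf e (hE he), fun e he => hp.cpos e (hE he),
    fun e he f hf => hp.cne e (hE he) f (hE hf), fun e he f hf => hp.up e (hE he) f (hE hf),
    fun e he f hf => hp.dn e (hE he) f (hE hf)⟩, hm, ?_, fun x hx e he => hv x hx e (hE he),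
    fun x hx => ?_, ?_⟩
  · refine hc.imp fun x y hxy => ⟨hxy.1, fun hk => ?_⟩
    obtain ⟨h1, h2, h3⟩ := hxy.2 hk
    exact ⟨h1, fun e he => h2 e (hE he), fun e he => h3 e (hE he)⟩
  · refine (Set.ncard_le_ncard ?_ (Set.toFinite _)).trans (hcnt x hx)
    rintro e ⟨he, h'⟩
    exact ⟨hE he, h'⟩
  · refine (Set.ncard_le_ncard ?_ (Set.toFinite _)).trans hb
    rintro e ⟨he, h'⟩
    exact ⟨hE he, h'⟩

theorem chain_le {pos : V → ℝ} {R : Ent V → Ent V → Prop} {P Q : List (Ent V)} {a : Ent V}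
    (h : (P ++ a :: Q).IsChain fun x y => pos x.u < pos y.u ∧ R x y) :
    (∀ x ∈ P, pos x.u < pos a.u) ∧ ∀ x ∈ Q, pos a.u < pos x.u := by
  have h1 : (P ++ a :: Q).IsChain fun x y => pos x.u < pos y.u := h.imp fun x y hxy => hxy.1
  have : IsTrans (Ent V) (fun x y => pos x.u < pos y.u) := ⟨fun x y z => lt_trans⟩
  rw [List.isChain_iff_pairwise, List.pairwise_append] at h1
  exact ⟨fun x hx => h1.2.2 x hx a (by simp), fun x hx => (List.pairwise_cons.1 h1.2.1).1 x hx⟩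

/-- Drawing a mountain over the middle one of three consecutive vertices of the outer path. -/
theorem Dr.cover {E : Set (Sym2 V)} {W : Finset V} {β : ℕ} {P Q : List (Ent V)} {x y z : Ent V}
    (h : Dr E W β (P ++ x :: y :: z :: Q)) (o : Option V) :
    Dr (insert s(x.u, z.u) E) W β (P ++ ⟨x.u, x.h + 1, false, o⟩ :: z :: Q) := by
  obtain ⟨pos, c, hp, hm, hc, hv, hcnt, hb⟩ := h.mono (E' := E \ {s(x.u, z.u)}) Set.sdiff_subset
  have hx := hm x (by simp)
  have hz := hm z (by simp)
  have h1 := chain_le hc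
  have hyz := chain_le (P := P ++ [x, y]) (a := z) (Q := Q) (by simpa using hc)
  have hxz : pos x.u < pos z.u := h1.2 z (by simp)
  have hvx := hv x (by simp)
  have hvz := hv z (by simp)
  set g := s(x.u, z.u) with hg
  set c' : Sym2 V → ℝ := fun e => if e = g then pos x.u else c e with hc'
  have hcg : c' g = pos x.u := if_pos rfl
  have hlo : elo pos g = pos x.u := elo_mk hxz
  have hhi : ehi pos g = pos z.u := ehi_mk hxz
  have hce : ∀ e ∈ E \ {g}, c' e = c e := fun e he => if_neg he.2
  have hE : ∀ e ∈ insert g E, e = g ∨ e ∈ E \ {g} := by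
    intro e he
    by_cases heg : e = g
    · exact Or.inl heg
    · exact Or.inr ⟨he.resolve_left heg, heg⟩
  have hwf : ∀ e ∈ E \ {g}, ∃ a b, a ∈ W ∧ b ∈ W ∧ elo pos e = pos a ∧ ehi pos e = pos b ∧
      elo pos e ≤ c e ∧ c e ≤ ehi pos e := by
    intro e he
    obtain ⟨a, b, ha, hb, rfl, h1, h2, h3⟩ := hp.wf e he
    rw [elo_mk h1, ehi_mk h1]
    exact ⟨a, b, ha, hb, rfl, rfl, h2, h3⟩
  have hclear : ∀ s t, Clear pos c (E \ {g}) W s t → (t ≤ pos x.u ∨ pos z.u ≤ s) →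
      Clear pos c' (insert g E) W s t := by
    intro s t hst hor
    refine ⟨hst.pt, ?_, ?_⟩
    · intro e he
      rcases hE e he with rfl | he
      · rw [hcg]
        rcases hor with h | h
        · exact Or.inr h
        · exact Or.inl (hxz.le.trans h)
      · rw [hce e he]; exact hst.cr e he
    · intro e he
      rcases hE e he with rfl | he
      · rw [hcg, hhi]; exact hor.symm
      · rw [hce e he]; exact hst.arc e he
  refine ⟨pos, c', ⟨hp.inj, ?_, ?_, ?_, ?_, ?_⟩, ?_, ?_, ?_, ?_, ?_⟩
  · intro e he
    rcases hE e he with rfl | he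
    · exact ⟨x.u, z.u, hx, hz, rfl, hxz, hcg.ge, by rw [hcg]; exact hxz.le⟩
    · rw [hce e he]; exact hp.wf e he
  · intro e he w hw
    rcases hE e he with rfl | he
    · rw [hcg, hlo]; exact fun _ => Or.inl rfl
    · rw [hce e he]; exact hp.cpos e he w hw
  · intro e he f hf hef hcc
    rcases hE e he with rfl | he
    · exact Or.inl (hcg.trans hlo.symm)
    · rw [hce e he] at hcc ⊢
      rcases hE f hf with rfl | hf
      · exact hp.cpos e he x.u hx (hcc.trans hcg)
      · rw [hce f hf] at hcc
        exact hp.cne e he f hf hef hcc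
  · intro e he f hf
    rcases hE e he with rfl | he <;> rcases hE f hf with rfl | hf
    · exact fun h => absurd h (lt_irrefl _)
    · rw [hce f hf, hcg, hhi]
      exact fun _ h2 h3 => hvz f hf h2 h3
    · rw [hce e he, hcg, hhi]
      exact fun h1 h2 _ => hvx e he h1 h2
    · rw [hce e he, hce f hf]
      exact hp.up e he f hf
  · intro e he f hf
    rcases hE e he with rfl | he <;> rcases hE f hf with rfl | hf
    · exact fun h => absurd h (lt_irrefl _)
    · rw [hcg, hlo]
      exact fun h1 h2 => absurd h1 h2.not_gt
    · rw [hce e he, hcg, hlo]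
      exact fun _ h2 h3 => absurd h2 h3.not_gt
    · rw [hce e he, hce f hf]
      exact hp.dn e he f hf
  · intro w hw
    simp only [List.mem_append, List.mem_cons] at hw
    rcases hw with hw | rfl | rfl | hw
    · exact hm w (by simp [hw])
    · exact hx
    · exact hz
    · exact hm w (by simp [hw])
  · rw [List.isChain_append_cons_cons] at hc ⊢
    obtain ⟨hc1, -, hc2⟩ := hc
    rw [List.isChain_cons_cons] at hc2
    refine ⟨?_, ⟨hxz, by simp⟩, ?_⟩
    · have hc1' : (P ++ [(⟨x.u, x.h + 1, false, o⟩ : Ent V)]).IsChain fun x y =>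
          pos x.u < pos y.u ∧ (x.k = true → Clear pos c (E \ {g}) W (pos x.u) (pos y.u)) := by
        rw [List.isChain_append] at hc1 ⊢
        refine ⟨hc1.1, by simp, fun a ha b hb => ?_⟩
        simp at hb; subst hb
        exact hc1.2.2 a ha x (by simp)
      refine hc1'.imp_of_mem_imp fun a b ha hb hab => ⟨hab.1, fun hk => hclear _ _ (hab.2 hk) ?_⟩
      left
      simp only [List.mem_append, List.mem_cons, List.not_mem_nil, or_false] at hb
      rcases hb with hb | rfl
      · exact (h1.1 b hb).le
      · exact le_rfl
    · refine hc2.2.imp_of_mem_imp fun a b ha hb hab => ⟨hab.1, fun hk => hclear _ _ (hab.2 hk) ?_⟩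
      right
      rcases List.mem_cons.1 ha with rfl | ha
      · exact le_rfl
      · exact (hyz.2 a ha).le
  · intro w hw e he
    have hw' : w.u = x.u ∨ w.u = z.u ∨ pos w.u < pos x.u ∨ pos z.u < pos w.u := by
      simp only [List.mem_append, List.mem_cons] at hw
      rcases hw with hw | rfl | rfl | hw
      · exact Or.inr (Or.inr (Or.inl (h1.1 w hw)))
      · exact Or.inl rfl
      · exact Or.inr (Or.inl rfl)
      · exact Or.inr (Or.inr (Or.inr (hyz.2 w hw)))
    rcases hE e he with rfl | he
    · rw [hcg, hhi]
      intro g1 g2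
      rcases hw' with hw' | hw' | hw' | hw'
      · rw [hw'] at g1; exact lt_irrefl _ g1
      · rw [hw'] at g2; exact lt_irrefl _ g2
      · exact lt_asymm g1 hw'
      · exact lt_asymm g2 hw'
    · rw [hce e he]
      simp only [List.mem_append, List.mem_cons] at hw
      rcases hw with hw | rfl | rfl | hw
      · exact hv w (by simp [hw]) e he
      · exact hvx e he
      · exact hvz e he
      · exact hv w (by simp [hw]) e he
  · have hsub : ∀ t, {e ∈ insert g E | c' e = t ∧ elo pos e = t}
        ⊆ insert g {e ∈ E \ {g} | c e = t ∧ elo pos e = t} := by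
      rintro t e ⟨he, h1, h2⟩
      rcases hE e he with rfl | he
      · exact Or.inl rfl
      · rw [hce e he] at h1
        exact Or.inr ⟨he, h1, h2⟩
    have hsub' : ∀ t, t ≠ pos x.u → {e ∈ insert g E | c' e = t ∧ elo pos e = t}
        ⊆ {e ∈ E \ {g} | c e = t ∧ elo pos e = t} := by
      rintro t ht e ⟨he, h1, h2⟩
      rcases hE e he with rfl | he
      · exact absurd (hcg.symm.trans h1).symm ht
      · rw [hce e he] at h1
        exact ⟨he, h1, h2⟩
    intro w hw
    simp only [List.mem_append, List.mem_cons] at hw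
    rcases hw with hw | rfl | rfl | hw
    · exact (Set.ncard_le_ncard (hsub' _ (h1.1 w hw).ne) (Set.toFinite _)).trans
        (hcnt w (by simp [hw]))
    · refine (Set.ncard_le_ncard (hsub _) (Set.toFinite _)).trans
        ((Set.ncard_insert_le _ _).trans ?_)
      have := hcnt x (by simp)
      exact Nat.succ_le_succ this
    · exact (Set.ncard_le_ncard (hsub' _ hxz.ne') (Set.toFinite _)).trans
        (hcnt w (by simp))
    · exact (Set.ncard_le_ncard (hsub' _ (hxz.trans (hyz.2 w hw)).ne') (Set.toFinite _)).trans
        (hcnt w (by simp [hw]))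
  · refine (Set.ncard_le_ncard ?_ (Set.toFinite _)).trans hb
    rintro e ⟨he, h1, h2⟩
    rcases hE e he with rfl | he
    · rw [hcg, hlo] at h1; exact absurd h1 (lt_irrefl _)
    · rw [hce e he] at h1 h2
      exact ⟨he, h1, h2⟩

end ArcDual

namespace ArcDual

variable {V : Type} [Fintype V] [DecidableEq V]

theorem exists_gap {S : Set ℝ} (hS : S.Finite) {a b : ℝ} (hab : a < b) :
    ∃ t, a < t ∧ t ≤ b ∧ ∀ s ∈ S, s ≤ a ∨ t ≤ s := by
  have hne : (insert b {s ∈ S | a < s}).Nonempty := ⟨b, Or.inl rfl⟩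
  obtain ⟨t, ht, hmin⟩ := Set.exists_min_image _ id ((hS.subset (Set.sep_subset _ _)).insert b) hne
  refine ⟨t, ?_, hmin b (Or.inl rfl), fun s hs => ?_⟩
  · rcases ht with rfl | ht
    · exact hab
    · exact ht.2
  · rcases le_or_gt s a with h | h
    · exact Or.inl h
    · exact Or.inr (hmin s (Or.inr ⟨hs, h⟩))

theorem exists_strictAnti_between {m t a : ℝ} (hmt : m < t) :
    ∃ g : ℝ → ℝ, (∀ y, a < y → m < g y ∧ g y < t) ∧ ∀ y z, a < y → y < z → g z < g y := by
  refine ⟨fun y => m + (t - m) / (1 + (y - a)), fun y hy => ⟨?_, ?_⟩, fun y z hy hyz => ?_⟩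
  · have : 0 < (t - m) / (1 + (y - a)) := div_pos (by linarith) (by linarith)
    linarith
  · have : (t - m) / (1 + (y - a)) < t - m := div_lt_self (by linarith) (by linarith)
    linarith
  · have : (t - m) / (1 + (z - a)) < (t - m) / (1 + (y - a)) :=
      div_lt_div_of_pos_left (by linarith) (by linarith) (by linarith)
    linarith

set_option maxHeartbeats 4000000 in
/-- Drawing a new vertex immediately to the right of a vertex `x` of the outer path, joined to `x`
by a pocket. It is joined to the next vertex `y` of the path by a pocket if `κ` holds, and by a
mountain otherwise; in the latter case the mountains starting at `x` become biarcs. -/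
theorem Dr.ins {E : Set (Sym2 V)} {W : Finset V} {β : ℕ} {P Q : List (Ent V)} {x y : Ent V}
    (h : Dr E W β (P ++ x :: y :: Q)) {v : V} (hvW : v ∉ W) (κ : Bool) (hκ : κ = true → x.k = true)
    (o o' : Option V) :
    Dr (insert s(x.u, v) (insert s(v, y.u) E)) (insert v W) (if κ then β else β + x.h)
      (P ++ ⟨x.u, 0, true, o⟩ :: ⟨v, if κ then 0 else 1, κ, o'⟩ :: y :: Q) := by
  obtain ⟨pos, c, hp, hm, hc, hv, hcnt, hb⟩ := h
  have hx := hm x (by simp)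
  have hy := hm y (by simp)
  have h1 := chain_le hc
  have h2 := chain_le (P := P ++ [x]) (a := y) (Q := Q) (by simpa using hc)
  have hxy : pos x.u < pos y.u := h1.2 y (by simp)
  have hvx := hv x (by simp)
  have hvy := hv y (by simp)
  have hclr : κ = true → Clear pos c E W (pos x.u) (pos y.u) := by
    intro hk
    rw [List.isChain_append_cons_cons] at hc
    exact hc.2.1.2 (hκ hk)
  have hwf : ∀ e ∈ E, v ∉ e ∧ (∃ a ∈ W, elo pos e = pos a) ∧ (∃ a ∈ W, ehi pos e = pos a) ∧
      elo pos e < ehi pos e ∧ elo pos e ≤ c e ∧ c e ≤ ehi pos e := by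
    intro e he
    obtain ⟨a, b, ha, hb, rfl, h1, h2, h3⟩ := hp.wf e he
    rw [elo_mk h1, ehi_mk h1]
    refine ⟨?_, ⟨a, ha, rfl⟩, ⟨b, hb, rfl⟩, h1, h2, h3⟩
    rw [Sym2.mem_iff]
    rintro (rfl | rfl)
    · exact hvW ha
    · exact hvW hb
  obtain ⟨t, hat, htb, hgp, hgc, htk⟩ : ∃ t, pos x.u < t ∧ t ≤ pos y.u ∧
      (∀ w ∈ W, pos w ≤ pos x.u ∨ t ≤ pos w) ∧ (∀ e ∈ E, c e ≤ pos x.u ∨ t ≤ c e) ∧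
      (κ = true → t = pos y.u) := by
    cases hk : κ with
    | true => exact ⟨pos y.u, hxy, le_rfl, (hclr hk).pt, (hclr hk).cr, fun _ => rfl⟩
    | false =>
      obtain ⟨t, h1, h2, h3⟩ := exists_gap (S := Set.range pos ∪ Set.range c)
        ((Set.finite_range _).union (Set.finite_range _)) hxy
      exact ⟨t, h1, h2, fun w _ => h3 _ (Or.inl ⟨w, rfl⟩), fun e _ => h3 _ (Or.inr ⟨e, rfl⟩),
        by simp⟩
  obtain ⟨m, ham, hmt⟩ := exists_between hat
  obtain ⟨g, hg1, hg2⟩ := exists_strictAnti_between (a := pos x.u) hmt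
  set q : ℝ := if κ then pos y.u else m with hq
  set pos' : V → ℝ := Function.update pos v m with hpos'
  set c' : Sym2 V → ℝ := fun e => if e = s(x.u, v) then m else if e = s(v, y.u) then q else
    if c e = pos x.u ∧ elo pos e = pos x.u then g (ehi pos e) else c e with hc'
  have hpv : pos' v = m := Function.update_self _ _ _
  have hpw : ∀ w ∈ W, pos' w = pos w := by
    intro w hw
    refine Function.update_of_ne ?_ _ _
    rintro rfl
    exact hvW hw
  have hxv : x.u ≠ v := fun h => hvW (h ▸ hx)
  have hyv : y.u ≠ v := fun h => hvW (h ▸ hy)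
  have hold : ∀ e ∈ E, elo pos' e = elo pos e ∧ ehi pos' e = ehi pos e ∧
      c' e = if c e = pos x.u ∧ elo pos e = pos x.u then g (ehi pos e) else c e := by
    intro e he
    obtain ⟨hve, -⟩ := hwf e he
    refine ⟨?_, ?_, ?_⟩
    · obtain ⟨a, b, ha, hb, rfl, h1, h2, h3⟩ := hp.wf e he
      rw [elo_mk h1, elo_mk (by rwa [hpw a ha, hpw b hb]), hpw a ha]
    · obtain ⟨a, b, ha, hb, rfl, h1, h2, h3⟩ := hp.wf e he
      rw [ehi_mk h1, ehi_mk (by rwa [hpw a ha, hpw b hb]), hpw b hb]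
    · rw [hc']
      dsimp only
      rw [if_neg, if_neg]
      · rintro rfl; simp at hve
      · rintro rfl; simp at hve
  have hcases : ∀ e ∈ insert s(x.u, v) (insert s(v, y.u) E),
      (e ∈ E ∧ elo pos' e = elo pos e ∧ ehi pos' e = ehi pos e ∧ c' e = c e ∧
        (t ≤ c e ∨ ehi pos e ≤ pos x.u) ∧ (elo pos e ≤ pos x.u ∨ t ≤ elo pos e) ∧
        (c e ≤ pos x.u ∨ t ≤ c e) ∧ elo pos e ≤ c e ∧ c e ≤ ehi pos e ∧ elo pos e < ehi pos e ∧
        ¬ (c e = pos x.u ∧ elo pos e = pos x.u)) ∨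
      (κ = false ∧ e ∈ E ∧ elo pos e = pos x.u ∧ elo pos' e = pos x.u ∧ ehi pos' e = ehi pos e ∧
        c e = pos x.u ∧ c' e = g (ehi pos e) ∧ t ≤ ehi pos e ∧ ehi pos e ≤ pos y.u ∧
        m < g (ehi pos e) ∧ g (ehi pos e) < t) ∨
      (e = s(x.u, v) ∧ elo pos' e = pos x.u ∧ c' e = m ∧ ehi pos' e = m) ∨
      (e = s(v, y.u) ∧ elo pos' e = m ∧ c' e = q ∧ ehi pos' e = pos y.u) := by
    rintro e (rfl | rfl | he)
    · refine Or.inr (Or.inr (Or.inl ⟨rfl, ?_, if_pos rfl, ?_⟩))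
      · rw [elo_mk (by rw [hpw _ hx, hpv]; exact ham), hpw _ hx]
      · rw [ehi_mk (by rw [hpw _ hx, hpv]; exact ham), hpv]
    · refine Or.inr (Or.inr (Or.inr ⟨rfl, ?_, ?_, ?_⟩))
      · rw [elo_mk (by rw [hpw _ hy, hpv]; exact hmt.trans_le htb), hpv]
      · rw [hc']
        dsimp only
        rw [if_neg, if_pos rfl]
        intro h
        have hxm : x.u ∈ s(v, y.u) := by rw [h]; simp
        rcases Sym2.mem_iff.1 hxm with h' | h'
        · exact hxv h'
        · rw [h'] at hxy; exact lt_irrefl _ hxy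
      · rw [ehi_mk (by rw [hpw _ hy, hpv]; exact hmt.trans_le htb), hpw _ hy]
    · obtain ⟨e1, e2, e3⟩ := hold e he
      obtain ⟨hve, ⟨a, haW, ha⟩, ⟨b, hbW, hb⟩, hlh, hlc, hch⟩ := hwf e he
      by_cases hK : c e = pos x.u ∧ elo pos e = pos x.u
      · right; left
        rw [if_pos hK] at e3
        have hhi : pos x.u < ehi pos e := by rw [← hK.2]; exact hlh
        refine ⟨?_, he, hK.2, e1.trans hK.2, e2, hK.1, e3, ?_, ?_, (hg1 _ hhi).1, (hg1 _ hhi).2⟩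
        · rw [Bool.eq_false_iff]
          intro hk
          rcases (hclr hk).arc e he with h | h
          · exact absurd hhi h.not_gt
          · rw [hK.1] at h; exact absurd hxy h.not_gt
        · rcases hgp b hbW with h | h
          · rw [← hb] at h; exact absurd hhi h.not_gt
          · rwa [hb]
        · by_contra! h
          exact hvy e he (by rw [hK.1]; exact hxy) h
      · left
        rw [if_neg hK] at e3
        refine ⟨he, e1, e2, e3, ?_, by rw [ha]; exact hgp a haW, hgc e he, hlc, hch, hlh, hK⟩
        rcases hgc e he with h | h
        · right
          by_contra! h'
          rcases h.lt_or_eq with h | h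
          · exact hvx e he h h'
          · rcases hp.cpos e he _ hx h with h'' | h''
            · exact hK ⟨h, h''.symm.trans h⟩
            · rw [← h'', h] at h'
              exact lt_irrefl _ h'
        · exact Or.inl h
  have hqm : (κ = true ∧ q = pos y.u ∧ t = pos y.u) ∨ (κ = false ∧ q = m) := by
    cases hk : κ with
    | true => left; exact ⟨rfl, by simp [hq, hk], htk hk⟩
    | false => right; exact ⟨rfl, by simp [hq, hk]⟩
  clear_value pos' c' q
  clear hold hκ hclr htk hwf hg1 hgc hc'
  have hEx : pos x.u < m ∧ m < t ∧ t ≤ pos y.u := ⟨ham, hmt, htb⟩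
  have hclear : ∀ s u, Clear pos c E W s u → (u ≤ pos x.u ∨ pos y.u ≤ s) →
      Clear pos' c' (insert s(x.u, v) (insert s(v, y.u) E)) (insert v W) s u := by
    intro s u hsu hor
    refine ⟨fun w hw => ?_, fun e he => ?_, fun e he => ?_⟩
    · rcases Finset.mem_insert.1 hw with rfl | hw
      · rw [hpv]; grind
      · rw [hpw w hw]; exact hsu.pt w hw
    · rcases hcases e he with ⟨hE, -, -, h3, -⟩ | hK | hA | hB
      · rw [h3]; exact hsu.cr e hE
      · grind
      · grind
      · grind
    · rcases hcases e he with ⟨hE, -, h2, h3, -⟩ | hK | hA | hB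
      · rw [h2, h3]; exact hsu.arc e hE
      · grind
      · grind
      · grind
  have hmem : ∀ w ∈ P ++ (⟨x.u, 0, true, o⟩ : Ent V) :: ⟨v, if κ then 0 else 1, κ, o'⟩ :: y :: Q,
      (w.u = v ∧ w.h = if κ then 0 else 1) ∨ w.u = x.u ∨ (w ∈ P ++ x :: y :: Q ∧ w.u ∈ W ∧
        (pos w.u < pos x.u ∨ pos y.u ≤ pos w.u)) := by
    intro w hw
    simp only [List.mem_append, List.mem_cons] at hw
    rcases hw with hw | rfl | rfl | rfl | hw
    · exact Or.inr (Or.inr ⟨by simp [hw], hm w (by simp [hw]), Or.inl (h1.1 w hw)⟩)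
    · exact Or.inr (Or.inl rfl)
    · exact Or.inl ⟨rfl, rfl⟩
    · exact Or.inr (Or.inr ⟨by simp, hy, Or.inr le_rfl⟩)
    · exact Or.inr (Or.inr ⟨by simp [hw], hm w (by simp [hw]), Or.inr (h2.2 w hw).le⟩)
  refine ⟨pos', c', ⟨?_, ?_, ?_, ?_, ?_, ?_⟩, ?_, ?_, ?_, ?_, ?_⟩
  · intro a ha b hb hab
    rw [Finset.mem_insert] at ha hb
    rcases ha with rfl | ha <;> rcases hb with rfl | hb
    · rfl
    · rw [hpv, hpw b hb] at hab
      rcases hgp b hb with h | h <;> linarith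
    · rw [hpv, hpw a ha] at hab
      rcases hgp a ha with h | h <;> linarith
    · rw [hpw a ha, hpw b hb] at hab
      exact hp.inj a ha b hb hab
  · intro e he
    rcases hcases e he with hO | hK | hA | hB
    · obtain ⟨a, b, ha, hb, rfl, h1, h2, h3⟩ := hp.wf e hO.1
      refine ⟨a, b, Finset.mem_insert_of_mem ha, Finset.mem_insert_of_mem hb, rfl, ?_⟩
      rw [hpw a ha, hpw b hb, hO.2.2.2.1]
      exact ⟨h1, h2, h3⟩
    · obtain ⟨a, b, ha, hb, rfl, h1, h2, h3⟩ := hp.wf e hK.2.1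
      refine ⟨a, b, Finset.mem_insert_of_mem ha, Finset.mem_insert_of_mem hb, rfl, ?_⟩
      rw [hpw a ha, hpw b hb]
      rw [elo_mk h1, ehi_mk h1] at hK
      grind
    · exact ⟨x.u, v, Finset.mem_insert_of_mem hx, Finset.mem_insert_self _ _, hA.1,
        by rw [hpw _ hx, hpv]; exact ham, by rw [hpw _ hx, hA.2.2.1]; exact ham.le,
        by rw [hpv, hA.2.2.1]⟩
    · refine ⟨v, y.u, Finset.mem_insert_self _ _, Finset.mem_insert_of_mem hy, hB.1, ?_⟩
      rw [hpw _ hy, hpv]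
      grind
  · intro e he w hw
    rcases hcases e he with hO | hK | hA | hB
    · rw [hO.2.1, hO.2.2.1, hO.2.2.2.1]
      rcases Finset.mem_insert.1 hw with rfl | hw
      · rw [hpv]; grind
      · rw [hpw w hw]; exact hp.cpos e hO.1 w hw
    · rcases Finset.mem_insert.1 hw with rfl | hw
      · rw [hpv]; grind
      · rw [hpw w hw]
        have := hgp w hw
        grind
    · grind
    · grind
  · intro e he f hf hef
    rcases hcases e he with hO | hK | hA | hB
    · rw [hO.2.1, hO.2.2.1, hO.2.2.2.1]
      rcases hcases f hf with hO' | hK' | hA' | hB'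
      · rw [hO'.2.2.2.1]
        exact hp.cne e hO.1 f hO'.1 hef
      · grind
      · grind
      · have := hp.cpos e hO.1 _ hy
        grind
    · rcases hcases f hf with hO' | hK' | hA' | hB'
      · grind
      · intro hcc
        exfalso
        rw [hK.2.2.2.2.2.2.1, hK'.2.2.2.2.2.2.1] at hcc
        have hhi : ehi pos e = ehi pos f := by
          rcases lt_trichotomy (ehi pos e) (ehi pos f) with h | h | h
          · exact absurd hcc (hg2 _ _ (by linarith [hK.2.2.2.2.2.2.2.1]) h).ne'
          · exact h
          · exact absurd hcc (hg2 _ _ (by linarith [hK'.2.2.2.2.2.2.2.1]) h).ne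
        have hlo : elo pos e = elo pos f := hK.2.2.1.trans hK'.2.2.1.symm
        obtain ⟨a, b, ha, hb, rfl, h1, -, -⟩ := hp.wf e hK.2.1
        obtain ⟨a', b', ha', hb', rfl, h1', -, -⟩ := hp.wf f hK'.2.1
        rw [elo_mk h1, elo_mk h1'] at hlo
        rw [ehi_mk h1, ehi_mk h1'] at hhi
        rw [hp.inj a ha a' ha' hlo, hp.inj b hb b' hb' hhi] at hef
        exact hef rfl
      · grind
      · grind
    · grind
    · grind
  · intro e he f hf
    rcases hcases e he with hO | hK | he' | he' <;> rcases hcases f hf with hO' | hK' | hf' | hf'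
    · rw [hO.2.2.1, hO.2.2.2.1, hO'.2.2.1, hO'.2.2.2.1]
      exact hp.up e hO.1 f hO'.1
    · clear * - hO hK' hEx hqm; grind
    · clear * - hO hf' hEx hqm; grind
    · clear * - hO hf' hEx hqm; grind
    · have := hp.up e hK.2.1 f hO'.1
      clear * - hK hO' hEx hqm this; grind
    · have := hg2 (ehi pos e) (ehi pos f)
      clear * - hK hK' hEx hqm this; grind
    · clear * - hK hf' hEx hqm; grind
    · clear * - hK hf' hEx hqm; grind
    · clear * - he' hO' hEx hqm; grind
    · clear * - he' hK' hEx hqm; grind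
    · clear * - he' hf' hEx hqm; grind
    · clear * - he' hf' hEx hqm; grind
    · have := hvy f hO'.1
      clear * - he' hO' hEx hqm this; grind
    · clear * - he' hK' hEx hqm; grind
    · clear * - he' hf' hEx hqm; grind
    · clear * - he' hf' hEx hqm; grind
  · intro e he f hf
    rcases hcases e he with he' | he' | he' | he' <;> rcases hcases f hf with hf' | hf' | hf' | hf'
    · rw [he'.2.1, he'.2.2.2.1, hf'.2.1, hf'.2.2.2.1]
      exact hp.dn e he'.1 f hf'.1
    all_goals clear * - he' hf' hEx hqm; grind
  · intro w hw
    rcases hmem w hw with h | h | h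
    · rw [h.1]; exact Finset.mem_insert_self _ _
    · rw [h]; exact Finset.mem_insert_of_mem hx
    · exact Finset.mem_insert_of_mem h.2.1
  · rw [List.isChain_append_cons_cons] at hc ⊢
    obtain ⟨hc1, -, hc2⟩ := hc
    rw [List.isChain_cons_cons]
    refine ⟨?_, ⟨?_, fun _ => ?_⟩, ⟨?_, fun hk => ?_⟩, ?_⟩
    · have hc1' : (P ++ [(⟨x.u, 0, true, o⟩ : Ent V)]).IsChain fun x y =>
          pos x.u < pos y.u ∧ (x.k = true → Clear pos c E W (pos x.u) (pos y.u)) := by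
        rw [List.isChain_append] at hc1 ⊢
        refine ⟨hc1.1, by simp, fun a ha b hb => ?_⟩
        simp at hb; subst hb
        exact hc1.2.2 a ha x (by simp)
      have hP : ∀ a ∈ P ++ [(⟨x.u, 0, true, o⟩ : Ent V)], a.u ∈ W ∧ pos a.u ≤ pos x.u := by
        intro a ha
        simp only [List.mem_append, List.mem_cons, List.not_mem_nil, or_false] at ha
        rcases ha with ha | rfl
        · exact ⟨hm a (by simp [ha]), (h1.1 a ha).le⟩
        · exact ⟨hx, le_rfl⟩
      refine hc1'.imp_of_mem_imp fun a b ha hb hab => ?_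
      rw [hpw _ (hP a ha).1, hpw _ (hP b hb).1]
      exact ⟨hab.1, fun hk => hclear _ _ (hab.2 hk) (Or.inl (hP b hb).2)⟩
    · rw [hpw _ hx, hpv]; exact ham
    · rw [hpw _ hx, hpv]
      refine ⟨fun w hw => ?_, fun e he => ?_, fun e he => ?_⟩
      · rcases Finset.mem_insert.1 hw with rfl | hw
        · rw [hpv]; exact Or.inr le_rfl
        · rw [hpw w hw]
          have := hgp w hw
          grind
      · rcases hcases e he with hO | hK | hA | hB <;> grind
      · rcases hcases e he with hO | hK | hA | hB <;> grind
    · rw [hpw _ hy, hpv]; exact hmt.trans_le htb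
    · rw [hpw _ hy, hpv]
      have hk : κ = true := hk
      refine ⟨fun w hw => ?_, fun e he => ?_, fun e he => ?_⟩
      · rcases Finset.mem_insert.1 hw with rfl | hw
        · rw [hpv]; exact Or.inl le_rfl
        · rw [hpw w hw]
          have := hgp w hw
          grind
      · rcases hcases e he with hO | hK | hA | hB <;> grind
      · rcases hcases e he with hO | hK | hA | hB <;> grind
    · have hP : ∀ a ∈ y :: Q, a.u ∈ W ∧ pos y.u ≤ pos a.u := by
        intro a ha
        rcases List.mem_cons.1 ha with rfl | ha
        · exact ⟨hy, le_rfl⟩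
        · exact ⟨hm a (by simp [ha]), (h2.2 a ha).le⟩
      refine hc2.imp_of_mem_imp fun a b ha hb hab => ?_
      rw [hpw _ (hP a ha).1, hpw _ (hP b hb).1]
      exact ⟨hab.1, fun hk => hclear _ _ (hab.2 hk) (Or.inr (hP a ha).2)⟩
  · intro w hw e he
    rcases hmem w hw with h | h | ⟨h, hW, hor⟩
    · rw [h.1, hpv]
      rcases hcases e he with hO | hK | hA | hB <;> grind
    · rw [h, hpw _ hx]
      rcases hcases e he with hO | hK | hA | hB
      · rw [hO.2.2.1, hO.2.2.2.1]; exact hvx e hO.1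
      all_goals grind
    · rw [hpw _ hW]
      rcases hcases e he with hO | hK | hA | hB
      · rw [hO.2.2.1, hO.2.2.2.1]; exact hv w h e hO.1
      all_goals grind
  · intro w hw
    rcases hmem w hw with h | h | ⟨h, hW, hor⟩
    · rw [h.1, hpv]
      rcases hqm with hk | hk
      · refine le_of_eq_of_le ((Set.ncard_eq_zero (Set.toFinite _)).2 ?_) (Nat.zero_le _)
        refine Set.eq_empty_of_forall_notMem ?_
        rintro e ⟨he, h'⟩
        rcases hcases e he with hO | hK | hA | hB <;> grind
      · rw [h.2, if_neg (by simp [hk.1])]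
        refine (Set.ncard_le_ncard ?_ (Set.toFinite _)).trans (Set.ncard_singleton s(v, y.u)).le
        rintro e ⟨he, h'⟩
        rcases hcases e he with hO | hK | hA | hB
        · grind
        · grind
        · grind
        · exact hB.1
    · rw [h, hpw _ hx]
      refine le_of_eq_of_le ((Set.ncard_eq_zero (Set.toFinite _)).2 ?_) (Nat.zero_le _)
      refine Set.eq_empty_of_forall_notMem ?_
      rintro e ⟨he, h'⟩
      rcases hcases e he with hO | hK | hA | hB <;> grind
    · rw [hpw _ hW]
      refine (Set.ncard_le_ncard ?_ (Set.toFinite _)).trans (hcnt w h)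
      rintro e ⟨he, h'⟩
      rcases hcases e he with hO | hK | hA | hB
      · rw [hO.2.1, hO.2.2.2.1] at h'
        exact ⟨hO.1, h'⟩
      all_goals exfalso; grind
  · rcases hqm with hk | hk
    · rw [if_pos hk.1]
      refine (Set.ncard_le_ncard ?_ (Set.toFinite _)).trans hb
      rintro e ⟨he, h'⟩
      rcases hcases e he with hO | hK | hA | hB
      · rw [hO.2.1, hO.2.2.1, hO.2.2.2.1] at h'
        exact ⟨hO.1, h'⟩
      all_goals exfalso; grind
    · rw [if_neg (by simp [hk.1])]
      refine (Set.ncard_le_ncard ?_ (Set.toFinite _)).trans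
        ((Set.ncard_union_le _ _).trans (Nat.add_le_add hb (hcnt x (by simp))))
      rintro e ⟨he, h'⟩
      rcases hcases e he with hO | hK | hA | hB
      · rw [hO.2.1, hO.2.2.1, hO.2.2.2.1] at h'
        exact Or.inl ⟨hO.1, h'⟩
      · exact Or.inr ⟨hK.2.1, hK.2.2.2.2.2.1, hK.2.2.1⟩
      all_goals exfalso; grind

end ArcDual

namespace ArcDual

variable {V : Type} [Fintype V] [DecidableEq V]

theorem Dr.insPocket {E : Set (Sym2 V)} {W : Finset V} {β : ℕ} {P Q : List (Ent V)} {x y : Ent V}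
    (h : Dr E W β (P ++ x :: y :: Q)) {v : V} (hv : v ∉ W) (hk : x.k = true) :
    Dr (insert s(x.u, v) (insert s(v, y.u) E)) (insert v W) β
      (P ++ ⟨x.u, 0, true, none⟩ :: ⟨v, 0, true, none⟩ :: y :: Q) :=
  h.ins hv true (fun _ => hk) none none

theorem Dr.insMountain {E : Set (Sym2 V)} {W : Finset V} {β : ℕ} {P Q : List (Ent V)} {x y : Ent V}
    (h : Dr E W β (P ++ x :: y :: Q)) {v : V} (hv : v ∉ W) :
    Dr (insert s(x.u, v) (insert s(v, y.u) E)) (insert v W) (β + x.h)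
      (P ++ ⟨x.u, 0, true, none⟩ :: ⟨v, 1, false, none⟩ :: y :: Q) :=
  h.ins hv false (by simp) none none

/-- Drawing a mountain from `x` to `z` over `y`, with a vertex `w` inside the triangle. -/
theorem Dr.cov {E : Set (Sym2 V)} {W : Finset V} {β : ℕ} {P Q : List (Ent V)} {x y z : Ent V}
    (h : Dr E W β (P ++ x :: y :: z :: Q)) (o : Option V) (ho : ∀ w ∈ o, w ∉ W) :
    ∃ E' W' β' h', Dr E' W' β' (P ++ ⟨x.u, h', false, none⟩ :: z :: Q) ∧ E ⊆ E' ∧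
      (∀ w, w ∈ W' ↔ w ∈ W ∨ w ∈ o) ∧ 1 ≤ h' ∧ β' + h' ≤ β + x.h + 1 ∧ s(x.u, z.u) ∈ E' ∧
      ∀ w ∈ o, s(x.u, w) ∈ E' ∧ s(w, y.u) ∈ E' ∧ s(w, z.u) ∈ E' := by
  cases o with
  | none =>
    exact ⟨_, W, β, x.h + 1, h.cover none, Set.subset_insert _ _, by simp, by lia, by lia,
      Or.inl rfl, by simp⟩
  | some w =>
    have hw : w ∉ W := ho w rfl
    obtain ⟨κ, hk⟩ : ∃ κ : Bool, κ = x.k := ⟨_, rfl⟩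
    have h1 := h.ins hw κ (fun h => hk ▸ h) none none
    have h2 := Dr.cover (P := P ++ [⟨x.u, 0, true, none⟩]) (x := ⟨w, if κ then 0 else 1, κ, none⟩)
      (y := y) (z := z) (Q := Q) (by simpa using h1) none
    have h3 := Dr.cover (P := P) (x := ⟨x.u, 0, true, none⟩)
      (y := ⟨w, (if κ then 0 else 1) + 1, false, none⟩) (z := z) (Q := Q) (by simpa using h2) none
    refine ⟨_, _, _, 1, h3, ?_, ?_, le_rfl, ?_, Or.inl rfl, ?_⟩
    · exact fun e he => Or.inr (Or.inr (Or.inr (Or.inr he)))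
    · intro u
      simp only [Finset.mem_insert, Option.mem_def, Option.some.injEq]
      constructor
      · rintro (h | h)
        · exact Or.inr h.symm
        · exact Or.inl h
      · rintro (h | h)
        · exact Or.inr h
        · exact Or.inl h.symm
    · split <;> lia
    · rintro u ⟨⟩
      exact ⟨by simp, by simp, by simp⟩

/-- The edges from `v` to the path `L` without its last vertex and to the vertices waiting along
`L`, and the edges from the waiting vertices to `L`, belong to `E`. -/
def Good (E : Set (Sym2 V)) (v : V) (L : List (Ent V)) : Prop :=
  L.IsChain fun p q => s(p.u, v) ∈ E ∧
    ∀ x ∈ p.o, s(p.u, x) ∈ E ∧ s(x, q.u) ∈ E ∧ s(x, v) ∈ E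

theorem Good.mono {E E' : Set (Sym2 V)} {v : V} {L : List (Ent V)} (h : Good E v L) (hE : E ⊆ E') :
    Good E' v L :=
  h.imp fun _ _ hpq => ⟨hE hpq.1, fun x hx => ⟨hE (hpq.2 x hx).1, hE (hpq.2 x hx).2.1,
    hE (hpq.2 x hx).2.2⟩⟩

theorem Good.change_last {E : Set (Sym2 V)} {v : V} {L : List (Ent V)} {p q : Ent V}
    (h : Good E v (L ++ [p])) (hpq : p.u = q.u) : Good E v (L ++ [q]) := by
  unfold Good at h ⊢
  rw [List.isChain_append] at h ⊢
  refine ⟨h.1, by simp, fun a ha b hb => ?_⟩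
  simp at hb; subst hb
  rw [← hpq]
  exact h.2.2 a ha p (by simp)

theorem Good.append {E : Set (Sym2 V)} {v : V} {L M : List (Ent V)} {p q : Ent V}
    (h : Good E v (L ++ [p])) (h' : Good E v (q :: M)) (hpq : p.u = q.u) :
    Good E v (L ++ q :: M) :=
  List.isChain_split.2 ⟨h.change_last hpq, h'⟩

/-- The vertices waiting along a path. -/
def pend (L : List (Ent V)) : List V := L.filterMap Ent.o

/-- The total number of mountains accounted for along a path. -/
def hsum (L : List (Ent V)) : ℕ := (L.map Ent.h).sum

theorem pend_append (L M : List (Ent V)) : pend (L ++ M) = pend L ++ pend M := by simp [pend]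

theorem pend_cons (p : Ent V) (L : List (Ent V)) : pend (p :: L) = p.o.toList ++ pend L := by
  unfold pend
  cases hp : p.o with
  | none => rw [List.filterMap_cons_none hp]; rfl
  | some x => rw [List.filterMap_cons_some hp]; rfl

theorem hsum_append (L M : List (Ent V)) : hsum (L ++ M) = hsum L + hsum M := by simp [hsum]

theorem hsum_cons (p : Ent V) (L : List (Ent V)) : hsum (p :: L) = p.h + hsum L := by simp [hsum]

/-- Joining `v` to the part of the outer path on its left. -/
theorem Dr.left {A C : List (Ent V)} {a v : Ent V} (Q : List (Ent V)) : ∀ {E : Set (Sym2 V)}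
    {W : Finset V} {β : ℕ} {u : Ent V}, Dr E W β (A ++ a :: Q ++ u :: v :: C) →
    (∀ x ∈ pend (a :: Q), x ∉ W) → (pend (a :: Q)).Nodup →
    ∃ E' W' β' h', Dr E' W' β' (A ++ ⟨a.u, h', false, none⟩ :: v :: C) ∧ E ⊆ E' ∧
      (∀ w, w ∈ W' ↔ w ∈ W ∨ w ∈ pend (a :: Q)) ∧ 1 ≤ h' ∧ β' + h' ≤ β + hsum (a :: Q) + 1 ∧
      Good E' v.u (a :: Q ++ [u]) := by
  induction Q using List.reverseRecOn with
  | nil =>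
    intro E W β u h hx hn
    obtain ⟨E', W', β', h', h1, h2, h3, h4, h5, h6, h7⟩ := Dr.cov (P := A) (x := a) (y := u)
      (z := v) (Q := C) (by simpa using h) a.o (fun w hw => hx w (by simp [pend_cons, Option.mem_def.1 hw]))
    refine ⟨E', W', β', h', h1, h2, fun w => ?_, h4, by simpa [hsum] using h5, ?_⟩
    · rw [h3]; simp [pend]
    · exact List.isChain_cons_cons.2 ⟨⟨h6, h7⟩, List.isChain_singleton _⟩
  | append_singleton Q q ih =>
    intro E W β u h hx hn
    have hp : pend (a :: (Q ++ [q])) = pend (a :: Q) ++ q.o.toList := by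
      rw [← List.cons_append, pend_append, pend_cons q]; simp [pend]
    rw [hp] at hx hn ⊢
    obtain ⟨E', W', β', h', h1, h2, h3, h4, h5, h6, h7⟩ := Dr.cov (P := A ++ a :: Q) (x := q)
      (y := u) (z := v) (Q := C) (by simpa using h) q.o (fun w hw => hx w (by simp_all))
    obtain ⟨E'', W'', β'', h'', g1, g2, g3, g4, g5, g6⟩ := ih (by simpa using h1) (by
      intro x hxp hxW
      rcases (h3 x).1 hxW with h | h
      · exact hx x (by simp [hxp]) h
      · exact (List.nodup_append.1 hn).2.2 x hxp x (by simpa using h) rfl)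
      (List.nodup_append.1 hn).1
    refine ⟨E'', W'', β'', h'', g1, h2.trans g2, fun w => ?_, g4, ?_, ?_⟩
    · rw [g3, h3, List.mem_append, Option.mem_toList]; tauto
    · rw [← List.cons_append, hsum_append, hsum_cons q]
      simp only [hsum, List.map_nil, List.sum_nil] at g5 ⊢
      lia
    · have : a :: (Q ++ [q]) ++ [u] = (a :: Q) ++ q :: [u] := by simp
      rw [this]
      exact g6.append (List.isChain_cons_cons.2
        ⟨⟨g2 h6, fun x hx => ⟨g2 (h7 x hx).1, g2 (h7 x hx).2.1, g2 (h7 x hx).2.2⟩⟩,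
          List.isChain_singleton _⟩) rfl

theorem exists_cons_eq {α : Type} (Q C : List α) (b : α) :
    ∃ r R R', Q ++ b :: C = r :: R ∧ Q ++ [b] = r :: R' := by
  cases Q with
  | nil => exact ⟨b, C, [], rfl, rfl⟩
  | cons q Q => exact ⟨q, _, _, rfl, rfl⟩

/-- Joining `v` to the part of the outer path on its right, where every vertex that gets covered
has a mountain. -/
theorem Dr.right {A C : List (Ent V)} {b : Ent V} (Q : List (Ent V)) : ∀ {E : Set (Sym2 V)}
    {W : Finset V} {β : ℕ} {v : Ent V}, Dr E W β (A ++ v :: (Q ++ b :: C)) →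
    (∀ q ∈ (Q ++ [b]).head?, s(v.u, q.u) ∈ E) →
    (∀ x ∈ pend Q, x ∉ W) → (pend Q).Nodup → (∀ q ∈ Q, 1 ≤ q.h) → v.o = none →
    ∃ E' W' β' h' k', Dr E' W' β' (A ++ ⟨v.u, h', k', none⟩ :: b :: C) ∧ E ⊆ E' ∧
      (∀ w, w ∈ W' ↔ w ∈ W ∨ w ∈ pend Q) ∧ β' + h' ≤ β + v.h + hsum Q ∧
      Good E' v.u (Q ++ [b]) ∧ s(v.u, b.u) ∈ E' ∧ (Q ≠ [] → k' = false ∧ 1 ≤ h') ∧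
      (Q = [] → h' = v.h ∧ k' = v.k) := by
  induction Q with
  | nil =>
    intro E W β v h hE hx hn hh hv
    refine ⟨E, W, β, v.h, v.k, ?_, subset_rfl, by simp [pend], by simp [hsum],
      List.isChain_singleton _, hE b (by simp), by simp, by simp⟩
    rw [← hv]
    exact h
  | cons q Q ih =>
    intro E W β v h hE hx hn hh hv
    rw [pend_cons] at hx hn
    obtain ⟨r, R, R', hR, hR'⟩ := exists_cons_eq Q C b
    rw [List.cons_append, hR] at h
    obtain ⟨E', W', β', h', h1, h2, h3, h4, h5, h6, h7⟩ := h.cov q.o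
      (fun w hw => hx w (by simp_all))
    rw [← hR] at h1
    obtain ⟨E'', W'', β'', h'', k'', g1, g2, g3, g4, g5, g6, g7, g8⟩ := ih h1 (by
      rw [hR']; simpa using h6) (by
      intro x hxp hxW
      rcases (h3 x).1 hxW with h | h
      · exact hx x (by simp [hxp]) h
      · exact (List.nodup_append.1 hn).2.2 x (by simpa using h) x hxp rfl)
      (List.nodup_append.1 hn).2.1 (fun p hp => hh p (by simp [hp])) rfl
    have hq := hh q (by simp)
    refine ⟨E'', W'', β'', h'', k'', g1, h2.trans g2, fun w => ?_, ?_, ?_, g6, fun _ => ?_,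
      by simp⟩
    · rw [g3, h3, pend_cons, List.mem_append, Option.mem_toList]; tauto
    · rw [hsum_cons]; dsimp only at g4; lia
    · unfold Good at g5 ⊢
      rw [List.cons_append, hR', List.isChain_cons_cons, ← hR']
      refine ⟨⟨?_, fun x hx => ?_⟩, g5⟩
      · rw [Sym2.eq_swap]
        exact g2 (h2 (hE q (by simp)))
      · rw [Sym2.eq_swap (a := q.u), Sym2.eq_swap (a := x) (b := v.u)]
        exact ⟨g2 (h7 x hx).2.1, g2 (h7 x hx).2.2, g2 (h7 x hx).1⟩
    · by_cases hQ : Q = []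
      · rw [(g8 hQ).1, (g8 hQ).2]
        exact ⟨rfl, h4⟩
      · exact g7 hQ

end ArcDual

namespace ArcDual

variable {V : Type} [Fintype V] [DecidableEq V]

/-- Joining `v` to the part of the outer path on its right, where all edges that get covered
are pockets. -/
theorem Dr.rightPockets {A C : List (Ent V)} {b : Ent V} {β : ℕ} (Q : List (Ent V)) :
    ∀ {E : Set (Sym2 V)} {W : Finset V} {v : Ent V}, Dr E W β (A ++ v :: (Q ++ b :: C)) →
    (∀ q ∈ (Q ++ [b]).head?, s(v.u, q.u) ∈ E) →
    (∀ x ∈ pend Q, x ∉ W) → (pend Q).Nodup → (∀ q ∈ Q, q.k = true) → v.o = none →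
    ∃ E' W' h' k', Dr E' W' β (A ++ ⟨v.u, h', k', none⟩ :: b :: C) ∧ E ⊆ E' ∧
      (∀ w, w ∈ W' ↔ w ∈ W ∨ w ∈ pend Q) ∧ Good E' v.u (Q ++ [b]) ∧ s(v.u, b.u) ∈ E' := by
  induction Q with
  | nil =>
    intro E W v h hE hx hn hh hv
    refine ⟨E, W, v.h, v.k, ?_, subset_rfl, by simp [pend],
      List.isChain_singleton _, hE b (by simp)⟩
    rw [← hv]
    exact h
  | cons q Q ih =>
    intro E W v h hE hx hn hh hv
    rw [pend_cons] at hx hn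
    obtain ⟨r, R, R', hR, hR'⟩ := exists_cons_eq Q C b
    rw [List.cons_append, hR] at h
    obtain ⟨E', W', h', h1, h2, h3, h6, h7⟩ : ∃ E' W' h',
        Dr E' W' β (A ++ ⟨v.u, h', false, none⟩ :: r :: R) ∧ E ⊆ E' ∧
        (∀ w, w ∈ W' ↔ w ∈ W ∨ w ∈ q.o) ∧ s(v.u, r.u) ∈ E' ∧
        ∀ w ∈ q.o, s(v.u, w) ∈ E' ∧ s(w, q.u) ∈ E' ∧ s(w, r.u) ∈ E' := by
      cases hqo : q.o with
      | none =>
        exact ⟨_, W, v.h + 1, h.cover none, Set.subset_insert _ _, by simp, Or.inl rfl, by simp⟩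
      | some w =>
        have hw : w ∉ W := hx w (by simp [hqo])
        have h1 := Dr.insPocket (P := A ++ [v]) (x := q) (y := r) (Q := R) (by simpa using h) hw
          (hh q (by simp))
        have h2 := Dr.cover (P := A) (x := v) (y := ⟨q.u, 0, true, none⟩)
          (z := ⟨w, 0, true, none⟩) (Q := r :: R) (by simpa using h1) none
        have h3 := h2.cover none
        refine ⟨_, _, _, h3, fun e he => Or.inr (Or.inr (Or.inr (Or.inr he))), fun u => ?_,
          Or.inl rfl, ?_⟩
        · simp only [Finset.mem_insert, Option.mem_def, Option.some.injEq]
          rw [eq_comm (a := w)]; tauto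
        · rintro u ⟨⟩
          rw [Sym2.eq_swap (a := w) (b := q.u)]
          exact ⟨by simp, by simp, by simp⟩
    rw [← hR] at h1
    obtain ⟨E'', W'', h'', k'', g1, g2, g3, g5, g6⟩ := ih h1 (by
      rw [hR']; simpa using h6) (by
      intro x hxp hxW
      rcases (h3 x).1 hxW with h | h
      · exact hx x (by simp [hxp]) h
      · exact (List.nodup_append.1 hn).2.2 x (by simpa using h) x hxp rfl)
      (List.nodup_append.1 hn).2.1 (fun p hp => hh p (by simp [hp])) rfl
    refine ⟨E'', W'', h'', k'', g1, h2.trans g2, fun w => ?_, ?_, g6⟩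
    · rw [g3, h3, pend_cons, List.mem_append, Option.mem_toList]; tauto
    · unfold Good at g5 ⊢
      rw [List.cons_append, hR', List.isChain_cons_cons, ← hR']
      refine ⟨⟨?_, fun x hx => ?_⟩, g5⟩
      · rw [Sym2.eq_swap]
        exact g2 (h2 (hE q (by simp)))
      · rw [Sym2.eq_swap (a := q.u), Sym2.eq_swap (a := x) (b := v.u)]
        exact ⟨g2 (h7 x hx).2.1, g2 (h7 x hx).2.2, g2 (h7 x hx).1⟩

/-- A new vertex `v` is drawn on a pocket and joined to the path on its right, which consists of
pockets. -/
theorem Dr.placePockets {A C Q : List (Ent V)} {b p : Ent V} {β : ℕ} {E : Set (Sym2 V)}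
    {W : Finset V} {v : V} (h : Dr E W β (A ++ p :: (Q ++ b :: C))) (hv : v ∉ W)
    (hx : ∀ x ∈ pend (p :: Q), x ∉ W) (hn : (v :: pend (p :: Q)).Nodup) (hp : p.k = true)
    (hQ : ∀ q ∈ Q, q.k = true) :
    ∃ E' W' h' k', Dr E' W' β (A ++ ⟨p.u, 0, true, none⟩ :: ⟨v, h', k', none⟩ :: b :: C) ∧ E ⊆ E' ∧
      (∀ w, w ∈ W' ↔ w ∈ W ∨ w = v ∨ w ∈ pend (p :: Q)) ∧ Good E' v (p :: Q ++ [b]) ∧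
      s(v, b.u) ∈ E' := by
  obtain ⟨r, R, R', hR, hR'⟩ := exists_cons_eq Q C b
  rw [pend_cons] at hx hn
  rw [hR] at h
  obtain ⟨E', W', h', k', h1, h2, h3, h5, h6, h7⟩ : ∃ E' W' h' k',
      Dr E' W' β (A ++ ⟨p.u, 0, true, none⟩ :: ⟨v, h', k', none⟩ :: r :: R) ∧ E ⊆ E' ∧
      (∀ w, w ∈ W' ↔ w ∈ W ∨ w = v ∨ w ∈ p.o) ∧ s(p.u, v) ∈ E' ∧ s(v, r.u) ∈ E' ∧
      ∀ w ∈ p.o, s(p.u, w) ∈ E' ∧ s(w, r.u) ∈ E' ∧ s(w, v) ∈ E' := by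
    cases hpo : p.o with
    | none =>
      refine ⟨_, _, _, _, h.insPocket hv hp, fun e he => Or.inr (Or.inr he), fun w => ?_,
        by simp, by simp, by simp⟩
      simp [or_comm]
    | some y =>
      have hy : y ∉ W := hx y (by simp [hpo])
      have hyv : v ≠ y := by
        rintro rfl; simp [hpo] at hn
      have h1 := h.insPocket hy hp
      have h2 := h1.insPocket (v := v) (by simp [hyv, hv]) rfl
      have h3 := Dr.cover (P := A ++ [⟨p.u, 0, true, none⟩]) (x := ⟨v, 0, true, none⟩)
        (y := ⟨y, 0, true, none⟩) (z := r) (Q := R) (by simpa using h2) none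
      rw [List.append_assoc] at h3
      refine ⟨_, _, _, _, h3,
        fun e he => Or.inr (Or.inr (Or.inr (Or.inr (Or.inr he)))), fun w => ?_,
        by simp, by simp, ?_⟩
      · simp only [Finset.mem_insert, Option.mem_def, Option.some.injEq]
        rw [eq_comm (a := y)]; tauto
      · rintro u ⟨⟩
        rw [Sym2.eq_swap (a := y) (b := v)]
        exact ⟨by simp, by simp, by simp⟩
  rw [← hR] at h1
  obtain ⟨E'', W'', h'', k'', g1, g2, g3, g5, g6⟩ := Dr.rightPockets
    (A := A ++ [⟨p.u, 0, true, none⟩]) Q (by simpa using h1) (by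
    rw [hR']; simpa using h6) (by
    intro x hxp hxW
    rcases (h3 x).1 hxW with h | h | h
    · exact hx x (by simp [hxp]) h
    · subst h; simp [hxp] at hn
    · exact (List.nodup_append.1 (List.nodup_cons.1 hn).2).2.2 x (by simpa using h) x hxp rfl)
    (List.nodup_append.1 (List.nodup_cons.1 hn).2).2.1 hQ rfl
  refine ⟨E'', W'', h'', k'', by simpa using g1, h2.trans g2, fun w => ?_, ?_, g6⟩
  · rw [g3, h3, pend_cons, List.mem_append, Option.mem_toList]; tauto
  · unfold Good at g5 ⊢
    rw [List.cons_append, hR', List.isChain_cons_cons, ← hR']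
    exact ⟨⟨g2 h5, fun x hx => ⟨g2 (h7 x hx).1, g2 (h7 x hx).2.1, g2 (h7 x hx).2.2⟩⟩, g5⟩

/-- A new vertex `v` is drawn on a pocket and joined to the path on its right, which consists of
mountains. -/
theorem Dr.placeMountains {A C Q : List (Ent V)} {b p : Ent V} {β : ℕ} {E : Set (Sym2 V)}
    {W : Finset V} {v : V} (h : Dr E W β (A ++ p :: (Q ++ b :: C))) (hv : v ∉ W)
    (hx : ∀ x ∈ pend (p :: Q), x ∉ W) (hn : (v :: pend (p :: Q)).Nodup) (hp : p.k = true)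
    (hQ : ∀ q ∈ Q, 1 ≤ q.h) :
    ∃ E' W' β' h' k' hp' kp',
      Dr E' W' β' (A ++ ⟨p.u, hp', kp', none⟩ :: ⟨v, h', k', none⟩ :: b :: C) ∧ E ⊆ E' ∧ (∀ w, w ∈ W' ↔ w ∈ W ∨ w = v ∨ w ∈ pend (p :: Q)) ∧ Good E' v (p :: Q ++ [b]) ∧
      s(v, b.u) ∈ E' ∧ β' + h' ≤ β + hsum Q ∧ (Q ≠ [] → k' = false ∧ 1 ≤ h') ∧
      (Q = [] → h' = 0 ∧ k' = true) ∧ (hp' = 0 ∧ kp' = true ∨ hp' = 1 ∧ kp' = false) := by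
  obtain ⟨r, R, R', hR, hR'⟩ := exists_cons_eq Q C b
  rw [pend_cons] at hx hn
  rw [hR] at h
  obtain ⟨E', W', hp', kp', h1, h2, h3, h5, h6, h7, h8⟩ : ∃ E' W' hp' kp',
      Dr E' W' β (A ++ ⟨p.u, hp', kp', none⟩ :: ⟨v, 0, true, none⟩ :: r :: R) ∧ E ⊆ E' ∧
      (∀ w, w ∈ W' ↔ w ∈ W ∨ w = v ∨ w ∈ p.o) ∧ s(p.u, v) ∈ E' ∧ s(v, r.u) ∈ E' ∧
      (∀ w ∈ p.o, s(p.u, w) ∈ E' ∧ s(w, r.u) ∈ E' ∧ s(w, v) ∈ E') ∧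
      (hp' = 0 ∧ kp' = true ∨ hp' = 1 ∧ kp' = false) := by
    cases hpo : p.o with
    | none =>
      refine ⟨_, _, _, _, h.insPocket hv hp, fun e he => Or.inr (Or.inr he), fun w => ?_,
        by simp, by simp, by simp, Or.inl ⟨rfl, rfl⟩⟩
      simp [or_comm]
    | some y =>
      have hy : y ∉ W := hx y (by simp [hpo])
      have hyv : v ≠ y := by
        rintro rfl; simp [hpo] at hn
      have h1 := h.insPocket hy hp
      have h2 := Dr.insPocket (P := A ++ [⟨p.u, 0, true, none⟩]) (x := ⟨y, 0, true, none⟩)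
        (y := r) (Q := R) (by simpa using h1) (v := v) (by simp [hyv, hv]) rfl
      have h3 := Dr.cover (P := A) (x := ⟨p.u, 0, true, none⟩) (y := ⟨y, 0, true, none⟩)
        (z := ⟨v, 0, true, none⟩) (Q := r :: R) (by simpa using h2) none
      refine ⟨_, _, _, _, h3,
        fun e he => Or.inr (Or.inr (Or.inr (Or.inr (Or.inr he)))), fun w => ?_,
        by simp, by simp, ?_, Or.inr ⟨rfl, rfl⟩⟩
      · simp only [Finset.mem_insert, Option.mem_def, Option.some.injEq]
        rw [eq_comm (a := y)]; tauto
      · rintro u ⟨⟩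
        exact ⟨by simp, by simp, by simp⟩
  rw [← hR] at h1
  obtain ⟨E'', W'', β'', h'', k'', g1, g2, g3, g4, g5, g6, g7, g8⟩ := Dr.right
    (A := A ++ [⟨p.u, hp', kp', none⟩]) Q (by simpa using h1) (by
    rw [hR']; simpa using h6) (by
    intro x hxp hxW
    rcases (h3 x).1 hxW with h | h | h
    · exact hx x (by simp [hxp]) h
    · subst h; simp [hxp] at hn
    · exact (List.nodup_append.1 (List.nodup_cons.1 hn).2).2.2 x (by simpa using h) x hxp rfl)
    (List.nodup_append.1 (List.nodup_cons.1 hn).2).2.1 hQ rfl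
  refine ⟨E'', W'', β'', h'', k'', hp', kp', by simpa using g1, h2.trans g2, fun w => ?_, ?_, g6,
    by simpa using g4, g7, g8, h8⟩
  · rw [g3, h3, pend_cons, List.mem_append, Option.mem_toList]; tauto
  · unfold Good at g5 ⊢
    rw [List.cons_append, hR', List.isChain_cons_cons, ← hR']
    exact ⟨⟨g2 h5, fun x hx => ⟨g2 (h7 x hx).1, g2 (h7 x hx).2.1, g2 (h7 x hx).2.2⟩⟩, g5⟩

end ArcDual

namespace ArcDual

variable {V : Type} [Fintype V] [DecidableEq V]

theorem exists_last_flag (c : Bool) (L : List (Ent V)) : (∀ p ∈ L, p.k = !c) ∨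
    ∃ l₁ p l₂, L = l₁ ++ p :: l₂ ∧ p.k = c ∧ ∀ q ∈ l₂, q.k = !c := by
  induction L with
  | nil => simp
  | cons a L ih =>
    rcases ih with ih | ⟨l₁, p, l₂, rfl, h1, h2⟩
    · by_cases ha : a.k = c
      · exact Or.inr ⟨[], a, L, rfl, ha, ih⟩
      · left
        intro p hp
        rcases List.mem_cons.1 hp with rfl | hp
        · exact Bool.eq_not_of_ne ha
        · exact ih p hp
    · exact Or.inr ⟨a :: l₁, p, l₂, rfl, h1, h2⟩

/-- A new vertex `v` is drawn on the last pocket of its segment of the outer path. -/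
theorem Dr.addAtPocket {A C l₁ l₂ : List (Ent V)} {a b p : Ent V} {β : ℕ} {E : Set (Sym2 V)}
    {W : Finset V} {v : V} (h : Dr E W β (A ++ (l₁ ++ p :: l₂) ++ b :: C))
    (ha : ∀ q ∈ (l₁ ++ p :: l₂).head?, q = a) (hv : v ∉ W)
    (hx : ∀ x ∈ pend (l₁ ++ p :: l₂), x ∉ W) (hn : (v :: pend (l₁ ++ p :: l₂)).Nodup)
    (hp : p.k = true) (hQ : ∀ q ∈ l₂, 1 ≤ q.h) :
    ∃ E' W' β' ha ka hv kv, Dr E' W' β' (A ++ ⟨a.u, ha, ka, none⟩ :: ⟨v, hv, kv, none⟩ :: b :: C) ∧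
      E ⊆ E' ∧ (∀ w, w ∈ W' ↔ w ∈ W ∨ w = v ∨ w ∈ pend (l₁ ++ p :: l₂)) ∧
      Good E' v (l₁ ++ p :: l₂ ++ [b]) ∧ s(v, b.u) ∈ E' ∧
      (ka = false → 1 ≤ ha) ∧ (kv = false → 1 ≤ hv) ∧
      β' + ha + hv ≤ β + hsum (l₁ ++ p :: l₂) + 1 ∧
      (ka = false ∨ β' + ha + hv ≤ β + hsum (l₁ ++ p :: l₂)) ∧ (l₂ ≠ [] → 1 ≤ hv) := by
  rw [pend_append] at hx hn
  have hn1 := (List.nodup_cons.1 hn).1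
  have hn2 := List.nodup_append.1 (List.nodup_cons.1 hn).2
  simp only [List.mem_append, not_or] at hn1
  obtain ⟨E', W', β', h', k', hp', kp', h1, h2, h3, h4, h5, h6, h7, h8, h9⟩ := Dr.placeMountains
    (A := A ++ l₁) (p := p) (Q := l₂) (b := b) (C := C) (v := v) (by simpa using h) hv
    (fun x hx' => hx x (by simp [hx'])) (List.nodup_cons.2 ⟨hn1.2, hn2.2.1⟩) hp hQ
  have hk' : k' = false → 1 ≤ h' := by
    intro hk
    by_cases hQ' : l₂ = []
    · rw [(h8 hQ').2] at hk; exact absurd hk (by simp)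
    · exact (h7 hQ').2
  cases l₁ with
  | nil =>
    obtain rfl : p = a := ha p (by simp)
    rw [List.nil_append] at *
    rw [List.append_nil] at h1
    refine ⟨E', W', β', hp', kp', h', k', h1, h2, h3, h4, h5, ?_, hk', ?_, ?_,
      fun h => (h7 h).2⟩
    · rcases h9 with h9 | h9 <;> simp [h9]
    · rw [hsum_cons]; lia
    · rw [hsum_cons]
      rcases h9 with h9 | h9
      · right; lia
      · exact Or.inl h9.2
  | cons a' Q =>
    obtain rfl : a' = a := ha a' (by simp)
    obtain ⟨E'', W'', β'', h'', g1, g2, g3, g4, g5, g6⟩ := Dr.left (A := A) (a := a') Q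
      (u := ⟨p.u, hp', kp', none⟩) (v := ⟨v, h', k', none⟩) (C := b :: C)
      (by simpa using h1) (by
        intro x hxp hxW
        rcases (h3 x).1 hxW with h | h | h
        · exact hx x (List.mem_append_left _ hxp) h
        · subst h; exact hn1.1 hxp
        · exact hn2.2.2 x hxp x h rfl) hn2.1
    refine ⟨E'', W'', β'', h'', false, h', k', g1, h2.trans g2, fun w => ?_, ?_, g2 h5,
      fun _ => g4, hk', ?_, Or.inl rfl, fun h => (h7 h).2⟩
    · rw [g3, h3, pend_append, List.mem_append]; tauto
    · rw [List.append_assoc, List.cons_append]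
      exact g6.append (h4.mono g2) rfl
    · rw [hsum_append, hsum_cons p]; lia

/-- A new vertex `v` is drawn next to the first vertex of its segment of the outer path, where
the segment consists of mountains. -/
theorem Dr.addAtMountain {A C M : List (Ent V)} {a b : Ent V} {β : ℕ} {E : Set (Sym2 V)}
    {W : Finset V} {v : V} (h : Dr E W β (A ++ a :: M ++ b :: C)) (hv : v ∉ W)
    (hx : ∀ x ∈ pend (a :: M), x ∉ W) (hn : (v :: pend (a :: M)).Nodup)
    (hQ : ∀ q ∈ M, 1 ≤ q.h) :
    ∃ E' W' β' hv, Dr E' W' β' (A ++ ⟨a.u, 0, true, none⟩ :: ⟨v, hv, false, none⟩ :: b :: C) ∧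
      E ⊆ E' ∧ (∀ w, w ∈ W' ↔ w ∈ W ∨ w = v ∨ w ∈ pend (a :: M)) ∧
      Good E' v (a :: M ++ [b]) ∧ s(v, b.u) ∈ E' ∧ 1 ≤ hv ∧
      β' + hv ≤ β + hsum (a :: M) + 1 := by
  rw [pend_cons] at hx hn
  have hn1 := (List.nodup_cons.1 hn).1
  have hn2 := List.nodup_append.1 (List.nodup_cons.1 hn).2
  simp only [List.mem_append, not_or] at hn1
  obtain ⟨r, R, R', hR, hR'⟩ := exists_cons_eq M C b
  rw [List.append_assoc, List.cons_append, hR] at h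
  obtain ⟨E', W', h1, h2, h3, h5, h6, h7⟩ : ∃ E' W',
      Dr E' W' (β + a.h) (A ++ ⟨a.u, 0, true, none⟩ :: ⟨v, 1, false, none⟩ :: r :: R) ∧ E ⊆ E' ∧
      (∀ w, w ∈ W' ↔ w ∈ W ∨ w = v ∨ w ∈ a.o) ∧ s(a.u, v) ∈ E' ∧ s(v, r.u) ∈ E' ∧
      (∀ w ∈ a.o, s(a.u, w) ∈ E' ∧ s(w, r.u) ∈ E' ∧ s(w, v) ∈ E') := by
    cases hao : a.o with
    | none =>
      refine ⟨_, _, h.insMountain hv, fun e he => Or.inr (Or.inr he), fun w => ?_,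
        by simp, by simp, by simp⟩
      simp [or_comm]
    | some y =>
      have hy : y ∉ W := hx y (by simp [hao])
      have hyv : v ≠ y := by
        rintro rfl; simp [hao] at hn
      have h1 := h.insMountain hy
      have h2 := h1.insPocket (v := v) (by simp [hyv, hv]) rfl
      have h3 := Dr.cover (P := A ++ [⟨a.u, 0, true, none⟩]) (x := ⟨v, 0, true, none⟩)
        (y := ⟨y, 1, false, none⟩) (z := r) (Q := R) (by simpa using h2) none
      rw [List.append_assoc] at h3
      refine ⟨_, _, h3, fun e he => Or.inr (Or.inr (Or.inr (Or.inr (Or.inr he)))), fun w => ?_,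
        by simp, by simp, ?_⟩
      · simp only [Finset.mem_insert, Option.mem_def, Option.some.injEq]
        rw [eq_comm (a := y)]; tauto
      · rintro u ⟨⟩
        rw [Sym2.eq_swap (a := y) (b := v)]
        exact ⟨by simp, by simp, by simp⟩
  rw [← hR] at h1
  obtain ⟨E'', W'', β'', h'', k'', g1, g2, g3, g4, g5, g6, g7, g8⟩ := Dr.right
    (A := A ++ [⟨a.u, 0, true, none⟩]) M (by simpa using h1) (by
    rw [hR']; simpa using h6) (by
    intro x hxp hxW
    rcases (h3 x).1 hxW with h | h | h
    · exact hx x (by simp [hxp]) h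
    · subst h; exact hn1.2 hxp
    · exact hn2.2.2 x (by simpa using h) x hxp rfl) hn2.2.1 hQ rfl
  have hk : k'' = false ∧ 1 ≤ h'' := by
    by_cases hM : M = []
    · simp [g8 hM]
    · exact g7 hM
  rw [hk.1] at g1
  refine ⟨E'', W'', β'', h'', by simpa using g1, h2.trans g2, fun w => ?_, ?_, g6, hk.2, ?_⟩
  · rw [g3, h3, pend_cons, List.mem_append, Option.mem_toList]; tauto
  · unfold Good at g5 ⊢
    rw [List.cons_append, hR', List.isChain_cons_cons, ← hR']
    exact ⟨⟨g2 h5, fun x hx => ⟨g2 (h7 x hx).1, g2 (h7 x hx).2.1, g2 (h7 x hx).2.2⟩⟩, g5⟩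
  · rw [hsum_cons]; dsimp only at g4; lia

/-- A new vertex `v` is drawn above the segment `a :: M ++ [b]` of the outer path. -/
theorem Dr.add {A C M : List (Ent V)} {a b : Ent V} {β : ℕ} {E : Set (Sym2 V)}
    {W : Finset V} {v : V} (h : Dr E W β (A ++ a :: M ++ b :: C)) (hv : v ∉ W)
    (hx : ∀ x ∈ pend (a :: M), x ∉ W) (hn : (v :: pend (a :: M)).Nodup)
    (hQ : ∀ q ∈ a :: M, q.k = false → 1 ≤ q.h) :
    ∃ E' W' β' ha ka hv kv, Dr E' W' β' (A ++ ⟨a.u, ha, ka, none⟩ :: ⟨v, hv, kv, none⟩ :: b :: C) ∧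
      E ⊆ E' ∧ (∀ w, w ∈ W' ↔ w ∈ W ∨ w = v ∨ w ∈ pend (a :: M)) ∧
      Good E' v (a :: M ++ [b]) ∧ s(v, b.u) ∈ E' ∧
      (ka = false → 1 ≤ ha) ∧ (kv = false → 1 ≤ hv) ∧
      β' + ha + hv ≤ β + hsum (a :: M) + 1 ∧
      (ka = false ∨ kv = false ∨ β' + ha + hv ≤ β + hsum (a :: M)) := by
  rcases exists_last_flag true (a :: M) with hf | ⟨l₁, p, l₂, hl, hp, hf⟩
  · obtain ⟨E', W', β', h', h1, h2, h3, h4, h5, h6, h7⟩ := h.addAtMountain hv hx hn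
      (fun q hq => hQ q (by simp [hq]) (hf q (by simp [hq])))
    exact ⟨E', W', β', 0, true, h', false, h1, h2, h3, h4, h5, by simp, fun _ => h6, by lia,
      Or.inr (Or.inl rfl)⟩
  · rw [hl] at hx hn h hQ ⊢
    obtain ⟨E', W', β', ha, ka, hv, kv, h1, h2, h3, h4, h5, h6, h7, h8, h9, -⟩ :=
      h.addAtPocket (a := a) (by rw [← hl]; simp) hv hx hn hp
        (fun q hq => hQ q (by simp [hq]) (hf q hq))
    exact ⟨E', W', β', ha, ka, hv, kv, h1, h2, h3, h4, h5, h6, h7, h8,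
      h9.imp_right Or.inr⟩

/-- The last vertex `v` is drawn above the whole outer path, which starts with a pocket. -/
theorem Dr.addLast {M : List (Ent V)} {a b : Ent V} {β : ℕ} {E : Set (Sym2 V)}
    {W : Finset V} {v : V} (h : Dr E W β (a :: M ++ [b])) (hv : v ∉ W)
    (hx : ∀ x ∈ pend (a :: M), x ∉ W) (hn : (v :: pend (a :: M)).Nodup)
    (hQ : ∀ q ∈ a :: M, q.k = false → 1 ≤ q.h) (ha : a.k = true) :
    ∃ E' W' β' L', Dr E' W' β' L' ∧ E ⊆ E' ∧ (∀ w, w ∈ W' ↔ w ∈ W ∨ w = v ∨ w ∈ pend (a :: M)) ∧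
      Good E' v (a :: M ++ [b]) ∧ s(v, b.u) ∈ E' ∧ β' ≤ β + hsum (a :: M) ∧
      ((∃ p ∈ a :: M, p.k = false) → β' + 1 ≤ β + hsum (a :: M)) := by
  rcases exists_last_flag false (a :: M) with hf | ⟨l₁, m, l₂, hl, hm, hf⟩
  · obtain ⟨E', W', h', k', h1, h2, h3, h4, h5⟩ := Dr.placePockets (A := []) (Q := M)
      (by simpa using h) hv hx hn (by simpa using ha) (fun q hq => hf q (by simp [hq]))
    refine ⟨E', W', β, _, h1, h2, h3, h4, h5, by lia, ?_⟩
    rintro ⟨p, hp, hpk⟩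
    have := hf p hp
    simp [hpk] at this
  cases l₂ with
  | nil =>
    rcases exists_last_flag true (a :: M) with hf' | ⟨j₁, p, j₂, hj, hp, hf'⟩
    · have := hf' a (by simp)
      simp [ha] at this
    · have hj₂ : j₂ ≠ [] := by
        rintro rfl
        have := hl.symm.trans hj
        have h' := congrArg List.getLast? this
        simp at h'
        rw [h', hp] at hm
        exact absurd hm (by simp)
      rw [hj] at hx hn h hQ ⊢
      obtain ⟨E', W', β', ha, ka, hv, kv, h1, h2, h3, h4, h5, h6, h7, h8, h9, h10⟩ :=
        Dr.addAtPocket (A := []) (a := a) (by simpa using h) (by rw [← hj]; simp) hv hx hn hp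
          (fun q hq => hQ q (by simp [hq]) (hf' q hq))
      have h10 := h10 hj₂
      have hle : β' + 1 ≤ β + hsum (j₁ ++ p :: j₂) := by
        rcases h9 with h9 | h9
        · have := h6 h9; lia
        · lia
      exact ⟨E', W', β', _, h1, h2, h3, h4, h5, by lia, fun _ => hle⟩
  | cons p R =>
    have hmh : 1 ≤ m.h := hQ m (by rw [hl]; simp) hm
    rw [hl] at hx hn h ⊢
    have hpd : pend (l₁ ++ m :: p :: R) = pend l₁ ++ (m.o.toList ++ pend (p :: R)) := by
      rw [pend_append, pend_cons m]
    rw [hpd] at hx hn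
    have hn1 := (List.nodup_cons.1 hn).1
    have hn2 := List.nodup_append.1 (List.nodup_cons.1 hn).2
    have hn3 := List.nodup_append.1 hn2.2.1
    simp only [List.mem_append, not_or] at hn1
    obtain ⟨E', W', h', k', h1, h2, h3, h4, h5⟩ := Dr.placePockets (A := l₁ ++ [m]) (p := p)
      (Q := R) (b := b) (C := []) (v := v) (by simpa using h) hv
      (fun x hx' => hx x (by simp [hx'])) (List.nodup_cons.2 ⟨hn1.2.2, hn3.2.1⟩)
      (hf p (by simp)) (fun q hq => hf q (by simp [hq]))
    obtain ⟨E₁, W₁, hm', j1, j2, j3, j4, j5⟩ : ∃ E₁ W₁ hm',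
        Dr E₁ W₁ β (l₁ ++ ⟨m.u, hm', false, none⟩ :: ⟨v, h', k', none⟩ :: [b]) ∧ E' ⊆ E₁ ∧
        (∀ w, w ∈ W₁ ↔ w ∈ W' ∨ w ∈ m.o) ∧ s(m.u, v) ∈ E₁ ∧
        ∀ w ∈ m.o, s(m.u, w) ∈ E₁ ∧ s(w, p.u) ∈ E₁ ∧ s(w, v) ∈ E₁ := by
      cases hmo : m.o with
      | none =>
        exact ⟨_, W', _, Dr.cover (P := l₁) (by simpa using h1) none, Set.subset_insert _ _,
          by simp, by simp, by simp⟩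
      | some y =>
        have hy : y ∉ W' := by
          intro hy
          rcases (h3 y).1 hy with h | h | h
          · exact hx y (by simp [hmo]) h
          · subst h; simp [hmo] at hn1
          · exact hn3.2.2 y (by simp [hmo]) y h rfl
        have q1 := Dr.insPocket (P := l₁ ++ [m]) h1 hy rfl
        have q2 := Dr.cover (P := l₁) (x := m) (y := ⟨p.u, 0, true, none⟩)
          (z := ⟨y, 0, true, none⟩) (Q := ⟨v, h', k', none⟩ :: [b]) (by simpa using q1) none
        have q3 := q2.cover none
        refine ⟨_, _, _, q3, fun e he => Or.inr (Or.inr (Or.inr (Or.inr he))), fun w => ?_,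
          Or.inl rfl, ?_⟩
        · simp only [Finset.mem_insert, Option.mem_def, Option.some.injEq]
          rw [eq_comm (a := y)]; tauto
        · rintro u ⟨⟩
          rw [Sym2.eq_swap (a := y) (b := p.u)]
          exact ⟨by simp, by simp, by simp⟩
    have hgm : Good E₁ v (m :: (p :: R ++ [b])) :=
      List.isChain_cons_cons.2 ⟨⟨j4, j5⟩, h4.mono j2⟩
    cases l₁ with
    | nil =>
      refine ⟨E₁, W₁, β, _, j1, h2.trans j2, fun w => ?_, hgm, j2 h5, by lia, fun _ => ?_⟩
      · rw [j3, h3, hpd]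
        simp only [List.mem_append, Option.mem_toList, pend, List.filterMap_nil, List.not_mem_nil]
        tauto
      · rw [List.nil_append, hsum_cons]; lia
    | cons a' Q =>
      obtain ⟨E₂, W₂, β₂, h₂, g1, g2, g3, g4, g5, g6⟩ := Dr.left (A := []) (a := a') Q
        (u := ⟨m.u, hm', false, none⟩) (v := ⟨v, h', k', none⟩) (C := [b])
        (by simpa using j1) (by
          intro x hxp hxW
          rcases (j3 x).1 hxW with h | h
          · rcases (h3 x).1 h with h | h | h
            · exact hx x (List.mem_append_left _ hxp) h
            · subst h; exact hn1.1 hxp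
            · exact hn2.2.2 x hxp x (by simp [h]) rfl
          · exact hn2.2.2 x hxp x (by simp [Option.mem_def.1 h]) rfl) hn2.1
      refine ⟨E₂, W₂, β₂, _, g1, (h2.trans j2).trans g2, fun w => ?_, ?_, g2 (j2 h5), ?_,
        fun _ => ?_⟩
      · rw [g3, j3, h3, hpd, List.mem_append, List.mem_append, Option.mem_toList]; tauto
      · have : a' :: Q ++ m :: p :: R ++ [b] = (a' :: Q) ++ m :: (p :: R ++ [b]) := by simp
        rw [this]
        exact g6.append (hgm.mono g2) rfl
      · rw [hsum_append, hsum_cons m]; lia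
      · rw [hsum_append, hsum_cons m]; lia

end ArcDual

namespace ArcDual

variable {V : Type} [Fintype V] [DecidableEq V] {T : SimpleGraph V}

/-- The vertices of a path including the waiting ones. -/
def flat (L : List (Ent V)) : List V := L.flatMap fun p => p.u :: p.o.toList

theorem flat_append (L M : List (Ent V)) : flat (L ++ M) = flat L ++ flat M := by simp [flat]

theorem flat_cons (p : Ent V) (L : List (Ent V)) : flat (p :: L) = p.u :: p.o.toList ++ flat L := by
  simp [flat]

theorem pend_sublist_flat (L : List (Ent V)) : (pend L).Sublist (flat L) := by
  induction L with
  | nil => exact List.Sublist.refl _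
  | cons p L ih =>
    rw [pend_cons, flat_cons]
    exact (List.sublist_cons_self _ _).append ih

theorem mem_flat {L : List (Ent V)} {x : V} : x ∈ flat L ↔ (∃ p ∈ L, p.u = x) ∨ x ∈ pend L := by
  induction L with
  | nil => simp [flat, pend]
  | cons p L ih =>
    rw [flat_cons, pend_cons, List.mem_append, List.mem_cons, ih, List.mem_append]
    simp only [List.mem_cons, exists_eq_or_imp]
    rw [eq_comm (a := x)]
    generalize (∃ p ∈ L, p.u = x) = Q
    tauto

theorem flat_split {L : List (Ent V)} : ∀ {A R : List V} {a : V}, flat L = A ++ a :: R →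
    a ∉ pend L → ∃ LA p LC, L = LA ++ p :: LC ∧ flat LA = A ∧ p.u = a ∧ p.o.toList ++ flat LC = R := by
  induction L with
  | nil => intro A R a h; simp [flat] at h
  | cons e L ih =>
    intro A R a h ha
    rw [flat_cons] at h
    rw [pend_cons, List.mem_append, not_or] at ha
    cases A with
    | nil =>
      simp only [List.nil_append, List.cons_append, List.cons.injEq] at h
      exact ⟨[], e, L, rfl, rfl, h.1, h.2⟩
    | cons b A =>
      simp only [List.cons_append, List.cons.injEq] at h
      cases ho : e.o with
      | none =>
        rw [ho] at h
        obtain ⟨LA, p, LC, rfl, h1, h2, h3⟩ := ih (by simpa using h.2) ha.2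
        refine ⟨e :: LA, p, LC, rfl, ?_, h2, h3⟩
        rw [flat_cons, ho, h1, h.1]; simp
      | some x =>
        rw [ho] at h ha
        cases A with
        | nil =>
          simp at h ha
          exact absurd h.2.1.symm ha.1
        | cons c A =>
          simp only [Option.toList_some, List.cons_append, List.nil_append, List.cons.injEq] at h
          obtain ⟨LA, p, LC, rfl, h1, h2, h3⟩ := ih h.2.2 ha.2
          refine ⟨e :: LA, p, LC, rfl, ?_, h2, h3⟩
          rw [flat_cons, ho, h1, h.1, h.2.1]; simp

theorem exists_pair_of_mem_pend {R : Ent V → Ent V → Prop} {b : Ent V} {x : V} {S : List (Ent V)} :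
    (S ++ [b]).IsChain R → x ∈ pend S → ∃ p q, p ∈ S ∧ q ∈ S ++ [b] ∧ p.o = some x ∧ R p q := by
  induction S with
  | nil => simp [pend]
  | cons s S ih =>
    intro h hx
    rw [pend_cons, List.mem_append] at hx
    obtain ⟨r, R, R', hR, hR'⟩ := exists_cons_eq S [] b
    rw [List.cons_append, hR', List.isChain_cons_cons, ← hR'] at h
    rcases hx with hx | hx
    · exact ⟨s, r, by simp, by rw [List.cons_append, hR']; simp, by simpa using hx, h.1⟩
    · obtain ⟨p, q, hp, hq, h1, h2⟩ := ih h.2 hx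
      exact ⟨p, q, by simp [hp], List.mem_cons_of_mem _ hq, h1, h2⟩

theorem Good.edge_of_mem_flat {E : Set (Sym2 V)} {v w : V} {b : Ent V} {S : List (Ent V)}
    (h : Good E v (S ++ [b])) (hw : w ∈ flat S) : s(w, v) ∈ E := by
  rcases mem_flat.1 hw with ⟨p, hp, rfl⟩ | hw
  · clear hw
    induction S with
    | nil => simp at hp
    | cons s S ih =>
      obtain ⟨r, R, R', hR, hR'⟩ := exists_cons_eq S [] b
      unfold Good at h
      rw [List.cons_append, hR', List.isChain_cons_cons, ← hR'] at h
      rcases List.mem_cons.1 hp with rfl | hp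
      · exact h.1.1
      · exact ih h.2 hp
  · obtain ⟨p, q, -, -, h1, h2⟩ := exists_pair_of_mem_pend h hw
    exact (h2.2 w h1).2.2

theorem Dr.chain_ne {E : Set (Sym2 V)} {W : Finset V} {β : ℕ} {L : List (Ent V)}
    (h : Dr E W β L) : L.IsChain fun p q => p.u ≠ q.u := by
  obtain ⟨pos, c, h⟩ := h
  exact h.chain.imp fun p q hpq heq => absurd hpq.1 (by rw [heq]; exact lt_irrefl _)

theorem Dr.mem {E : Set (Sym2 V)} {W : Finset V} {β : ℕ} {L : List (Ent V)}
    (h : Dr E W β L) {p : Ent V} (hp : p ∈ L) : p.u ∈ W := by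
  obtain ⟨pos, c, h⟩ := h
  exact h.mem p hp

theorem isChain_replace {R : Ent V → Ent V → Prop} {A C : List (Ent V)} {a a' : Ent V}
    (h : (A ++ a :: C).IsChain R) (h1 : ∀ x, R x a → R x a') (h2 : ∀ x, R a x → R a' x) :
    (A ++ a' :: C).IsChain R := by
  rw [List.isChain_split] at h ⊢
  refine ⟨?_, ?_⟩
  · rw [List.isChain_append] at h ⊢
    refine ⟨h.1.1, by simp, fun x hx y hy => ?_⟩
    simp at hy; subst hy
    exact h1 x (h.1.2.2 x hx a (by simp))
  · rw [List.isChain_cons] at h ⊢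
    exact ⟨fun y hy => h2 y (h.2.1 y hy), h.2.2⟩

theorem Dr.set_waiting {E : Set (Sym2 V)} {W : Finset V} {β : ℕ} {A C : List (Ent V)} {a : Ent V}
    (h : Dr E W β (A ++ a :: C)) (o : Option V) : Dr E W β (A ++ ⟨a.u, a.h, a.k, o⟩ :: C) := by
  obtain ⟨pos, c, hp, hm, hc, hv, hcnt, hb⟩ := h
  have hmem : ∀ x ∈ A ++ (⟨a.u, a.h, a.k, o⟩ : Ent V) :: C, ∃ y ∈ A ++ a :: C,
      y.u = x.u ∧ y.h = x.h := by
    intro x hx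
    simp only [List.mem_append, List.mem_cons] at hx
    rcases hx with hx | rfl | hx
    · exact ⟨x, by simp [hx], rfl, rfl⟩
    · exact ⟨a, by simp, rfl, rfl⟩
    · exact ⟨x, by simp [hx], rfl, rfl⟩
  refine ⟨pos, c, hp, fun x hx => ?_, isChain_replace hc (fun x h => h) (fun x h => h),
    fun x hx => ?_, fun x hx => ?_, hb⟩
  · obtain ⟨y, hy, h1, -⟩ := hmem x hx
    rw [← h1]; exact hm y hy
  · obtain ⟨y, hy, h1, -⟩ := hmem x hx
    rw [← h1]; exact hv y hy
  · obtain ⟨y, hy, h1, h2⟩ := hmem x hx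
    rw [← h1, ← h2]; exact hcnt y hy

theorem Canon.basic {v1 v2 v3 : V} {W : Finset V} {P : List V} (h : Canon T v1 v2 v3 W P) :
    P.Nodup ∧ (∀ u ∈ P, u ∈ W) ∧ v1 ∈ W ∧ v2 ∈ W ∧ v3 ∈ W ∧ P.head? = some v1 ∧
      ∀ u ∈ P, ∃ z, z ∉ W ∧ T.Adj u z := by
  induction h with
  | base h12 h13 h32 hout =>
    refine ⟨?_, ?_, by simp, by simp, by simp, rfl, hout⟩
    · simp [h12.ne, h13.ne, h32.ne]
    · simp
  | @step W A B C a b v h hv hadj hout ih =>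
    obtain ⟨h1, h2, h3, h4, h5, h6, -⟩ := ih
    have hmem : ∀ u ∈ A ++ a :: b :: C, u ∈ A ++ a :: B ++ b :: C := by
      intro u hu
      simp only [List.mem_append, List.mem_cons] at hu ⊢
      tauto
    refine ⟨?_, ?_, Finset.mem_insert_of_mem h3, Finset.mem_insert_of_mem h4,
      Finset.mem_insert_of_mem h5, ?_, hout⟩
    · have hs : (A ++ a :: b :: C).Nodup := by
        refine h1.sublist ?_
        rw [List.append_assoc, List.cons_append]
        exact (List.Sublist.refl A).append (List.Sublist.cons_cons a (List.sublist_append_right _ _))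
      have hp : (A ++ a :: v :: b :: C).Perm (v :: (A ++ a :: b :: C)) := by
        simpa using List.perm_middle (l₁ := A ++ [a]) (a := v) (l₂ := b :: C)
      rw [hp.nodup_iff, List.nodup_cons]
      exact ⟨fun hvm => hv (h2 v (hmem v hvm)), hs⟩
    · intro u hu
      rw [Finset.mem_insert]
      by_cases huv : u = v
      · exact Or.inl huv
      · right
        refine h2 u (hmem u ?_)
        simp only [List.mem_append, List.mem_cons] at hu ⊢
        tauto
    · cases A <;> simpa using h6

theorem eq_of_adj_of_ncard_le {x p q r w : V} (hx : (T.neighborSet x).ncard ≤ 3) (hp : T.Adj x p)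
    (hq : T.Adj x q) (hr : T.Adj x r) (hpq : p ≠ q) (hpr : p ≠ r) (hqr : q ≠ r) (hw : T.Adj x w) :
    w = p ∨ w = q ∨ w = r := by
  by_contra! hne
  have hs : (({p, q, r, w} : Finset V) : Set V) ⊆ T.neighborSet x := by
    intro z hz
    simp only [Finset.coe_insert, Finset.coe_singleton, Set.mem_insert_iff,
      Set.mem_singleton_iff] at hz
    rcases hz with rfl | rfl | rfl | rfl <;> assumption
  have := Set.ncard_le_ncard hs (Set.toFinite _)
  rw [Set.ncard_coe_finset, Finset.card_insert_of_notMem (by simp [hpq, hpr, hne.1.symm]),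
    Finset.card_insert_of_notMem (by simp [hqr, hne.2.1.symm]),
    Finset.card_insert_of_notMem (by simp [hne.2.2.symm]), Finset.card_singleton] at this
  lia

end ArcDual

namespace ArcDual

variable {V : Type} [Fintype V] [DecidableEq V] {T : SimpleGraph V}

/-- A picture of the part `W` of a triangulation with outer path `P`, in which the vertices of `X`
on the outer path have not been drawn yet. -/
structure Inv (T : SimpleGraph V) (X : Finset V) (v1 v2 v3 vn : V) (W : Finset V) (P : List V)
    (L : List (Ent V)) (β : ℕ) (E : Set (Sym2 V)) (Wd : Finset V) : Prop where
  flat_eq : flat L = P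
  dr : Dr E Wd β L
  sub : ∀ w, w ∈ W ↔ w ∈ Wd ∨ w ∈ pend L
  pnd : ∀ x ∈ pend L, x ∉ Wd ∧ x ∈ X
  nX : ∀ p ∈ L, p.u ∉ X
  edges : ∀ p q, T.Adj p q → p ∈ Wd → q ∈ Wd → s(p, q) ∈ E
  adj : L.IsChain fun p q => ∀ x ∈ p.o, T.Adj x p.u ∧ T.Adj x q.u
  last : ∀ p ∈ L.getLast?, p.o = none ∧ p.k = true
  hk : ∀ p ∈ L, p.k = false → 1 ≤ p.h
  first : (∀ u, T.Adj v1 u → u = v2 ∨ u = v3 ∨ u = vn) → ∀ p ∈ L, p.u = v1 → p.k = true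
  bound : ∃ N, N + 3 = (W \ X).card ∧ β + hsum L ≤ N ∧
    ((∃ p ∈ L, p.k = false) ∨ β + hsum L + 1 ≤ N ∨ N = 0)

theorem dr_pair {a b : V} (hab : a ≠ b) :
    Dr {s(a, b)} {a, b} 0 [⟨a, 0, true, none⟩, ⟨b, 0, true, none⟩] := by
  set pos : V → ℝ := fun w => if w = a then 0 else 1 with hpos
  have ha : pos a = 0 := if_pos rfl
  have hb : pos b = 1 := if_neg hab.symm
  have hlt : pos a < pos b := by rw [ha, hb]; exact zero_lt_one
  have hlo : elo pos s(a, b) = 0 := (elo_mk hlt).trans ha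
  have hhi : ehi pos s(a, b) = 1 := (ehi_mk hlt).trans hb
  refine ⟨pos, fun _ => 1, ⟨?_, ?_, ?_, ?_, ?_, ?_⟩, ?_, ?_, ?_, ?_, ?_⟩
  · intro x hx y hy hxy
    simp only [Finset.mem_insert, Finset.mem_singleton] at hx hy
    rcases hx with rfl | rfl <;> rcases hy with rfl | rfl
    · rfl
    · exact absurd hxy hlt.ne
    · exact absurd hxy hlt.ne'
    · rfl
  · rintro e rfl
    exact ⟨a, b, by simp, by simp, rfl, hlt, by rw [ha]; exact zero_le_one, hb.ge⟩
  · rintro e rfl w hw -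
    exact Or.inr hhi.symm
  · rintro e rfl f rfl h
    exact absurd rfl h
  · intro e _ f _ h
    exact absurd h (lt_irrefl _)
  · intro e _ f _ _ _ h
    exact absurd h (lt_irrefl _)
  · simp
  · refine List.isChain_cons_cons.2 ⟨⟨hlt, fun _ => ⟨?_, ?_, ?_⟩⟩, List.isChain_singleton _⟩
    · intro w hw
      simp only [Finset.mem_insert, Finset.mem_singleton] at hw
      rcases hw with rfl | rfl
      · exact Or.inl le_rfl
      · exact Or.inr le_rfl
    · intro e _
      exact Or.inr hb.le
    · intro e _
      exact Or.inr hb.le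
  · rintro x hx e rfl h1 h2
    rw [hhi] at h2
    exact lt_asymm h1 h2
  · intro x hx
    refine le_of_eq_of_le ((Set.ncard_eq_zero (Set.toFinite _)).2 ?_) (Nat.zero_le _)
    refine Set.eq_empty_of_forall_notMem ?_
    rintro e ⟨rfl, h1, h2⟩
    rw [hlo, ← h1] at h2
    exact zero_ne_one h2
  · refine le_of_eq ((Set.ncard_eq_zero (Set.toFinite _)).2 ?_)
    refine Set.eq_empty_of_forall_notMem ?_
    rintro e ⟨rfl, h1, h2⟩
    rw [hhi] at h2
    exact lt_irrefl _ h2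

theorem inv_base {X : Finset V} {v1 v2 v3 vn : V} (h12 : T.Adj v1 v2) (h13 : T.Adj v1 v3)
    (h32 : T.Adj v3 v2) (h1 : v1 ∉ X) (h2 : v2 ∉ X) (h3 : v3 ∉ X) :
    ∃ L β E Wd, Inv T X v1 v2 v3 vn {v1, v3, v2} [v1, v3, v2] L β E Wd := by
  have h := Dr.insPocket (P := []) (dr_pair h12.ne) (v := v3)
    (by simp [h13.ne', h32.ne]) rfl
  refine ⟨_, _, _, _, ⟨by simp [flat], h, ?_, ?_, ?_, ?_, ?_, ?_, ?_, ?_, 0, ?_, ?_, ?_⟩⟩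
  · intro w
    simp [pend]; tauto
  · simp [pend]
  · simp [h1, h2, h3]
  · intro p q hpq hp hq
    simp only [Finset.mem_insert, Finset.mem_singleton] at hp hq
    have hne := hpq.ne
    rcases hp with rfl | rfl | rfl <;> rcases hq with rfl | rfl | rfl <;>
      simp_all [Sym2.eq_iff]
  · simp
  · simp
  · simp
  · simp
  · rw [Finset.sdiff_eq_self_of_disjoint (by simp [h1, h2, h3]),
      Finset.card_insert_of_notMem (by simp [h13.ne, h12.ne]),
      Finset.card_insert_of_notMem (by simp [h32.ne]), Finset.card_singleton]
  · simp [hsum]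
  · exact Or.inr (Or.inr rfl)

theorem isChain_and_intro {α : Type} {R S : α → α → Prop} {L : List α} (hR : L.IsChain R)
    (hS : L.IsChain S) : L.IsChain fun p q => R p q ∧ S p q := by
  induction L with
  | nil => exact List.isChain_nil
  | cons a L ih =>
    cases L with
    | nil => exact List.isChain_singleton _
    | cons b L =>
      rw [List.isChain_cons_cons] at *
      exact ⟨⟨hR.1, hS.1⟩, ih hR.2 hS.2⟩

/-- The edges of a triangulation between the drawn vertices are still drawn after drawing a new
vertex `v` above the segment `S ++ [b]` of the outer path. -/
theorem edges_after {X : Finset V} (hX : ∀ x ∈ X, (T.neighborSet x).ncard ≤ 3)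
    {E E' : Set (Sym2 V)} {Wd Wd' : Finset V} {S : List (Ent V)} {b : Ent V} {v : V}
    (hE : ∀ p q, T.Adj p q → p ∈ Wd → q ∈ Wd → s(p, q) ∈ E) (hEE : E ⊆ E')
    (hWd : ∀ w, w ∈ Wd' ↔ w ∈ Wd ∨ w = v ∨ w ∈ pend S)
    (hgood : Good E' v (S ++ [b])) (hb : s(v, b.u) ∈ E')
    (hadj : (S ++ [b]).IsChain fun p q => ∀ x ∈ p.o, T.Adj x p.u ∧ T.Adj x q.u)
    (hne : (S ++ [b]).IsChain fun p q => p.u ≠ q.u)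
    (hS : ∀ p ∈ S ++ [b], p.u ≠ v) (hpX : ∀ x ∈ pend S, x ∈ X ∧ T.Adj x v)
    (hv : ∀ u ∈ Wd', T.Adj v u → u ∈ flat S ∨ u = b.u) :
    ∀ p q, T.Adj p q → p ∈ Wd' → q ∈ Wd' → s(p, q) ∈ E' := by
  have hv' : ∀ u ∈ Wd', T.Adj v u → s(u, v) ∈ E' := by
    intro u hu huv
    rcases hv u hu huv with h | rfl
    · exact hgood.edge_of_mem_flat h
    · rw [Sym2.eq_swap]; exact hb
  have hpend : ∀ x ∈ pend S, ∀ w, T.Adj x w → s(x, w) ∈ E' := by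
    intro x hx w hw
    have hch : (S ++ [b]).IsChain fun p q => (s(p.u, v) ∈ E' ∧
        ∀ x ∈ p.o, s(p.u, x) ∈ E' ∧ s(x, q.u) ∈ E' ∧ s(x, v) ∈ E') ∧
        (∀ x ∈ p.o, T.Adj x p.u ∧ T.Adj x q.u) ∧ p.u ≠ q.u :=
      isChain_and_intro hgood (isChain_and_intro hadj hne)
    obtain ⟨p, q, hp, hq, hpo, h1, h2, h3⟩ := exists_pair_of_mem_pend hch hx
    rcases eq_of_adj_of_ncard_le (hX x (hpX x hx).1) (h2 x hpo).1 (h2 x hpo).2 (hpX x hx).2 h3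
      (hS p (List.mem_append_left _ hp)) (hS q hq) hw with rfl | rfl | rfl
    · rw [Sym2.eq_swap]; exact (h1.2 x hpo).1
    · exact (h1.2 x hpo).2.1
    · exact (h1.2 x hpo).2.2
  intro p q hpq hp hq
  rcases (hWd p).1 hp with hp' | rfl | hp'
  · rcases (hWd q).1 hq with hq' | rfl | hq'
    · exact hEE (hE p q hpq hp' hq')
    · exact hv' p hp hpq.symm
    · rw [Sym2.eq_swap]; exact hpend q hq' p hpq.symm
  · rw [Sym2.eq_swap]; exact hv' q hq hpq
  · exact hpend p hp' q hpq

end ArcDual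

namespace ArcDual

variable {V : Type} [Fintype V] [DecidableEq V] {T : SimpleGraph V}

theorem isChain_replace_last {R : Ent V → Ent V → Prop} {A : List (Ent V)} {a a' : Ent V}
    (h : (A ++ [a]).IsChain R) (h1 : ∀ x, R x a → R x a') : (A ++ [a']).IsChain R := by
  rw [List.isChain_append] at h ⊢
  refine ⟨h.1, by simp, fun x hx y hy => ?_⟩
  simp at hy; subst hy
  exact h1 x (h.2.2 x hx a (by simp))

theorem Inv.notMem_pend {X : Finset V} {v1 v2 v3 vn : V} {W : Finset V} {P : List V}
    {L : List (Ent V)} {β : ℕ} {E : Set (Sym2 V)} {Wd : Finset V}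
    (h : Inv T X v1 v2 v3 vn W P L β E Wd) (hX : ∀ x ∈ X, (T.neighborSet x).ncard ≤ 3) {x v z : V}
    (hv : v ∉ W) (hxv : T.Adj x v) (hz : z ∉ insert v W) (hxz : T.Adj x z) : x ∉ pend L := by
  intro hx
  obtain ⟨S, b, rfl⟩ : ∃ S b, L = S ++ [b] := by
    refine ⟨L.dropLast, L.getLast ?_, (List.dropLast_append_getLast _).symm⟩
    rintro rfl
    simp [pend] at hx
  have hW : ∀ p ∈ S ++ [b], p.u ∈ W := fun p hp => (h.sub _).2 (Or.inl (h.dr.mem hp))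
  have hb : b.o = none := (h.last b (by simp)).1
  have hxS : x ∈ pend S := by
    rw [pend_append, pend_cons, hb] at hx
    simpa [pend] using hx
  obtain ⟨p, q, hp, hq, hpo, h1, h2⟩ :=
    exists_pair_of_mem_pend (isChain_and_intro h.adj h.dr.chain_ne) hxS
  have hpW := hW p (List.mem_append_left _ hp)
  have hqW := hW q hq
  rw [Finset.mem_insert, not_or] at hz
  rcases eq_of_adj_of_ncard_le (hX x (h.pnd x hx).2) (h1 x hpo).1 (h1 x hpo).2 hxv h2
    (fun h => hv (h ▸ hpW)) (fun h => hv (h ▸ hqW)) hxz with rfl | rfl | rfl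
  · exact hz.2 hpW
  · exact hz.2 hqW
  · exact hz.1 rfl

theorem Inv.exists_split {X : Finset V} {v1 v2 v3 vn : V} {W : Finset V} {A B C : List V} {a b : V}
    {L : List (Ent V)} {β : ℕ} {E : Set (Sym2 V)} {Wd : Finset V}
    (h : Inv T X v1 v2 v3 vn W (A ++ a :: B ++ b :: C) L β E Wd) (ha : a ∉ pend L)
    (hb : b ∉ pend L) : ∃ LA LM LC ea eb, L = LA ++ ea :: LM ++ eb :: LC ∧ flat LA = A ∧
      ea.u = a ∧ ea.o.toList ++ flat LM = B ∧ eb.u = b ∧ eb.o.toList ++ flat LC = C := by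
  obtain ⟨L1, eb, LC, rfl, h1, h2, h3⟩ := flat_split h.flat_eq hb
  obtain ⟨LA, ea, LM, rfl, h4, h5, h6⟩ := flat_split h1
    (fun hm => ha (by rw [pend_append]; exact List.mem_append_left _ hm))
  exact ⟨LA, LM, LC, ea, eb, rfl, h4, h5, h6, h2, h3⟩

theorem Inv.step {X : Finset V} {v1 v2 v3 vn : V} {W : Finset V} {A B C : List V} {a b v : V}
    {L : List (Ent V)} {β : ℕ} {E : Set (Sym2 V)} {Wd : Finset V}
    (h : Inv T X v1 v2 v3 vn W (A ++ a :: B ++ b :: C) L β E Wd)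
    (hX : ∀ x ∈ X, (T.neighborSet x).ncard ≤ 3) (hP : (A ++ a :: B ++ b :: C).Nodup)
    (hv : v ∉ W) (hvX : v ∉ X) (hadj : ∀ u ∈ W, T.Adj v u ↔ u = a ∨ u ∈ B ∨ u = b)
    (hout : ∀ u ∈ A ++ a :: v :: b :: C, ∃ z, z ∉ insert v W ∧ T.Adj u z)
    (hW : ∀ u ∈ A ++ a :: B ++ b :: C, u ∈ W)
    (hv1 : v1 ∈ W) (hv2 : v2 ∈ W) (hv3 : v3 ∈ W) (hvn : v ≠ vn) :
    ∃ L β E Wd, Inv T X v1 v2 v3 vn (insert v W) (A ++ a :: v :: b :: C) L β E Wd := by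
  have haW : a ∈ W := hW a (by simp)
  have hbW : b ∈ W := hW b (by simp)
  have hva : T.Adj v a := (hadj a haW).2 (Or.inl rfl)
  have hvb : T.Adj v b := (hadj b hbW).2 (Or.inr (Or.inr rfl))
  obtain ⟨za, hza, haz⟩ := hout a (by simp)
  obtain ⟨zb, hzb, hbz⟩ := hout b (by simp)
  obtain ⟨LA, LM, LC, ea, eb, rfl, rfl, rfl, rfl, rfl, rfl⟩ := h.exists_split
    (h.notMem_pend hX hv hva.symm hza haz) (h.notMem_pend hX hv hvb.symm hzb hbz)
  have hpe : pend (LA ++ ea :: LM ++ eb :: LC) = pend LA ++ pend (ea :: LM) ++ pend (eb :: LC) := by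
    rw [pend_append, pend_append]
  have hpnd : (pend LA ++ pend (ea :: LM) ++ pend (eb :: LC)).Nodup := by
    rw [← hpe]
    refine (show (flat (LA ++ ea :: LM ++ eb :: LC)).Nodup from ?_).sublist (pend_sublist_flat _)
    rw [h.flat_eq]; exact hP
  have hpW : ∀ x ∈ pend LA ++ pend (ea :: LM) ++ pend (eb :: LC), x ∈ W ∧ x ∉ Wd ∧ x ∈ X := by
    intro x hx
    rw [← hpe] at hx
    exact ⟨(h.sub x).2 (Or.inr hx), h.pnd x hx⟩
  have huW : ∀ p ∈ LA ++ ea :: LM ++ eb :: LC, p.u ∈ W :=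
    fun p hp => (h.sub _).2 (Or.inl (h.dr.mem hp))
  have hvp : ∀ x ∈ pend LA ++ pend (ea :: LM) ++ pend (eb :: LC), x ≠ v :=
    fun x hx hxv => hv (hxv ▸ (hpW x hx).1)
  have hmid : ∀ x ∈ pend (ea :: LM), x ∈ pend LA ++ pend (ea :: LM) ++ pend (eb :: LC) :=
    fun x hx => by simp [hx]
  have hflat : flat (ea :: LM) = ea.u :: (ea.o.toList ++ flat LM) := by rw [flat_cons]; rfl
  obtain ⟨N, hN, hβ, hor⟩ := h.bound
  obtain ⟨E', Wd', β', na, ka, nv, kv, hD, hEE, hWd, hgood, hb, hka, hkv, hs1, hs2⟩ := h.dr.add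
    (v := v) (fun hm => hv ((h.sub v).2 (Or.inl hm))) (fun x hx => (hpW x (hmid x hx)).2.1)
    (List.nodup_cons.2 ⟨fun hm => hvp v (hmid v hm) rfl,
      (List.nodup_append.1 (List.nodup_append.1 hpnd).1).2.1⟩)
    (fun q hq => h.hk q (List.mem_append_left _ (List.mem_append_right _ hq)))
  have hL : LA ++ ea :: LM ++ eb :: LC = LA ++ (ea :: LM ++ eb :: LC) := by simp
  have hseg : ∀ {R : Ent V → Ent V → Prop}, (LA ++ ea :: LM ++ eb :: LC).IsChain R →
      (ea :: LM ++ [eb]).IsChain R := by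
    intro R hR
    rw [List.isChain_split] at hR
    rw [List.append_assoc] at hR
    exact (List.isChain_append.1 hR.1).2.1
  have hpend' : pend (LA ++ (⟨ea.u, na, ka, none⟩ : Ent V) :: ⟨v, nv, kv, none⟩ :: eb :: LC) =
      pend LA ++ pend (eb :: LC) := by
    rw [pend_append, pend_cons, pend_cons]; rfl
  have hmem : ∀ p ∈ LA ++ (⟨ea.u, na, ka, none⟩ : Ent V) :: ⟨v, nv, kv, none⟩ :: eb :: LC,
      p ∈ LA ++ ea :: LM ++ eb :: LC ∨ p = ⟨ea.u, na, ka, none⟩ ∨ p = ⟨v, nv, kv, none⟩ := by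
    intro p hp
    rw [List.mem_append, List.mem_cons, List.mem_cons] at hp
    rcases hp with hp | hp | hp | hp
    · exact Or.inl (by simp [hp])
    · exact Or.inr (Or.inl hp)
    · exact Or.inr (Or.inr hp)
    · exact Or.inl (List.mem_append_right _ hp)
  refine ⟨_, β', E', Wd', ⟨?_, hD, ?_, ?_, ?_, ?_, ?_, ?_, ?_, ?_, N + 1, ?_, ?_, ?_⟩⟩
  · rw [flat_append, flat_cons, flat_cons, flat_cons]; simp
  · intro w
    rw [hpend', Finset.mem_insert, h.sub, hWd, hpe]
    simp only [List.mem_append, or_assoc, or_comm, or_left_comm]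
  · intro x hx
    rw [hpend'] at hx
    have hx' : x ∈ pend LA ++ pend (ea :: LM) ++ pend (eb :: LC) := by
      rw [List.append_assoc]
      rcases List.mem_append.1 hx with hx | hx <;> simp [hx]
    refine ⟨fun hm => ?_, (hpW x hx').2.2⟩
    rcases (hWd x).1 hm with hm | hm | hm
    · exact (hpW x hx').2.1 hm
    · exact hvp x hx' hm
    · rw [List.nodup_append] at hpnd
      obtain ⟨hA, -, hAC⟩ := hpnd
      rw [List.nodup_append] at hA
      rcases List.mem_append.1 hx with hx | hx
      · exact hA.2.2 x hx x hm rfl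
      · exact hAC x (List.mem_append_right _ hm) x hx rfl
  · intro p hp
    rcases hmem p hp with hp | rfl | rfl
    · exact h.nX p hp
    · exact h.nX ea (by simp)
    · exact hvX
  · refine edges_after hX h.edges hEE hWd hgood hb (hseg h.adj) (hseg h.dr.chain_ne) ?_ ?_ ?_
    · intro p hp hpv
      refine hv (hpv ▸ huW p ?_)
      rw [hL]
      refine List.mem_append_right _ ?_
      rcases List.mem_append.1 hp with hp | hp
      · exact List.mem_append_left _ hp
      · exact List.mem_append_right _ (by rw [List.mem_singleton.1 hp]; simp)
    · intro x hx
      have hx' := hpW x (hmid x hx)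
      refine ⟨hx'.2.2, ((hadj x hx'.1).2 ?_).symm⟩
      have := (pend_sublist_flat _).subset hx
      rw [hflat, List.mem_cons] at this
      exact this.imp_right Or.inl
    · intro u hu huv
      have huW : u ∈ W := by
        rcases (hWd u).1 hu with hu | rfl | hu
        · exact (h.sub u).2 (Or.inl hu)
        · exact absurd huv (T.loopless.irrefl _)
        · exact (hpW u (hmid u hu)).1
      rw [hflat, List.mem_cons, or_assoc]
      exact (hadj u huW).1 huv
  · have h1 := h.adj
    rw [hL, List.cons_append, List.isChain_split] at h1
    have h2 := h.adj
    rw [List.isChain_split] at h2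
    rw [List.isChain_split]
    refine ⟨isChain_replace_last h1.1 (fun x hx => hx), ?_⟩
    rw [List.isChain_cons_cons, List.isChain_cons_cons]
    exact ⟨by simp, by simp, h2.2⟩
  · have h1 := h.last
    rw [List.getLast?_append_of_ne_nil _ (by simp)] at h1 ⊢
    simpa using h1
  · intro p hp hk
    rcases hmem p hp with hp | rfl | rfl
    · exact h.hk p hp hk
    · exact hka hk
    · exact hkv hk
  · intro hf p hp hp1
    rcases hmem p hp with hp | rfl | rfl
    · exact h.first hf p hp hp1
    · exfalso
      change ea.u = v1 at hp1
      rcases hf v (hp1 ▸ hva.symm) with rfl | rfl | rfl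
      · exact hv hv2
      · exact hv hv3
      · exact hvn rfl
    · exact absurd ((show v = v1 from hp1) ▸ hv1) hv
  · rw [Finset.insert_sdiff_of_notMem _ hvX, Finset.card_insert_of_notMem (by simp [hv])]
    lia
  · simp only [hsum_append, hsum_cons] at hβ hs1 ⊢
    lia
  · rcases hs2 with h | h | h
    · exact Or.inl ⟨⟨ea.u, na, ka, none⟩, by simp, h⟩
    · exact Or.inl ⟨⟨v, nv, kv, none⟩, by simp, h⟩
    · simp only [hsum_append, hsum_cons] at hβ h ⊢
      right; left; lia

theorem Inv.wait {X : Finset V} {v1 v2 v3 vn : V} {W : Finset V} {A B C : List V} {a b v : V}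
    {L : List (Ent V)} {β : ℕ} {E : Set (Sym2 V)} {Wd : Finset V}
    (h : Inv T X v1 v2 v3 vn W (A ++ a :: B ++ b :: C) L β E Wd)
    (hX : ∀ x ∈ X, (T.neighborSet x).ncard ≤ 3) (hI : ∀ x ∈ X, ∀ y ∈ X, ¬T.Adj x y)
    (hP : (A ++ a :: B ++ b :: C).Nodup)
    (hv : v ∉ W) (hvX : v ∈ X) (hadj : ∀ u ∈ W, T.Adj v u ↔ u = a ∨ u ∈ B ∨ u = b)
    (hout : ∃ z, z ∉ insert v W ∧ T.Adj v z) (hW : ∀ u ∈ A ++ a :: B ++ b :: C, u ∈ W) :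
    ∃ L β E Wd, Inv T X v1 v2 v3 vn (insert v W) (A ++ a :: v :: b :: C) L β E Wd := by
  have haW : a ∈ W := hW a (by simp)
  have hbW : b ∈ W := hW b (by simp)
  have hva : T.Adj v a := (hadj a haW).2 (Or.inl rfl)
  have hvb : T.Adj v b := (hadj b hbW).2 (Or.inr (Or.inr rfl))
  obtain ⟨z, hz, hvz⟩ := hout
  have hB : B = [] := by
    refine List.eq_nil_iff_forall_not_mem.2 fun u hu => ?_
    have huW : u ∈ W := hW u (by simp [hu])
    rw [List.append_assoc] at hP
    have hP' := (List.nodup_append.1 hP).2.1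
    rw [List.cons_append, List.nodup_cons] at hP'
    have hab : a ≠ b := fun hab => hP'.1 (by simp [hab])
    have hau : a ≠ u := fun hau => hP'.1 (by simp [hau, hu])
    have hub : u ≠ b := (List.nodup_append.1 hP'.2).2.2 u hu b (by simp)
    rw [Finset.mem_insert, not_or] at hz
    rcases eq_of_adj_of_ncard_le (hX v hvX) hva ((hadj u huW).2 (Or.inr (Or.inl hu))) hvb hau hab hub
      hvz with rfl | rfl | rfl
    · exact hz.2 haW
    · exact hz.2 huW
    · exact hz.2 hbW
  obtain ⟨LA, LM, LC, ea, eb, rfl, rfl, rfl, hM, rfl, rfl⟩ := h.exists_split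
    (fun hm => hI v hvX _ (h.pnd _ hm).2 hva) (fun hm => hI v hvX _ (h.pnd _ hm).2 hvb)
  rw [hB, List.append_eq_nil_iff] at hM
  obtain ⟨ho, hM⟩ := hM
  obtain rfl : LM = [] := by
    cases LM with
    | nil => rfl
    | cons p L => simp [flat_cons] at hM
  rw [Option.toList_eq_nil_iff] at ho
  subst hB
  have hL : LA ++ [ea] ++ eb :: LC = LA ++ ea :: eb :: LC := by simp
  simp only [hL] at h
  have hpe : pend (LA ++ ea :: eb :: LC) = pend LA ++ pend (eb :: LC) := by
    rw [pend_append, pend_cons, ho]; rfl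
  have hpend' : pend (LA ++ (⟨ea.u, ea.h, ea.k, some v⟩ : Ent V) :: eb :: LC) =
      pend LA ++ v :: pend (eb :: LC) := by
    rw [pend_append, pend_cons]; rfl
  have hmem : ∀ p ∈ LA ++ (⟨ea.u, ea.h, ea.k, some v⟩ : Ent V) :: eb :: LC,
      ∃ q ∈ LA ++ ea :: eb :: LC, q.u = p.u ∧ q.k = p.k ∧ q.h = p.h := by
    intro p hp
    simp only [List.mem_append, List.mem_cons] at hp
    rcases hp with hp | rfl | hp
    · exact ⟨p, by simp [hp], rfl, rfl, rfl⟩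
    · exact ⟨ea, by simp, rfl, rfl, rfl⟩
    · exact ⟨p, by simp [hp], rfl, rfl, rfl⟩
  obtain ⟨N, hN, hβ, hor⟩ := h.bound
  refine ⟨_, β, E, Wd, ⟨?_, h.dr.set_waiting (some v), ?_, ?_, ?_, h.edges, ?_, ?_, ?_, ?_, N, ?_,
    ?_, ?_⟩⟩
  · rw [flat_append, flat_cons, flat_cons]; simp
  · intro w
    rw [hpend', Finset.mem_insert, h.sub, hpe]
    simp only [List.mem_append, List.mem_cons]
    tauto
  · intro x hx
    rw [hpend', List.mem_append, List.mem_cons] at hx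
    by_cases hxv : x = v
    · rw [hxv]
      exact ⟨fun hm => hv ((h.sub v).2 (Or.inl hm)), hvX⟩
    · refine h.pnd x ?_
      rw [hpe, List.mem_append]
      tauto
  · intro p hp
    obtain ⟨q, hq, h1, -⟩ := hmem p hp
    rw [← h1]; exact h.nX q hq
  · have h1 := h.adj
    rw [List.isChain_split] at h1 ⊢
    refine ⟨isChain_replace_last h1.1 (fun x hx => hx), ?_⟩
    rw [List.isChain_cons_cons] at h1 ⊢
    refine ⟨?_, h1.2.2⟩
    simp [hva, hvb]
  · have h1 := h.last
    rw [List.getLast?_append_of_ne_nil _ (by simp)] at h1 ⊢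
    simpa using h1
  · intro p hp hk
    obtain ⟨q, hq, -, h2, h3⟩ := hmem p hp
    rw [← h3]; exact h.hk q hq (h2.trans hk)
  · intro hf p hp hp1
    obtain ⟨q, hq, h1, h2, -⟩ := hmem p hp
    rw [← h2]; exact h.first hf q hq (h1.trans hp1)
  · rw [Finset.insert_sdiff_of_mem _ hvX]; exact hN
  · simpa only [hsum_append, hsum_cons] using hβ
  · simp only [hsum_append, hsum_cons] at hor ⊢
    refine hor.imp_left ?_
    rintro ⟨p, hp, hk⟩
    simp only [List.mem_append, List.mem_cons] at hp
    rcases hp with hp | rfl | hp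
    · exact ⟨p, by simp [hp], hk⟩
    · exact ⟨⟨p.u, p.h, p.k, some v⟩, by simp, hk⟩
    · exact ⟨p, by simp [hp], hk⟩

theorem Canon.exists_inv {X : Finset V} {v1 v2 v3 vn : V} {W : Finset V} {P : List V}
    (h : Canon T v1 v2 v3 W P) (hX : ∀ x ∈ X, (T.neighborSet x).ncard ≤ 3)
    (hI : ∀ x ∈ X, ∀ y ∈ X, ¬T.Adj x y) (h1 : v1 ∉ X) (h2 : v2 ∉ X) (h3 : v3 ∉ X) (hn : vn ∉ W) :
    ∃ L β E Wd, Inv T X v1 v2 v3 vn W P L β E Wd := by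
  induction h with
  | base h12 h13 h32 hout => exact inv_base h12 h13 h32 h1 h2 h3
  | @step W A B C a b v h hv hadj hout ih =>
    rw [Finset.mem_insert, not_or] at hn
    obtain ⟨L, β, E, Wd, hi⟩ := ih hn.2
    obtain ⟨hP, hW, hv1, hv2, hv3, -⟩ := h.basic
    by_cases hvX : v ∈ X
    · exact hi.wait hX hI hP hv hvX hadj (hout v (by simp)) hW
    · exact hi.step hX hP hv hvX hadj hout hW hv1 hv2 hv3 (Ne.symm hn.1)

end ArcDual

namespace ArcDual

variable {V : Type} [Fintype V] [DecidableEq V] {T : SimpleGraph V}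

theorem Canon.three_le_length {v1 v2 v3 : V} {W : Finset V} {P : List V}
    (h : Canon T v1 v2 v3 W P) : 3 ≤ P.length := by
  cases h with
  | base => simp
  | step => simp; lia

theorem Canon.adj_base {v1 v2 v3 : V} {W : Finset V} {P : List V}
    (h : Canon T v1 v2 v3 W P) : T.Adj v1 v2 ∧ T.Adj v1 v3 ∧ T.Adj v3 v2 := by
  induction h with
  | base h12 h13 h32 => exact ⟨h12, h13, h32⟩
  | step _ _ _ _ _ ih => exact ih

/-- Drawing the last vertex of a triangulation. -/
theorem Inv.finish {X : Finset V} {v1 v2 v3 vn : V} {P : List V} {L : List (Ent V)} {β : ℕ}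
    {E : Set (Sym2 V)} {Wd : Finset V}
    (h : Inv T X v1 v2 v3 vn (Finset.univ.erase vn) P L β E Wd)
    (hX : ∀ x ∈ X, (T.neighborSet x).ncard ≤ 3) (hP : P.Nodup) (hlen : 2 ≤ P.length)
    (hhead : P.head? = some v1) (hadj : ∀ u, T.Adj vn u ↔ u ∈ P) :
    ∃ E' β' L', Dr E' Finset.univ β' L' ∧ T.edgeSet ⊆ E' ∧
      β' ≤ (Finset.univ.erase vn \ X).card - 3 ∧
      ((∀ u, T.Adj v1 u → u = v2 ∨ u = v3 ∨ u = vn) →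
        β' ≤ (Finset.univ.erase vn \ X).card - 4) := by
  have hne : L ≠ [] := by
    rintro rfl
    rw [← h.flat_eq] at hlen
    simp [flat] at hlen
  obtain ⟨S, b, rfl⟩ : ∃ S b, L = S ++ [b] :=
    ⟨L.dropLast, L.getLast hne, (List.dropLast_append_getLast _).symm⟩
  obtain ⟨hbo, hbk⟩ := h.last b (by simp)
  have hflat : P = flat S ++ [b.u] := by
    rw [← h.flat_eq, flat_append, flat_cons, hbo]; rfl
  have hpe : pend (S ++ [b]) = pend S := by
    rw [pend_append, pend_cons, hbo]; simp [pend]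
  cases S with
  | nil => simp [hflat, flat] at hlen
  | cons a M =>
  have ha1 : a.u = v1 := by
    rw [hflat, flat_cons] at hhead
    simpa using hhead
  have hvn : ∀ w ∈ Wd, w ≠ vn := fun w hw => Finset.ne_of_mem_erase ((h.sub w).2 (Or.inl hw))
  have hpn : ∀ w ∈ pend (a :: M), w ∉ Wd ∧ w ∈ X ∧ w ≠ vn := by
    intro w hw
    rw [← hpe] at hw
    exact ⟨(h.pnd w hw).1, (h.pnd w hw).2, Finset.ne_of_mem_erase ((h.sub w).2 (Or.inr hw))⟩
  have hnd : (vn :: pend (a :: M)).Nodup := by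
    refine List.nodup_cons.2 ⟨fun hm => (hpn vn hm).2.2 rfl, ?_⟩
    rw [hflat] at hP
    exact (List.nodup_append.1 hP).1.sublist (pend_sublist_flat _)
  have hQ : ∀ q ∈ a :: M, q.k = false → 1 ≤ q.h := fun q hq => h.hk q (List.mem_append_left _ hq)
  obtain ⟨E', W', β', L', hD, hEE, hWd, hgood, hb, hβ1, hβ2⟩ : ∃ E' W' β' L', Dr E' W' β' L' ∧
      E ⊆ E' ∧ (∀ w, w ∈ W' ↔ w ∈ Wd ∨ w = vn ∨ w ∈ pend (a :: M)) ∧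
      Good E' vn (a :: M ++ [b]) ∧ s(vn, b.u) ∈ E' ∧ β' ≤ β + hsum (a :: M) ∧
      ((∀ u, T.Adj v1 u → u = v2 ∨ u = v3 ∨ u = vn) →
        (∃ p ∈ a :: M, p.k = false) → β' + 1 ≤ β + hsum (a :: M)) := by
    by_cases hf : ∀ u, T.Adj v1 u → u = v2 ∨ u = v3 ∨ u = vn
    · obtain ⟨E', W', β', L', h1, h2, h3, h4, h5, h6, h7⟩ := h.dr.addLast
        (fun hm => hvn vn hm rfl) (fun x hx => (hpn x hx).1) hnd hQ
        (h.first hf a (by simp) ha1)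
      exact ⟨E', W', β', L', h1, h2, h3, h4, h5, h6, fun _ => h7⟩
    · have hd : Dr E Wd β ([] ++ a :: M ++ b :: []) := h.dr
      obtain ⟨E', W', β', na, ka, nv, kv, h1, h2, h3, h4, h5, h6, h7, h8, h9⟩ := hd.add
        (fun hm => hvn vn hm rfl) (fun x hx => (hpn x hx).1) hnd hQ
      refine ⟨E', W', β', _, h1, h2, h3, h4, h5, ?_, fun h => absurd h hf⟩
      rcases h9 with h9 | h9 | h9
      · have := h6 h9; lia
      · have := h7 h9; lia
      · lia
  have hW' : W' = Finset.univ := by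
    refine Finset.eq_univ_iff_forall.2 fun w => (hWd w).2 ?_
    by_cases hw : w = vn
    · exact Or.inr (Or.inl hw)
    · rcases (h.sub w).1 (Finset.mem_erase.2 ⟨hw, Finset.mem_univ w⟩) with hw | hw
      · exact Or.inl hw
      · exact Or.inr (Or.inr (hpe ▸ hw))
  subst hW'
  have hed := edges_after hX h.edges hEE hWd hgood hb h.adj h.dr.chain_ne
    (fun p hp => hvn _ (h.dr.mem hp))
    (fun x hx => ⟨(hpn x hx).2.1, ((hadj x).2 (by
      rw [hflat]
      exact List.mem_append_left _ ((pend_sublist_flat _).subset hx))).symm⟩)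
    (fun u _ hu => by
      have := (hadj u).1 hu
      rw [hflat] at this
      simpa using this)
  obtain ⟨N, hN, hN1, hN2⟩ := h.bound
  have hsum' : hsum (a :: M) ≤ hsum (a :: M ++ [b]) := by rw [hsum_append]; exact Nat.le_add_right _ _
  refine ⟨E', β', L', hD, ?_, by lia, fun hf => ?_⟩
  · intro e
    induction e with
    | h p q => exact fun he => hed p q he (Finset.mem_univ p) (Finset.mem_univ q)
  · rcases hN2 with ⟨p, hp, hk⟩ | hN2 | hN2
    · rcases List.mem_append.1 hp with hp | hp
      · have := hβ2 hf ⟨p, hp, hk⟩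
        lia
      · rw [List.mem_singleton.1 hp, hbk] at hk
        exact absurd hk (by decide)
    · lia
    · lia

theorem exists_of_ncard_eq_three {x y : V} (h : (T.neighborSet x).ncard = 3) (hy : T.Adj x y) :
    ∃ p q, ∀ z, T.Adj x z → z = y ∨ z = p ∨ z = q := by
  obtain ⟨a, b, c, -, -, -, hs⟩ := Set.ncard_eq_three.1 h
  have hmem : ∀ z, T.Adj x z → z = a ∨ z = b ∨ z = c := by
    intro z hz
    have : z ∈ T.neighborSet x := hz
    rw [hs] at this
    simpa using this
  rcases hmem y hy with rfl | rfl | rfl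
  · exact ⟨b, c, hmem⟩
  · exact ⟨a, c, fun z hz => by have := hmem z hz; tauto⟩
  · exact ⟨a, b, fun z hz => by have := hmem z hz; tauto⟩

theorem TriSphere.exists_dr {F : Type} [DecidableEq F] {l r : Sym2 V → F} (hT : TriSphere T l r)
    (hn : 5 ≤ Fintype.card V) : ∃ E β L, Dr E Finset.univ β L ∧ T.edgeSet ⊆ E ∧
      β ≤ Fintype.card V - {v : V | (T.neighborSet v).ncard = 3}.ncard - 4 := by
  classical
  have hnon : ∀ x y, (T.neighborSet x).ncard = 3 → (T.neighborSet y).ncard = 3 → ¬T.Adj x y := by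
    intro x y hx hy hxy
    obtain ⟨p, q, hpq⟩ := exists_of_ncard_eq_three hx hxy
    obtain ⟨s, t, hst⟩ := exists_of_ncard_eq_three hy hxy.symm
    exact hT.not_adj_of_degree_three hn hpq hst hxy
  set D : Finset V := Finset.univ.filter fun v => (T.neighborSet v).ncard = 3 with hD
  have hDm : ∀ v, v ∈ D ↔ (T.neighborSet v).ncard = 3 := fun v => by simp [hD]
  have hDc : {v : V | (T.neighborSet v).ncard = 3}.ncard = D.card := by
    rw [← Set.ncard_coe_finset]
    congr 1
    ext v
    simp [hD]
  rw [hDc]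
  obtain ⟨v1, hv1⟩ : ∃ v1, D.Nonempty → v1 ∈ D := by
    by_cases h : D.Nonempty
    · exact ⟨h.choose, fun _ => h.choose_spec⟩
    · have : Nonempty V := Fintype.card_pos_iff.1 (by lia)
      exact ⟨Classical.arbitrary V, fun h' => absurd h' h⟩
  have hcard : 1 < Fintype.card V := by lia
  obtain ⟨vn, h1n⟩ := hT.exists_adj (d := v1) (Fintype.exists_ne_of_one_lt_card hcard v1)
  obtain ⟨v2, h2n, h21, hf⟩ := hT.exists_third (inc_left (l := l) (r := r)
    (show s(v1, vn) ∈ T.edgeSet from h1n))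
  obtain ⟨v3, P, hC, hadj⟩ := hT.exists_canon (by lia) (v1 := v1) (v2 := v2) (vn := vn) h21.symm
    ((hf _).2 (Or.inl Sym2.eq_swap)) ((hf _).2 (Or.inr (Or.inr rfl)))
  obtain ⟨h12, h13, h32⟩ := hC.adj_base
  obtain ⟨hP, hPW, hW1, hW2, hW3, hhead, -⟩ := hC.basic
  have hlen := hC.three_le_length
  have hXd : ∀ y, T.Adj v1 y → y ∉ D := fun y hy hyD =>
    hnon v1 y ((hDm v1).1 (hv1 ⟨y, hyD⟩)) ((hDm y).1 hyD) hy
  have hX3 : ∀ x ∈ D.erase v1, (T.neighborSet x).ncard = 3 :=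
    fun x hx => (hDm x).1 (Finset.mem_of_mem_erase hx)
  obtain ⟨L, β, E, Wd, hi⟩ := hC.exists_inv (X := D.erase v1) (fun x hx => (hX3 x hx).le)
    (fun x hx y hy => hnon x y (hX3 x hx) (hX3 y hy)) (Finset.notMem_erase _ _)
    (fun h => hXd v2 h12 (Finset.mem_of_mem_erase h))
    (fun h => hXd v3 h13 (Finset.mem_of_mem_erase h)) (Finset.notMem_erase vn _)
  obtain ⟨E', β', L', hDr, hE, hb1, hb2⟩ :=
    hi.finish (fun x hx => (hX3 x hx).le) hP (by lia) hhead hadj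
  refine ⟨E', β', L', hDr, hE, ?_⟩
  have hsub : D.erase v1 ⊆ Finset.univ.erase vn := fun x hx =>
    Finset.mem_erase.2 ⟨fun h => hXd vn h1n (h ▸ Finset.mem_of_mem_erase hx), Finset.mem_univ x⟩
  rw [Finset.card_sdiff_of_subset hsub, Finset.card_erase_of_mem (Finset.mem_univ vn),
    Finset.card_univ] at hb1 hb2
  by_cases hne : D.Nonempty
  · have hd := hv1 hne
    rw [Finset.card_erase_of_mem hd] at hb2
    have hpos := Finset.card_pos.2 hne
    have := hb2 fun u hu => eq_of_adj_of_ncard_le ((hDm v1).1 hd).le h12 h13 h1n h32.ne'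
      (Finset.ne_of_mem_erase hW2) (Finset.ne_of_mem_erase hW3) hu
    lia
  · rw [Finset.not_nonempty_iff_eq_empty] at hne
    rw [hne] at hb1 ⊢
    simp only [Finset.erase_empty, Finset.card_empty] at hb1 ⊢
    lia

end ArcDual

namespace ArcDual

variable {V : Type} [Fintype V] [DecidableEq V] {T : SimpleGraph V}

theorem Pic.ends {pos : V → ℝ} {c : Sym2 V → ℝ} {E : Set (Sym2 V)} {W : Finset V}
    (h : Pic pos c E W) {e : Sym2 V} (he : e ∈ E) :
    elo pos e < ehi pos e ∧ elo pos e ≤ c e ∧ c e ≤ ehi pos e := by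
  obtain ⟨a, b, -, -, rfl, h1, h2, h3⟩ := h.wf e he
  rw [elo_mk h1, ehi_mk h1]
  exact ⟨h1, h2, h3⟩

theorem Pic.mono {pos : V → ℝ} {c : Sym2 V → ℝ} {E E' : Set (Sym2 V)} {W : Finset V}
    (h : Pic pos c E W) (hE : E' ⊆ E) : Pic pos c E' W :=
  ⟨h.inj, fun e he => h.wf e (hE he), fun e he => h.cpos e (hE he),
    fun e he f hf => h.cne e (hE he) f (hE hf), fun e he f hf => h.up e (hE he) f (hE hf),
    fun e he f hf => h.dn e (hE he) f (hE hf)⟩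

theorem Pic.eq_of_ends_eq {pos : V → ℝ} {c : Sym2 V → ℝ} {E : Set (Sym2 V)} {W : Finset V}
    (h : Pic pos c E W) {e f : Sym2 V} (he : e ∈ E) (hf : f ∈ E) (hlo : elo pos e = elo pos f)
    (hhi : ehi pos e = ehi pos f) : e = f := by
  obtain ⟨a, b, ha, hb, rfl, h1, -⟩ := h.wf e he
  obtain ⟨a', b', ha', hb', rfl, h2, -⟩ := h.wf f hf
  rw [elo_mk h1, elo_mk h2] at hlo
  rw [ehi_mk h1, ehi_mk h2] at hhi
  rw [h.inj a ha a' ha' hlo, h.inj b hb b' hb' hhi]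

open Classical in
/-- The arc diagram described by a picture. -/
noncomputable def arcDiagram (pos : V → ℝ) (c : Sym2 V → ℝ) : ArcDiagram V where
  pos := pos
  kind e := if c e = elo pos e then ArcKind.mountain
    else if c e = ehi pos e then ArcKind.pocket else ArcKind.biarc
  crossPt := c
  credit _ := 0

theorem arcDiagram_biarc {pos : V → ℝ} {c : Sym2 V → ℝ} {e : Sym2 V} :
    (arcDiagram pos c).kind e = ArcKind.biarc ↔ c e ≠ elo pos e ∧ c e ≠ ehi pos e := by
  simp only [arcDiagram]
  split_ifs with h1 h2 <;> simp [h1, *]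

theorem arcDiagram_upperArcs {pos : V → ℝ} {c : Sym2 V → ℝ} {e : Sym2 V} {p : ℝ × ℝ}
    (hp : p ∈ (arcDiagram pos c).upperArcs e) : p = (c e, ehi pos e) := by
  simp only [arcDiagram, ArcDiagram.upperArcs] at hp
  split_ifs at hp with h1 h2
  · rw [List.mem_singleton.1 hp, h1]; rfl
  · simp at hp
  · rw [List.mem_singleton.1 hp]; rfl

theorem arcDiagram_lowerArcs {pos : V → ℝ} {c : Sym2 V → ℝ} {e : Sym2 V} {p : ℝ × ℝ}
    (hp : p ∈ (arcDiagram pos c).lowerArcs e) : p = (elo pos e, c e) := by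
  simp only [arcDiagram, ArcDiagram.lowerArcs] at hp
  split_ifs at hp with h1 h2
  · simp at hp
  · rw [List.mem_singleton.1 hp, h2]; rfl
  · rw [List.mem_singleton.1 hp]; rfl

theorem Pic.isPlaneOn {pos : V → ℝ} {c : Sym2 V → ℝ} (h : Pic pos c T.edgeSet Finset.univ) :
    (arcDiagram pos c).IsPlaneOn T Set.univ := by
  refine ⟨fun x _ y _ hxy => h.inj x (Finset.mem_univ x) y (Finset.mem_univ y) hxy, ?_, ?_, ?_⟩
  · intro e he hk
    rw [arcDiagram_biarc] at hk
    obtain ⟨-, h1, h2⟩ := h.ends he.1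
    refine ⟨lt_of_le_of_ne h1 hk.1.symm, lt_of_le_of_ne h2 hk.2, fun x _ hx => ?_⟩
    exact (h.cpos e he.1 x (Finset.mem_univ x) hx).elim hk.1 hk.2
  · intro e he f hf hef hk _ hc
    rw [arcDiagram_biarc] at hk
    exact (h.cne e he.1 f hf.1 hef hc).elim hk.1 hk.2
  · intro e he f hf hef
    refine ⟨fun p hp q hq => ?_, fun p hp q hq => ?_⟩
    · rw [arcDiagram_upperArcs hp, arcDiagram_upperArcs hq]
      exact fun hi => h.up e he.1 f hf.1 hi.1 hi.2.1 hi.2.2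
    · rw [arcDiagram_lowerArcs hp, arcDiagram_lowerArcs hq]
      exact fun hi => h.dn e he.1 f hf.1 hi.1 hi.2.1 hi.2.2

theorem Pic.biarcCount {pos : V → ℝ} {c : Sym2 V → ℝ} (h : Pic pos c T.edgeSet Finset.univ) :
    (arcDiagram pos c).biarcCount T Set.univ ≤
      {e ∈ T.edgeSet | elo pos e < c e ∧ c e < ehi pos e}.ncard := by
  refine Set.ncard_le_ncard ?_ (Set.toFinite _)
  rintro e ⟨he, hk⟩
  rw [arcDiagram_biarc] at hk
  obtain ⟨-, h1, h2⟩ := h.ends he.1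
  exact ⟨he.1, lt_of_le_of_ne h1 hk.1.symm, lt_of_le_of_ne h2 hk.2⟩

/-- The height over the spine of the curve from `l` to `r` that crosses the spine upwards
at `c`. -/
noncomputable def wave (l c r x : ℝ) : ℝ := √((x - c) * (r - x)) - √((x - l) * (c - x))

theorem wave_right {l c r x : ℝ} (hl : l ≤ x) (hc : c ≤ x) : wave l c r x = √((x - c) * (r - x)) := by
  rw [wave, Real.sqrt_eq_zero_of_nonpos (x := (x - l) * (c - x)), sub_zero]
  exact mul_nonpos_of_nonneg_of_nonpos (by linarith) (by linarith)

theorem wave_left {l c r x : ℝ} (hc : x ≤ c) (hr : x ≤ r) :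
    wave l c r x = -√((x - l) * (c - x)) := by
  rw [wave, Real.sqrt_eq_zero_of_nonpos (x := (x - c) * (r - x)), zero_sub]
  exact mul_nonpos_of_nonpos_of_nonneg (by linarith) (by linarith)

theorem wave_pos {l c r x : ℝ} (hl : l < x) (hc : c < x) (hr : x < r) : 0 < wave l c r x := by
  rw [wave_right hl.le hc.le]
  exact Real.sqrt_pos.2 (mul_pos (by linarith) (by linarith))

theorem wave_neg {l c r x : ℝ} (hl : l < x) (hc : x < c) (hr : x < r) : wave l c r x < 0 := by
  rw [wave_left hc.le hr.le, neg_lt_zero]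
  exact Real.sqrt_pos.2 (mul_pos (by linarith) (by linarith))

theorem nested_eq {p q p' q' x : ℝ} (hp : p < x) (hq : x < q) (hp' : p' < x) (_ : x < q')
    (h : (x - p) * (q - x) = (x - p') * (q' - x)) (h1 : ¬(p < p' ∧ q < q'))
    (h2 : ¬(p' < p ∧ q' < q)) : p = p' ∧ q = q' := by
  rcases lt_trichotomy p p' with hlt | rfl | hlt
  · have : q' ≤ q := not_lt.1 fun hh => h1 ⟨hlt, hh⟩
    nlinarith
  · refine ⟨rfl, ?_⟩
    have := mul_left_cancel₀ (sub_pos.2 hp).ne' h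
    linarith
  · have : q ≤ q' := not_lt.1 fun hh => h2 ⟨hlt, hh⟩
    nlinarith

/-- Distinct edges of a picture are disjoint apart from their ends. -/
theorem Pic.wave_ne {pos : V → ℝ} {c : Sym2 V → ℝ} {E : Set (Sym2 V)} {W : Finset V}
    (h : Pic pos c E W) {e f : Sym2 V} (he : e ∈ E) (hf : f ∈ E) (hef : e ≠ f) {x : ℝ}
    (h1 : elo pos e < x) (h2 : x < ehi pos e) (h3 : elo pos f < x) (h4 : x < ehi pos f) :
    wave (elo pos e) (c e) (ehi pos e) x ≠ wave (elo pos f) (c f) (ehi pos f) x := by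
  intro heq
  have hce : ∀ {e f : Sym2 V}, e ∈ E → f ∈ E → e ≠ f → c e = c f → c e ≠ ehi pos e →
      c e = elo pos e := fun he hf hef hc hne => (h.cne _ he _ hf hef hc).resolve_right hne
  have hce' : ∀ {e f : Sym2 V}, e ∈ E → f ∈ E → e ≠ f → c e = c f → c e ≠ elo pos e →
      c e = ehi pos e := fun he hf hef hc hne => (h.cne _ he _ hf hef hc).resolve_left hne
  rcases lt_trichotomy (c e) x with hxe | hxe | hxe
  · have hpos := wave_pos h1 hxe h2
    have hxf : c f < x := by
      refine not_le.1 fun hxf => ?_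
      rw [heq, wave_left hxf h4.le] at hpos
      linarith [Real.sqrt_nonneg ((x - elo pos f) * (c f - x))]
    rw [wave_right h1.le hxe.le, wave_right h3.le hxf.le, Real.sqrt_inj
      (mul_pos (by linarith) (by linarith)).le (mul_pos (by linarith) (by linarith)).le] at heq
    obtain ⟨hc, hhi⟩ := nested_eq hxe h2 hxf h4 heq
      (fun hh => h.up e he f hf hh.1 (hxf.trans h2) hh.2)
      (fun hh => h.up f hf e he hh.1 (hxe.trans h4) hh.2)
    have hle := hce he hf hef hc (hxe.trans h2).ne
    have hlf := hce hf he hef.symm hc.symm (hxf.trans h4).ne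
    exact hef (h.eq_of_ends_eq he hf (by rw [← hle, ← hlf, hc]) hhi)
  · have hxf : c f = x := by
      rw [wave_right h1.le hxe.le, hxe, sub_self, zero_mul, Real.sqrt_zero] at heq
      rcases lt_trichotomy (c f) x with hxf | hxf | hxf
      · exact absurd heq (wave_pos h3 hxf h4).ne
      · exact hxf
      · exact absurd heq (wave_neg h3 hxf h4).ne'
    rcases h.cne e he f hf hef (hxe.trans hxf.symm) with hh | hh
    · linarith
    · linarith
  · have hneg := wave_neg h1 hxe h2
    have hxf : x < c f := by
      refine not_le.1 fun hxf => ?_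
      rw [heq, wave_right h3.le hxf] at hneg
      linarith [Real.sqrt_nonneg ((x - c f) * (ehi pos f - x))]
    rw [wave_left hxe.le h2.le, wave_left hxf.le h4.le, neg_inj, Real.sqrt_inj
      (mul_pos (by linarith) (by linarith)).le (mul_pos (by linarith) (by linarith)).le] at heq
    obtain ⟨hlo, hc⟩ := nested_eq h1 hxe h3 hxf heq
      (fun hh => h.dn e he f hf hh.1 (h3.trans hxe) hh.2)
      (fun hh => h.dn f hf e he hh.1 (h1.trans hxf) hh.2)
    have hle := hce' he hf hef hc (h1.trans hxe).ne'
    have hlf := hce' hf he hef.symm hc.symm (h3.trans hxf).ne'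
    exact hef (h.eq_of_ends_eq he hf hlo (by rw [← hle, ← hlf, hc]))

theorem Pic.isPlanar {pos : V → ℝ} {c : Sym2 V → ℝ} (h : Pic pos c T.edgeSet Finset.univ) :
    IsPlanar T := by
  set X : Sym2 V → ℝ → ℝ := fun e t => elo pos e + t * (ehi pos e - elo pos e) with hX
  have hIoo : ∀ e ∈ T.edgeSet, ∀ t ∈ Set.Ioo (0 : ℝ) 1, elo pos e < X e t ∧ X e t < ehi pos e := by
    intro e he t ht
    have h1 := sub_pos.2 (h.ends he).1
    have h2 := mul_pos ht.1 h1
    have h3 := mul_pos (sub_pos.2 ht.2) h1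
    simp only [hX]
    constructor <;> linarith
  have h0 : ∀ e, X e 0 = elo pos e := fun e => by simp [hX]
  have h1 : ∀ e, X e 1 = ehi pos e := fun e => by simp [hX]
  refine ⟨⟨fun v => (pos v, 0), fun e t => (X e t, wave (elo pos e) (c e) (ehi pos e) (X e t)),
    ?_, ?_, ?_, ?_, ?_, ?_⟩⟩
  · intro x y hxy
    exact h.inj x (Finset.mem_univ x) y (Finset.mem_univ y) (Prod.ext_iff.1 hxy).1
  · intro e _
    refine Continuous.continuousOn ?_
    simp only [hX, wave]
    fun_prop
  · intro e he s _ t _ hst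
    have hst' := (Prod.ext_iff.1 hst).1
    simp only [hX, add_right_inj] at hst'
    exact mul_right_cancel₀ (sub_pos.2 (h.ends he).1).ne' hst'
  · intro a b hab
    have he : s(a, b) ∈ T.edgeSet := hab
    obtain ⟨hlt, hlc, hch⟩ := h.ends he
    have hw0 : wave (elo pos s(a, b)) (c s(a, b)) (ehi pos s(a, b)) (elo pos s(a, b)) = 0 := by
      rw [wave_left hlc hlt.le]; simp
    have hw1 : wave (elo pos s(a, b)) (c s(a, b)) (ehi pos s(a, b)) (ehi pos s(a, b)) = 0 := by
      rw [wave_right hlt.le hch]; simp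
    simp only [h0, h1, hw0, hw1]
    obtain ⟨a', b', -, -, heq, hlt', -⟩ := h.wf _ he
    rw [heq, elo_mk hlt', ehi_mk hlt']
    rcases Sym2.eq_iff.1 heq with ⟨rfl, rfl⟩ | ⟨rfl, rfl⟩
    · rfl
    · exact Set.pair_comm _ _
  · rintro e he v ⟨t, ht, hv⟩
    obtain ⟨hl, hr⟩ := hIoo e he t ht
    obtain ⟨hv1, hv2⟩ := Prod.ext_iff.1 hv
    simp only at hv1 hv2
    rcases lt_trichotomy (c e) (X e t) with hc | hc | hc
    · exact (wave_pos hl hc hr).ne' hv2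
    · rcases h.cpos e he v (Finset.mem_univ v) (hc.trans hv1) with hh | hh
      · linarith
      · linarith
    · exact (wave_neg hl hc hr).ne hv2
  · intro e he f hf hef
    refine Set.eq_empty_of_forall_notMem ?_
    rintro _ ⟨⟨s, hs, rfl⟩, ⟨t, ht, hst⟩⟩
    obtain ⟨hx, hy⟩ := Prod.ext_iff.1 hst
    simp only at hx hy
    obtain ⟨hl, hr⟩ := hIoo e he s hs
    obtain ⟨hl', hr'⟩ := hIoo f hf t ht
    rw [hx] at hl' hr' hy
    exact h.wave_ne he hf hef hl hr hl' hr' hy.symm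

theorem isPlanar_mono {G : SimpleGraph V} (hT : IsPlanar T) (h : G ≤ T) : IsPlanar G := by
  obtain ⟨D⟩ := hT
  have he : G.edgeSet ⊆ T.edgeSet := SimpleGraph.edgeSet_subset_edgeSet.2 h
  exact ⟨⟨D.vert, D.edge, D.vert_inj, fun e h' => D.edge_cont e (he h'),
    fun e h' => D.edge_injOn e (he h'), fun a b hab => D.edge_ends a b (h hab),
    fun e h' => D.edge_int_vert e (he h'),
    fun e h' f hf => D.edge_disjoint e (he h') f (he hf)⟩⟩

/-- A plane picture of the complete graph on at most four vertices without biarcs. -/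
theorem exists_pic_top (hn : Fintype.card V ≤ 4) : ∃ pos c,
    Pic pos c (⊤ : SimpleGraph V).edgeSet Finset.univ ∧
      ∀ e, c e = elo pos e ∨ c e = ehi pos e := by
  classical
  obtain ⟨φ⟩ : Nonempty (V ↪ Fin 4) := Function.Embedding.nonempty_of_card_le (by simpa using hn)
  set pos : V → ℝ := fun v => ((φ v : ℕ) : ℝ) with hpos
  set c : Sym2 V → ℝ := fun e => if elo pos e = 1 ∧ ehi pos e = 3 then 3 else elo pos e with hc
  have hinj : ∀ x y, pos x = pos y → x = y := by
    intro x y hxy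
    exact φ.injective (Fin.ext (Nat.cast_injective (R := ℝ) hxy))
  have hmk : ∀ e ∈ (⊤ : SimpleGraph V).edgeSet, ∃ a b, e = s(a, b) ∧ pos a < pos b := by
    intro e
    induction e with
    | h a b =>
      intro hab
      have hne : pos a ≠ pos b := fun h => hab (hinj a b h)
      rcases lt_or_gt_of_ne hne with h | h
      · exact ⟨a, b, rfl, h⟩
      · exact ⟨b, a, Sym2.eq_swap, h⟩
  have hcase : ∀ e, (c e = 3 ∧ elo pos e = 1 ∧ ehi pos e = 3) ∨
      (c e = elo pos e ∧ ¬(elo pos e = 1 ∧ ehi pos e = 3)) := by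
    intro e
    by_cases h : elo pos e = 1 ∧ ehi pos e = 3
    · exact Or.inl ⟨if_pos h, h⟩
    · exact Or.inr ⟨if_neg h, h⟩
  have hcc : ∀ e, c e = elo pos e ∨ c e = ehi pos e := by
    intro e
    rcases hcase e with h | h
    · exact Or.inr (h.1.trans h.2.2.symm)
    · exact Or.inl h.1
  have hval : ∀ v, ∃ k : ℕ, k < 4 ∧ pos v = k := fun v => ⟨φ v, (φ v).2, rfl⟩
  have hnat : ∀ e ∈ (⊤ : SimpleGraph V).edgeSet, ∃ i j : ℕ, i < j ∧ j < 4 ∧ elo pos e = i ∧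
      ehi pos e = j := by
    intro e he
    obtain ⟨a, b, rfl, hab⟩ := hmk e he
    refine ⟨φ a, φ b, Nat.cast_lt (α := ℝ).1 hab, (φ b).2, elo_mk hab, ehi_mk hab⟩
  refine ⟨pos, c, ⟨fun x _ y _ => hinj x y, ?_, fun e _ w _ _ => hcc e, fun e _ f _ _ _ => hcc e,
    ?_, ?_⟩, hcc⟩
  · intro e he
    obtain ⟨a, b, rfl, hab⟩ := hmk e he
    refine ⟨a, b, Finset.mem_univ a, Finset.mem_univ b, rfl, hab, ?_⟩
    rw [← elo_mk hab, ← ehi_mk hab]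
    rcases hcc s(a, b) with h | h
    · rw [h, elo_mk hab, ehi_mk hab]; exact ⟨le_rfl, hab.le⟩
    · rw [h, elo_mk hab, ehi_mk hab]; exact ⟨hab.le, le_rfl⟩
  · intro e he f hf h1 h2 h3
    obtain ⟨i, j, hij, hj, hi', hj'⟩ := hnat e he
    obtain ⟨k, m, hkm, hm, hk', hm'⟩ := hnat f hf
    have hce := hcase e
    have hcf := hcase f
    rw [hi', hj'] at hce
    rw [hk', hm'] at hcf
    rw [hj'] at h2
    rw [hj', hm'] at h3
    norm_cast at hce hcf h3
    rcases hce with ⟨he1, he2, he3⟩ | ⟨he1, he2⟩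
    · lia
    · rcases hcf with ⟨hf1, hf2, hf3⟩ | ⟨hf1, hf2⟩
      · rw [hf1] at h2; norm_cast at h2; lia
      · rw [he1, hf1] at h1
        rw [hf1] at h2
        norm_cast at h1 h2
        lia
  · intro e he f hf h1 h2 h3
    obtain ⟨i, j, hij, hj, hi', hj'⟩ := hnat e he
    obtain ⟨k, m, hkm, hm, hk', hm'⟩ := hnat f hf
    have hce := hcase e
    have hcf := hcase f
    rw [hi', hj'] at hce
    rw [hk', hm'] at hcf
    rw [hi', hk'] at h1
    rw [hk'] at h2
    norm_cast at hce hcf h1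
    rcases hce with ⟨he1, he2, he3⟩ | ⟨he1, he2⟩
    · rcases hcf with ⟨hf1, hf2, hf3⟩ | ⟨hf1, hf2⟩
      · lia
      · rw [he1, hf1] at h3; norm_cast at h3; lia
    · rw [he1] at h2; norm_cast at h2; lia

end ArcDual

/-- Let `G` be a (plane) triangulation with `n` vertices and `d`
vertices of degree three.  Then `G` admits a monotone plane arc diagram with at most
`n - d - 4` biarcs, where every biarc is down-up. -/
theorem triangulation_arc_diagram_degree_three {V : Type} [Fintype V]
    (G : SimpleGraph V) (hG : IsTriangulation G) :
    ∃ A : ArcDiagram V, A.IsPlaneOn G Set.univ ∧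
      A.biarcCount G Set.univ ≤
        Fintype.card V - {v : V | (G.neighborSet v).ncard = 3}.ncard - 4 := by
  classical
  obtain ⟨h3, hpl, hmax⟩ := hG
  rcases Nat.lt_or_ge (Fintype.card V) 5 with hn | hn
  · obtain ⟨pos, c, hp, hc⟩ := ArcDual.exists_pic_top (V := V) (by lia)
    have hp' := hp.mono (SimpleGraph.edgeSet_subset_edgeSet.2 (le_top : G ≤ ⊤))
    refine ⟨_, hp'.isPlaneOn, hp'.biarcCount.trans (le_of_eq_of_le ?_ (Nat.zero_le _))⟩
    refine (Set.ncard_eq_zero (Set.toFinite _)).2 (Set.eq_empty_of_forall_notMem ?_)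
    rintro e ⟨-, h1, h2⟩
    rcases hc e with h | h
    · exact h1.ne' h
    · exact h2.ne h
  · obtain ⟨T, hGT, hT⟩ := ArcDual.exists_maxDual (ArcDual.hasDual_of_isPlanar hpl)
    obtain ⟨k, l, r, hS⟩ := hT.exists_triSphere h3
    obtain ⟨E, β, L, hD, hE, hβ⟩ := hS.exists_dr hn
    obtain ⟨pos, c, hp, -, -, -, -, hb⟩ := hD.mono hE
    have hTpl := hp.isPlanar
    obtain rfl : G = T := by
      refine le_antisymm hGT fun a b hab => ?_
      by_contra hnab
      refine hmax a b hab.ne hnab (ArcDual.isPlanar_mono hTpl (sup_le hGT ?_))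
      intro x y hxy
      rw [SimpleGraph.fromEdgeSet_adj, Set.mem_singleton_iff, Sym2.eq_iff] at hxy
      rcases hxy.1 with ⟨rfl, rfl⟩ | ⟨rfl, rfl⟩
      · exact hab
      · exact hab.symm
    exact ⟨_, hp.isPlaneOn, hp.biarcCount.trans (hb.trans hβ)⟩
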